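/- Let N ≥ 3, let ρ : ℝ^N → ℝ be continuous, bounded and strictly positive, and assume the weighted Poincaré inequality holds with some constant C_p > 0. Let 1 < p < m, let q > 1, and let u0 ∈ L^q_ρ(ℝ^N) ∩ L^m_ρ(ℝ^N) with u0 ≥ 0. Then there exists a constant C(q) > 0 and, for every T > 0, a very weak solution u of ρ u_t = Δ(u^m) + ρ u^p in ℝ^N × (0,T) with initial datum u0, such that ‖u(t)‖_{L^q_ρ(ℝ^N)} ≤ e^{C(q) t} ‖u0‖_{L^q_ρ(ℝ^N)} for all t > 0. -/

import Mathlib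

open MeasureTheory

/-- The Laplacian of `f : ℝ^N → ℝ` at `x`, as the sum of the second derivatives of `f`
along the coordinate directions. -/
noncomputable def lap {N : ℕ} (f : EuclideanSpace ℝ (Fin N) → ℝ)
    (x : EuclideanSpace ℝ (Fin N)) : ℝ :=
  ∑ i : Fin N, deriv (deriv fun t : ℝ => f (x + t • EuclideanSpace.single i (1 : ℝ))) 0

/-- A (very) weak solution `u` of `ρ ∂_t u = Δ(u^m) + ρ u^p` on `ℝ^N × (0,T)` with
initial datum `u0`: `u` is nonnegative, measurable, `∫∫ u^m ρ < ∞`, and the weak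
formulation holds against every smooth compactly supported test function vanishing
at time `T`. -/
def IsVeryWeakSolution (N : ℕ) (m p T : ℝ)
    (ρ u0 : EuclideanSpace ℝ (Fin N) → ℝ) (u : EuclideanSpace ℝ (Fin N) → ℝ → ℝ) : Prop :=
  (∀ x t, 0 ≤ u x t) ∧
  Measurable (fun q : EuclideanSpace ℝ (Fin N) × ℝ => u q.1 q.2) ∧
  Integrable (fun q : EuclideanSpace ℝ (Fin N) × ℝ => u q.1 q.2 ^ m * ρ q.1)
    (volume.prod (volume.restrict (Set.Ioo 0 T))) ∧
  ∀ φ : EuclideanSpace ℝ (Fin N) × ℝ → ℝ, ContDiff ℝ (⊤ : ℕ∞) φ → HasCompactSupport φ →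
    (∀ x, φ (x, T) = 0) →
    -∫ t in Set.Ioo 0 T, ∫ x, u x t * deriv (fun s => φ (x, s)) t * ρ x =
      (∫ t in Set.Ioo 0 T, ∫ x, u x t ^ m * lap (fun y => φ (y, t)) x) +
      (∫ t in Set.Ioo 0 T, ∫ x, u x t ^ p * φ (x, t) * ρ x) +
      ∫ x, u0 x * φ (x, 0) * ρ x

namespace VWS

/-- A Lipschitz function vanishing at zero. -/
structure LF where
  f : ℝ → ℝ
  K : NNReal
  lip : LipschitzWith K f
  zero : f 0 = 0

variable {X : Type*} [MeasurableSpace X] {μ : Measure X}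

namespace LF

/-- Nemytskii operator. -/
noncomputable def app (g : LF) (u : Lp ℝ 2 μ) : Lp ℝ 2 μ := g.lip.compLp g.zero u

lemma coe_app (g : LF) (u : Lp ℝ 2 μ) : ∀ᵐ x ∂μ, g.app u x = g.f (u x) :=
  g.lip.coeFn_compLp g.zero u

lemma app_lip (g : LF) : LipschitzWith g.K (g.app : Lp ℝ 2 μ → Lp ℝ 2 μ) :=
  g.lip.lipschitzWith_compLp g.zero

lemma app_norm (g : LF) (u : Lp ℝ 2 μ) : ‖g.app u‖ ≤ g.K * ‖u‖ :=
  g.lip.norm_compLp_le g.zero u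

lemma app_cont (g : LF) : Continuous (g.app : Lp ℝ 2 μ → Lp ℝ 2 μ) := g.app_lip.continuous

lemma abs_sub (g : LF) (a b : ℝ) : |g.f a - g.f b| ≤ g.K * |a - b| := by
  have := g.lip.dist_le_mul a b
  simpa [Real.dist_eq] using this

lemma abs_le (g : LF) (a : ℝ) : |g.f a| ≤ g.K * |a| := by
  simpa [g.zero] using g.abs_sub a 0

lemma cont (g : LF) : Continuous g.f := g.lip.continuous

/-- primitive -/
noncomputable def prim (g : LF) (s : ℝ) : ℝ := ∫ r in (0 : ℝ)..s, g.f r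

lemma prim_zero (g : LF) : g.prim 0 = 0 := by simp [prim]

lemma prim_deriv (g : LF) (s : ℝ) : HasDerivAt g.prim (g.f s) s :=
  g.cont.integral_hasStrictDerivAt 0 s |>.hasDerivAt

lemma prim_cont (g : LF) : Continuous g.prim :=
  continuous_iff_continuousAt.2 fun s => (g.prim_deriv s).continuousAt

lemma prim_taylor (g : LF) (a b : ℝ) :
    |g.prim b - g.prim a - g.f a * (b - a)| ≤ g.K * (b - a) ^ 2 := by
  have h1 : ∀ x ∈ Set.uIcc a b, HasDerivWithinAt (fun s => g.prim s - g.f a * s)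
      (g.f x - g.f a * 1) (Set.uIcc a b) x := fun x _ =>
    ((g.prim_deriv x).sub ((hasDerivAt_id x).const_mul (g.f a))).hasDerivWithinAt
  have h2 : ∀ x ∈ Set.uIcc a b, ‖g.f x - g.f a * 1‖ ≤ g.K * |b - a| := by
    intro x hx
    rw [mul_one, Real.norm_eq_abs]
    refine (g.abs_sub x a).trans ?_
    exact mul_le_mul_of_nonneg_left (Set.abs_sub_left_of_mem_uIcc hx) g.K.2
  have := (convex_uIcc a b).norm_image_sub_le_of_norm_hasDerivWithin_le h1 h2
    Set.left_mem_uIcc Set.right_mem_uIcc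
  rw [Real.norm_eq_abs, Real.norm_eq_abs, mul_assoc, ← sq, sq_abs] at this
  refine le_trans (le_of_eq ?_) this
  congr 1; ring

lemma prim_abs_le (g : LF) (s : ℝ) : |g.prim s| ≤ g.K * s ^ 2 := by
  simpa [g.prim_zero, g.zero] using g.prim_taylor 0 s

lemma prim_integrable (g : LF) (u : Lp ℝ 2 μ) : Integrable (fun x => g.prim (u x)) μ := by
  refine ((Lp.memLp u).integrable_sq.const_mul (g.K : ℝ)).mono'
    (g.prim_cont.comp_aestronglyMeasurable (Lp.aestronglyMeasurable u)) ?_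
  exact Filter.Eventually.of_forall fun x => g.prim_abs_le _

end LF

lemma inner_eq (u v : Lp ℝ 2 μ) : inner ℝ u v = ∫ x, u x * v x ∂μ := by
  rw [L2.inner_def]
  congr 1; ext x; simp [mul_comm]

lemma integrable_mul (u v : Lp ℝ 2 μ) : Integrable (fun x => u x * v x) μ := by
  have := L2.integrable_inner (𝕜 := ℝ) u v
  refine this.congr (Filter.Eventually.of_forall fun x => by simp [mul_comm])

lemma inner_mono {u v u' v' : Lp ℝ 2 μ} (h : ∀ᵐ x ∂μ, u x * v x ≤ u' x * v' x) :
    inner ℝ u v ≤ inner ℝ u' v' := by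
  rw [inner_eq, inner_eq]
  exact integral_mono_ae (integrable_mul _ _) (integrable_mul _ _) h

lemma inner_nonneg' {u v : Lp ℝ 2 μ} (h : ∀ᵐ x ∂μ, 0 ≤ u x * v x) :
    0 ≤ inner ℝ u v := by
  rw [inner_eq]; exact integral_nonneg_of_ae h

lemma inner_nonpos' {u v : Lp ℝ 2 μ} (h : ∀ᵐ x ∂μ, u x * v x ≤ 0) :
    inner ℝ u v ≤ 0 := by
  rw [inner_eq]; exact integral_nonpos_of_ae h

lemma norm_sq_eq (u : Lp ℝ 2 μ) : ‖u‖ ^ 2 = ∫ x, u x ^ 2 ∂μ := by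
  rw [← real_inner_self_eq_norm_sq, inner_eq]; simp [sq]

namespace LF

lemma hasDerivAt_integral (g : LF) {u : ℝ → Lp ℝ 2 μ} {u' : Lp ℝ 2 μ} {t : ℝ}
    (hu : HasDerivAt u u' t) :
    HasDerivAt (fun s => ∫ x, g.prim (u s x) ∂μ) (inner ℝ (g.app (u t)) u') t := by
  have key : ∀ w v : Lp ℝ 2 μ, |(∫ x, g.prim (w x) ∂μ) - (∫ x, g.prim (v x) ∂μ)
      - inner ℝ (g.app v) (w - v)| ≤ g.K * ‖w - v‖ ^ 2 := by
    intro w v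
    have hi : Integrable (fun x => g.prim (w x) - g.prim (v x)) μ :=
      (g.prim_integrable _).sub (g.prim_integrable _)
    rw [inner_eq, norm_sq_eq, ← integral_const_mul, ← integral_sub (g.prim_integrable _) (g.prim_integrable _),
      ← integral_sub hi (integrable_mul _ _)]
    refine (abs_integral_le_integral_abs).trans ?_
    refine integral_mono_ae (((g.prim_integrable _).sub (g.prim_integrable _)).sub
      (integrable_mul _ _)).abs ((Lp.memLp (w - v)).integrable_sq.const_mul _) ?_
    filter_upwards [g.coe_app v, Lp.coeFn_sub w v] with x h1 h2
    simp only [h1, h2, Pi.sub_apply]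
    exact g.prim_taylor _ _
  have hF : HasFDerivAt (fun w : Lp ℝ 2 μ => ∫ x, g.prim (w x) ∂μ) (innerSL ℝ (g.app (u t))) (u t) := by
    rw [hasFDerivAt_iff_isLittleO]
    refine Asymptotics.IsBigO.trans_isLittleO (g := fun w => ‖w - u t‖ ^ 2) ?_ ?_
    · refine Asymptotics.IsBigO.of_bound (g.K) (Filter.Eventually.of_forall fun w => ?_)
      have := key w (u t)
      simpa using this
    · have h1 : (fun w : Lp ℝ 2 μ => ‖w - u t‖ ^ 2) = fun w => ‖w - u t‖ * ‖w - u t‖ := by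
        ext; ring
      rw [h1, ← Asymptotics.isLittleO_norm_right]
      have h2 : Asymptotics.IsLittleO (nhds (u t)) (fun w : Lp ℝ 2 μ => ‖w - u t‖) (fun _ => (1 : ℝ)) := by
        rw [Asymptotics.isLittleO_one_iff]
        have : Continuous fun w : Lp ℝ 2 μ => ‖w - u t‖ := by fun_prop
        simpa using this.tendsto (u t)
      simpa using h2.mul_isBigO (Asymptotics.isBigO_refl (fun w : Lp ℝ 2 μ => ‖w - u t‖) (nhds (u t)))
  have := hF.comp_hasDerivAt t hu
  rw [innerSL_apply_apply] at this
  exact this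

end LF
end VWS

namespace VWS

section hilbert
variable {L H : Type*} [NormedAddCommGroup L] [InnerProductSpace ℝ L] [CompleteSpace L]
  [NormedAddCommGroup H] [InnerProductSpace ℝ H] [CompleteSpace H]

/-- `B` is the inverse of `ι ι† + l`. -/
structure Res (ι : H →L[ℝ] L) (l : ℝ) (B : L →L[ℝ] L) : Prop where
  pos : 0 < l
  eq : ∀ f, ι (ι.adjoint (B f)) + l • B f = f

lemma exists_res (ι : H →L[ℝ] L) (l : ℝ) (hl : 0 < l) : ∃ B, Res ι l B := by
  let S : L →L[ℝ] L := ι ∘L ι.adjoint + l • ContinuousLinearMap.id ℝ L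
  have hS : ∀ f, S f = ι (ι.adjoint f) + l • f := fun f => by simp [S]
  let b : L →L[ℝ] L →L[ℝ] ℝ := (innerSL ℝ) ∘L S
  have hb : ∀ f g, b f g = inner ℝ (S f) g := fun f g => rfl
  have hc : IsCoercive b := by
    refine ⟨l, hl, fun u => ?_⟩
    rw [hb, hS, inner_add_left, real_inner_smul_left, real_inner_self_eq_norm_sq,
      ← ContinuousLinearMap.adjoint_inner_right, real_inner_self_eq_norm_sq]
    nlinarith [sq_nonneg ‖ι.adjoint u‖]
  refine ⟨hc.continuousLinearEquivOfBilin.symm, hl, fun f => ?_⟩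
  have h1 : ∀ v, hc.continuousLinearEquivOfBilin v = S v := fun v => by
    refine ext_inner_right ℝ fun w => ?_
    rw [hc.continuousLinearEquivOfBilin_apply, hb]
  have := h1 (hc.continuousLinearEquivOfBilin.symm f)
  simp only [ContinuousLinearEquiv.apply_symm_apply, hS] at this
  exact this.symm

namespace Res
variable {ι : H →L[ℝ] L} {l : ℝ} {B : L →L[ℝ] L}

lemma symm (h : Res ι l B) (f g : L) : inner ℝ (B f) g = inner ℝ f (B g) := by
  conv_lhs => rw [← h.eq g]
  conv_rhs => rw [← h.eq f]
  rw [inner_add_left, inner_add_right, real_inner_smul_left, real_inner_smul_right,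
    ← ContinuousLinearMap.adjoint_inner_left ι, ← ContinuousLinearMap.adjoint_inner_right ι]

lemma coercive (h : Res ι l B) {k : ℝ} (hk : ‖ι‖ ^ 2 + 2 * l ≤ k) (f : L) :
    ‖f‖ ^ 2 ≤ k * inner ℝ f (B f) := by
  set y := B f with hy
  have hf : f = ι (ι.adjoint y) + l • y := (h.eq f).symm
  have e1 : inner ℝ f y = ‖ι.adjoint y‖ ^ 2 + l * ‖y‖ ^ 2 := by
    rw [hf, inner_add_left, real_inner_smul_left, real_inner_self_eq_norm_sq,
      ← ContinuousLinearMap.adjoint_inner_right, real_inner_self_eq_norm_sq]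
  have e2 : ‖f‖ ^ 2 = ‖ι (ι.adjoint y)‖ ^ 2 + 2 * l * ‖ι.adjoint y‖ ^ 2 + l ^ 2 * ‖y‖ ^ 2 := by
    rw [hf, norm_add_sq_real, real_inner_smul_right,
      ← ContinuousLinearMap.adjoint_inner_right, real_inner_self_eq_norm_sq, norm_smul, mul_pow,
      Real.norm_eq_abs, sq_abs]
    ring
  have e3 : ‖ι (ι.adjoint y)‖ ^ 2 ≤ ‖ι‖ ^ 2 * ‖ι.adjoint y‖ ^ 2 := by
    rw [← mul_pow]; gcongr; exact ι.le_opNorm _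
  have hl := h.pos
  have h4 : (‖ι‖ ^ 2 + 2 * l) * inner ℝ f y ≤ k * inner ℝ f y := by
    apply mul_le_mul_of_nonneg_right hk; rw [e1]; positivity
  rw [e1] at *
  nlinarith [mul_nonneg (sq_nonneg ‖ι‖) (mul_nonneg hl.le (sq_nonneg ‖y‖)), mul_nonneg hl.le (mul_nonneg hl.le (sq_nonneg ‖y‖))]

lemma minim (h : Res ι l B) (f : L) (k : H) :
    ‖ι k - f‖ ^ 2 + l * ‖k‖ ^ 2 = ‖ι (ι.adjoint (B f)) - f‖ ^ 2 + l * ‖ι.adjoint (B f)‖ ^ 2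
      + ‖ι (k - ι.adjoint (B f))‖ ^ 2 + l * ‖k - ι.adjoint (B f)‖ ^ 2 := by
  set y := B f with hy
  set g := ι.adjoint y with hg
  obtain ⟨d, rfl⟩ : ∃ d, k = g + d := ⟨k - g, by abel⟩
  have e1 : ι g - f = - (l • y) := by
    rw [← h.eq f]; abel
  have e2 : ι (g + d) - f = ι d - l • y := by
    rw [map_add, add_sub_right_comm, e1]; abel
  have e3 : inner ℝ g d = inner ℝ (ι d) y := by
    rw [hg, ContinuousLinearMap.adjoint_inner_left, real_inner_comm]
  rw [e1, e2, add_sub_cancel_left, norm_sub_sq_real, norm_add_sq_real, norm_neg,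
    real_inner_smul_right, e3]
  ring

end Res
end hilbert

/-- the reflection at level one -/
noncomputable def refl : LF where
  f s := 1 - |1 - s|
  K := 1
  lip := by
    apply LipschitzWith.of_dist_le_mul
    intro a b
    rw [Real.dist_eq, Real.dist_eq, NNReal.coe_one, one_mul]
    have := abs_abs_sub_abs_le_abs_sub (1 - b) (1 - a)
    calc _ = |(|1 - b| - |1 - a|)| := by congr 1; ring
      _ ≤ _ := this
      _ = _ := by congr 1; ring
  zero := by simp

variable {X : Type*} [MeasurableSpace X] {μ : Measure X}
variable {H : Type*} [NormedAddCommGroup H] [InnerProductSpace ℝ H] [CompleteSpace H]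

/-- normal contraction property -/
def NC (ι : H →L[ℝ] Lp ℝ 2 μ) : Prop :=
  ∀ h : H, ∀ ε > 0, ∃ h' : H, ‖h'‖ ≤ ‖h‖ + ε ∧ ‖ι h' - refl.app (ι h)‖ ≤ ε

lemma markov_one {ι : H →L[ℝ] Lp ℝ 2 μ} {l : ℝ} {B} (h : Res ι l B) (hnc : NC ι)
    (f : Lp ℝ 2 μ) (hf : ∀ᵐ x ∂μ, f x ≤ 1) : ∀ᵐ x ∂μ, f x - l * B f x ≤ 1 := by
  set g := ι.adjoint (B f) with hg
  have hl := h.pos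
  set D := ‖refl.app (ι g) - ι g‖ with hD
  have hT : ‖refl.app (ι g) - f‖ ≤ ‖ι g - f‖ := by
    refine Lp.norm_le_norm_of_ae_le ?_
    filter_upwards [refl.coe_app (ι g), Lp.coeFn_sub (refl.app (ι g)) f, Lp.coeFn_sub (ι g) f, hf]
      with x h1 h2 h3 h4
    rw [h2, h3, Pi.sub_apply, Pi.sub_apply, h1]
    simp only [refl, Real.norm_eq_abs]
    rcases abs_cases (1 - (ι g) x) with h5 | h5 <;> rcases abs_cases ((ι g) x - f x) with h6 | h6 <;>
      (rw [h5.1, h6.1, abs_le]; constructor <;> linarith)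
  have key : ∀ ε : ℝ, 0 < ε → ε ≤ 1 →
      D ^ 2 ≤ ε * (2 + 2 * (2 * ‖ι g - f‖ + 1 + 2 * l * ‖g‖ + l)) := by
    intro ε he he1
    obtain ⟨k, hk1, hk2⟩ := hnc g ε he
    have h1 := h.minim f k
    rw [← hg] at h1
    have h2 : ‖ι k - f‖ ≤ ‖ι g - f‖ + ε := by
      calc _ = ‖(ι k - refl.app (ι g)) + (refl.app (ι g) - f)‖ := by congr 1; abel
        _ ≤ _ := norm_add_le _ _
        _ ≤ _ := by linarith
    have h3 : ‖ι k - f‖ ^ 2 ≤ (‖ι g - f‖ + ε) ^ 2 := by gcongr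
    have h4 : ‖k‖ ^ 2 ≤ (‖g‖ + ε) ^ 2 := by gcongr
    have h5 : l * ‖k‖ ^ 2 ≤ l * (‖g‖ + ε) ^ 2 := by gcongr
    have h6 : D ≤ ε + ‖ι (k - g)‖ := by
      calc D = ‖(ι k - ι g) - (ι k - refl.app (ι g))‖ := by rw [hD]; congr 1; abel
        _ ≤ _ := norm_sub_le _ _
        _ ≤ _ := by rw [map_sub]; linarith
    have h7 : D ^ 2 ≤ (ε + ‖ι (k - g)‖) ^ 2 := by gcongr
    have h8 : D ^ 2 ≤ 2 * ε ^ 2 + 2 * ‖ι (k - g)‖ ^ 2 := by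
      nlinarith [sq_nonneg (ε - ‖ι (k - g)‖)]
    have h9 : 0 ≤ l * ‖k - g‖ ^ 2 := by positivity
    have h10 : ε ^ 2 ≤ ε := by nlinarith
    have h11 : l * ε ^ 2 ≤ l * ε := by gcongr
    nlinarith
  have hD0 : D ^ 2 ≤ 0 := by
    refine le_of_forall_pos_le_add fun δ hδ => ?_
    set C := (2 + 2 * (2 * ‖ι g - f‖ + 1 + 2 * l * ‖g‖ + l)) with hC
    have hCp : 0 < C := by positivity
    refine (key (min 1 (δ / C)) (by positivity) (min_le_left _ _)).trans ?_
    calc min 1 (δ / C) * C ≤ δ / C * C := by gcongr; exact min_le_right _ _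
      _ = 0 + δ := by field_simp; ring
  have hD1 : refl.app (ι g) - ι g = 0 := by
    rw [← norm_eq_zero, ← hD]; exact pow_eq_zero_iff (two_ne_zero) |>.1 (le_antisymm hD0 (sq_nonneg _))
  rw [sub_eq_zero] at hD1
  have e1 : ι g = f - l • B f := by rw [eq_sub_iff_add_eq]; exact h.eq f
  filter_upwards [refl.coe_app (ι g), Lp.coeFn_sub f (l • B f), Lp.coeFn_smul l (B f)] with x h1 h2 h3
  rw [hD1, e1, h2, Pi.sub_apply, h3, Pi.smul_apply, smul_eq_mul] at h1
  simp only [refl] at h1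
  have := abs_nonneg (1 - (f x - l * B f x))
  linarith

/-- symmetric sub-Markov operators -/
structure Markov (J : Lp ℝ 2 μ →L[ℝ] Lp ℝ 2 μ) : Prop where
  symm : ∀ f g, inner ℝ (J f) g = inner ℝ f (J g)
  sub : ∀ f : Lp ℝ 2 μ, ∀ c : ℝ, 0 ≤ c → (∀ᵐ x ∂μ, f x ≤ c) → ∀ᵐ x ∂μ, J f x ≤ c

lemma Markov.nonneg {J : Lp ℝ 2 μ →L[ℝ] Lp ℝ 2 μ} (hJ : Markov J) (f : Lp ℝ 2 μ)
    (hf : ∀ᵐ x ∂μ, 0 ≤ f x) : ∀ᵐ x ∂μ, 0 ≤ J f x := by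
  have := hJ.sub (-f) 0 le_rfl (by
    filter_upwards [hf, Lp.coeFn_neg f] with x h1 h2
    rw [h2]; simpa using h1)
  rw [map_neg] at this
  filter_upwards [this, Lp.coeFn_neg (J f)] with x h1 h2
  rw [h2] at h1; simpa using h1

lemma Res.markov {ι : H →L[ℝ] Lp ℝ 2 μ} {l : ℝ} {B} (h : Res ι l B) (hnc : NC ι) :
    Markov (ContinuousLinearMap.id ℝ _ - l • B) := by
  constructor
  · intro f g
    simp [inner_sub_left, inner_sub_right, real_inner_smul_left, real_inner_smul_right, h.symm f g]
  · intro f c hc hf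
    have key : ∀ a : ℝ, (∀ᵐ x ∂μ, a * f x ≤ 1) → ∀ᵐ x ∂μ, a * (f x - l * B f x) ≤ 1 := by
      intro a ha
      have := markov_one h hnc (a • f) (by
        filter_upwards [ha, Lp.coeFn_smul a f] with x h1 h2
        rw [h2]; exact h1)
      rw [map_smul] at this
      filter_upwards [this, Lp.coeFn_smul a f, Lp.coeFn_smul a (B f)] with x h1 h2 h3
      rw [h2, h3] at h1
      simp only [Pi.smul_apply, smul_eq_mul] at h1
      linarith
    have main : ∀ᵐ x ∂μ, f x - l * B f x ≤ c := by
      rcases hc.eq_or_lt with rfl | hc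
      · have : ∀ n : ℕ, ∀ᵐ x ∂μ, (n : ℝ) * (f x - l * B f x) ≤ 1 := fun n => key n (by
          filter_upwards [hf] with x h1
          have : (n : ℝ) * f x ≤ 0 := mul_nonpos_of_nonneg_of_nonpos (by positivity) h1
          linarith)
        filter_upwards [ae_all_iff.2 this] with x hx
        by_contra hcon
        push Not at hcon
        obtain ⟨n, hn⟩ := exists_nat_gt (1 / (f x - l * B f x))
        rw [div_lt_iff₀ hcon] at hn
        exact absurd (hx n) (not_le.2 hn)
      · have := key c⁻¹ (by
          filter_upwards [hf] with x h1
          rw [inv_mul_le_iff₀ hc]; simpa using h1)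
        filter_upwards [this] with x h1
        rw [inv_mul_le_iff₀ hc] at h1; simpa using h1
    filter_upwards [main, Lp.coeFn_sub f (l • B f), Lp.coeFn_smul l (B f)] with x h1 h2 h3
    have e : (ContinuousLinearMap.id ℝ (Lp ℝ 2 μ) - l • B) f = f - l • B f := by simp
    rw [e, h2, Pi.sub_apply, h3]
    simpa using h1

lemma finite_id {ι' : Type*} [Fintype ι'] (M a b : ι' → ℝ) (J : ι' → ι' → ℝ)
    (hJ : ∀ c d, J c d = J d c) :
    ∑ c, M c * (a c * b c) - ∑ c, ∑ d, J c d * (a c * b d) =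
      ∑ c, (M c - ∑ d, J c d) * (a c * b c) +
        (1 / 2) * ∑ c, ∑ d, J c d * ((a c - a d) * (b c - b d)) := by
  have e1 : ∑ c, ∑ d, J c d * (a d * b d) = ∑ c, ∑ d, J c d * (a c * b c) := by
    rw [Finset.sum_comm]
    simp_rw [hJ]
  have e2 : ∑ c, ∑ d, J c d * (a d * b c) = ∑ c, ∑ d, J c d * (a c * b d) := by
    rw [Finset.sum_comm]
    simp_rw [hJ]
  have e3 : ∑ c, ∑ d, J c d * ((a c - a d) * (b c - b d)) =
      ∑ c, ∑ d, J c d * (a c * b c) + ∑ c, ∑ d, J c d * (a d * b d)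
       - ∑ c, ∑ d, J c d * (a d * b c) - ∑ c, ∑ d, J c d * (a c * b d) := by
    simp_rw [← Finset.sum_add_distrib, ← Finset.sum_sub_distrib]
    refine Finset.sum_congr rfl fun c _ => Finset.sum_congr rfl fun d _ => by ring
  have e4 : ∑ c, (M c - ∑ d, J c d) * (a c * b c) =
      ∑ c, M c * (a c * b c) - ∑ c, ∑ d, J c d * (a c * b c) := by
    rw [← Finset.sum_sub_distrib]
    refine Finset.sum_congr rfl fun c _ => by rw [sub_mul, Finset.sum_mul]
  rw [e3, e4, e1, e2]; ring

lemma finite_sv {ι' : Type*} [Fintype ι'] (M a b g : ι' → ℝ) (J : ι' → ι' → ℝ)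
    (hJ : ∀ c d, J c d = J d c) (hJ0 : ∀ c d, 0 ≤ J c d) (hM : ∀ c, ∑ d, J c d ≤ M c)
    (h0 : ∀ c, g c * g c ≤ a c * b c)
    (h1 : ∀ c d, (g c - g d) * (g c - g d) ≤ (a c - a d) * (b c - b d)) :
    ∑ c, M c * (g c * g c) - ∑ c, ∑ d, J c d * (g c * g d) ≤
      ∑ c, M c * (a c * b c) - ∑ c, ∑ d, J c d * (a c * b d) := by
  rw [finite_id _ _ _ _ hJ, finite_id _ _ _ _ hJ]
  refine add_le_add (Finset.sum_le_sum fun c _ => ?_) ?_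
  · exact mul_le_mul_of_nonneg_left (h0 c) (sub_nonneg.2 (hM c))
  · refine mul_le_mul_of_nonneg_left ?_ (by norm_num)
    exact Finset.sum_le_sum fun c _ => Finset.sum_le_sum fun d _ =>
      mul_le_mul_of_nonneg_left (h1 c d) (hJ0 c d)

lemma coeFn_sum' {ι' : Type*} (s : Finset ι') (e : ι' → Lp ℝ 2 μ) :
    ∀ᵐ x ∂μ, (∑ c ∈ s, e c : Lp ℝ 2 μ) x = ∑ c ∈ s, e c x := by
  classical
  induction s using Finset.induction_on with
  | empty =>
    filter_upwards [Lp.coeFn_zero ℝ 2 μ] with x hx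
    simpa using hx
  | insert a s ha ih =>
    rw [Finset.sum_insert ha]
    filter_upwards [ih, Lp.coeFn_add (e a) (∑ c ∈ s, e c)] with x h1 h2
    rw [h2, Pi.add_apply, h1, Finset.sum_insert ha]

/-- Stroock-Varopoulos inequality -/
lemma Markov.sv {J : Lp ℝ 2 μ →L[ℝ] Lp ℝ 2 μ} (hJ : Markov J) (a b g : LF)
    (hab : ∀ s t, (g.f s - g.f t) * (g.f s - g.f t) ≤ (a.f s - a.f t) * (b.f s - b.f t))
    (u : Lp ℝ 2 μ) :
    inner ℝ (g.app u) (g.app u) - inner ℝ (g.app u) (J (g.app u)) ≤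
      inner ℝ (a.app u) (b.app u) - inner ℝ (a.app u) (J (b.app u)) := by
  have hclosed : IsClosed {u : Lp ℝ 2 μ | inner ℝ (g.app u) (g.app u) - inner ℝ (g.app u) (J (g.app u)) ≤
      inner ℝ (a.app u) (b.app u) - inner ℝ (a.app u) (J (b.app u))} := by
    have ha := a.app_cont (μ := μ)
    have hb := b.app_cont (μ := μ)
    have hg := g.app_cont (μ := μ)
    refine isClosed_le ?_ ?_ <;> fun_prop
  refine (Lp.simpleFunc.denseRange (E := ℝ) (μ := μ) (p := 2) (by norm_num)).induction_on
    (p := fun u => inner ℝ (g.app u) (g.app u) - inner ℝ (g.app u) (J (g.app u)) ≤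
      inner ℝ (a.app u) (b.app u) - inner ℝ (a.app u) (J (b.app u))) u hclosed ?_
  intro u
  classical
  set s := Lp.simpleFunc.toSimpleFunc u with hs
  have hus : ∀ᵐ x ∂μ, s x = (u : Lp ℝ 2 μ) x := Lp.simpleFunc.toSimpleFunc_eq_toFun u
  have hmem : MemLp s 2 μ := Lp.simpleFunc.memLp u
  let R := {c : ℝ // c ∈ s.range.filter (fun c => c ≠ 0)}
  let _ : Fintype R := Finset.fintypeCoeSort _
  have hfin : ∀ c : R, μ (s ⁻¹' {c.1}) ≠ ⊤ := fun c =>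
    (SimpleFunc.measure_preimage_lt_top_of_memLp (by norm_num) (by norm_num) s hmem c.1
      (Finset.mem_filter.1 c.2).2).ne
  let e : R → Lp ℝ 2 μ := fun c => indicatorConstLp 2 (s.measurableSet_fiber c.1) (hfin c) (1 : ℝ)
  have he : ∀ᵐ x ∂μ, ∀ c : R, e c x = if s x = c.1 then 1 else 0 := by
    refine ae_all_iff.2 fun c => ?_
    filter_upwards [indicatorConstLp_coeFn (p := 2) (hs := s.measurableSet_fiber c.1) (hμs := hfin c) (c := (1 : ℝ))]
      with x hx
    rw [hx, Set.indicator_apply]; rfl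
  have hrep : ∀ k : LF, k.app (u : Lp ℝ 2 μ) = ∑ c : R, k.f c.1 • e c := by
    intro k
    refine Lp.ext ?_
    filter_upwards [k.coe_app (u : Lp ℝ 2 μ), hus, he, coeFn_sum' Finset.univ (fun c : R => k.f c.1 • e c),
      ae_all_iff.2 fun c : R => Lp.coeFn_smul (k.f c.1) (e c)] with x h1 h2 h3 h4 h5
    rw [h1, h4, ← h2]
    simp only [h5, Pi.smul_apply, h3, smul_eq_mul, mul_ite, mul_one, mul_zero]
    by_cases h0 : s x = 0
    · rw [h0, k.zero, Finset.sum_eq_zero]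
      intro c _
      rw [if_neg]
      exact fun h => (Finset.mem_filter.1 c.2).2 h.symm
    · rw [Finset.sum_eq_single (⟨s x, Finset.mem_filter.2 ⟨SimpleFunc.mem_range_self s x, h0⟩⟩ : R)]
      · simp
      · intro c _ hc
        rw [if_neg]
        exact fun h => hc (Subtype.ext h.symm)
      · simp
  have horth : ∀ c d : R, c ≠ d → inner ℝ (e c) (e d) = 0 := by
    intro c d hcd
    rw [inner_eq]
    refine integral_eq_zero_of_ae ?_
    filter_upwards [he] with x hx
    rw [hx, hx]
    by_cases h : s x = c.1
    · have : s x ≠ d.1 := fun h' => hcd (Subtype.ext (h.symm.trans h'))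
      simp [this]
    · simp [h]
  have hJe : ∀ c d : R, 0 ≤ inner ℝ (e c) (J (e d)) := by
    intro c d
    refine inner_nonneg' ?_
    have := hJ.nonneg (e d) (by
      filter_upwards [he] with x hx
      rw [hx]; split_ifs <;> norm_num)
    filter_upwards [he, this] with x hx h1
    rw [hx]; split_ifs <;> simp [h1]
  have hsum : ∀ c : R, ∑ d, inner ℝ (e c) (J (e d)) ≤ inner ℝ (e c) (e c) := by
    intro c
    rw [← inner_sum, ← map_sum]
    refine inner_mono ?_
    have := hJ.sub (∑ d, e d) 1 zero_le_one (by
      filter_upwards [he, coeFn_sum' Finset.univ e] with x h1 h2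
      rw [h2]
      simp only [h1]
      by_cases h0 : ∃ d : R, s x = d.1
      · obtain ⟨d, hd⟩ := h0
        rw [Finset.sum_eq_single d]
        · split_ifs <;> norm_num
        · intro c _ hc
          rw [if_neg]
          exact fun h => hc (Subtype.ext (h.symm.trans hd))
        · simp
      · rw [Finset.sum_eq_zero]
        · norm_num
        · intro d _
          rw [if_neg]
          exact fun h => h0 ⟨d, h⟩)
    filter_upwards [he, this] with x hx h1
    rw [hx]; split_ifs
    · rw [one_mul, mul_one]; exact h1
    · simp
  have hexp : ∀ k k' : LF, inner ℝ (k.app (u : Lp ℝ 2 μ)) (k'.app (u : Lp ℝ 2 μ))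
      - inner ℝ (k.app (u : Lp ℝ 2 μ)) (J (k'.app (u : Lp ℝ 2 μ))) =
      ∑ c : R, inner ℝ (e c) (e c) * (k.f c.1 * k'.f c.1)
        - ∑ c : R, ∑ d : R, inner ℝ (e c) (J (e d)) * (k.f c.1 * k'.f d.1) := by
    intro k k'
    rw [hrep k, hrep k', map_sum, sum_inner, sum_inner]
    simp_rw [inner_sum, map_smul, real_inner_smul_left, real_inner_smul_right]
    congr 1
    · refine Finset.sum_congr rfl fun c _ => ?_
      rw [Finset.sum_eq_single c]
      · ring
      · intro d _ hd
        rw [horth c d (Ne.symm hd)]; ring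
      · simp
    · refine Finset.sum_congr rfl fun c _ => Finset.sum_congr rfl fun d _ => by ring
  rw [hexp, hexp]
  refine finite_sv _ _ _ _ _ ?_ hJe hsum ?_ ?_
  · intro c d
    rw [← hJ.symm, real_inner_comm]
  · intro c
    simpa [a.zero, b.zero, g.zero] using hab c.1 0
  · intro c d
    exact hab _ _

end VWS

namespace VWS

lemma exists_ode {E : Type*} [NormedAddCommGroup E] [NormedSpace ℝ E] [CompleteSpace E]
    (V : E → E) (K : NNReal) (hV : LipschitzWith K V) (x0 : E) (T : ℝ) (hT : 0 ≤ T) :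
    ∃ u : ℝ → E, Continuous u ∧ u 0 = x0 ∧ ∀ t ∈ Set.Icc 0 T, HasDerivAt u (V (u t)) t := by
  set c : ℝ := 2 * K + 1 with hc
  have hc0 : 0 < c := by positivity
  let ext : C(Set.Icc (0 : ℝ) T, E) → ℝ → E := fun w s => Real.exp (c * s) • w (Set.projIcc 0 T hT s)
  have hext : ∀ w, Continuous (ext w) := fun w => by
    have h1 : Continuous (fun s => w (Set.projIcc 0 T hT s)) := w.continuous.comp continuous_projIcc
    have h2 : Continuous fun s : ℝ => Real.exp (c * s) := by fun_prop
    exact h2.smul h1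
  let U : C(Set.Icc (0 : ℝ) T, E) → ℝ → E := fun w t => x0 + ∫ s in (0 : ℝ)..t, V (ext w s)
  have hUd : ∀ w t, HasDerivAt (U w) (V (ext w t)) t := fun w t =>
    (((hV.continuous.comp (hext w)).integral_hasStrictDerivAt 0 t).hasDerivAt).const_add x0
  have hUc : ∀ w, Continuous (U w) := fun w =>
    continuous_iff_continuousAt.2 fun t => (hUd w t).continuousAt
  let Ψ : C(Set.Icc (0 : ℝ) T, E) → C(Set.Icc (0 : ℝ) T, E) := fun w =>
    ⟨fun t => Real.exp (-(c * t)) • U w t, by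
      have h2 : Continuous fun t : Set.Icc (0 : ℝ) T => Real.exp (-(c * (t : ℝ))) := by fun_prop
      exact h2.smul ((hUc w).comp continuous_subtype_val)⟩
  have hcon : ContractingWith (1 / 2) Ψ := by
    refine ⟨by rw [← NNReal.coe_lt_coe]; norm_num, ?_⟩
    refine LipschitzWith.of_dist_le_mul fun w z => ?_
    rw [ContinuousMap.dist_le (by positivity)]
    rintro ⟨t, ht0, htT⟩
    have hd0 : 0 ≤ dist w z := dist_nonneg
    have e1 : U w t - U z t = ∫ s in (0 : ℝ)..t, (V (ext w s) - V (ext z s)) := by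
      simp only [U]
      rw [intervalIntegral.integral_sub (f := fun s => V (ext w s)) (g := fun s => V (ext z s)) ((hV.continuous.comp (hext w)).intervalIntegrable _ _)
        ((hV.continuous.comp (hext z)).intervalIntegrable _ _)]
      abel
    have e2 : ∫ s in (0 : ℝ)..t, (K * dist w z) * Real.exp (c * s) =
        (K * dist w z) * (Real.exp (c * t) / c - 1 / c) := by
      rw [intervalIntegral.integral_const_mul]
      congr 1
      rw [intervalIntegral.integral_eq_sub_of_hasDerivAt (f := fun s => Real.exp (c * s) / c)]
      · simp
      · intro x _
        have := (((hasDerivAt_id x).const_mul c).exp).div_const c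
        refine this.congr_deriv ?_
        simp only [id, mul_one]; field_simp
      · exact Continuous.intervalIntegrable (by fun_prop) _ _
    have e3 : ‖U w t - U z t‖ ≤ (K * dist w z) * (Real.exp (c * t) / c - 1 / c) := by
      rw [e1, ← e2]
      refine intervalIntegral.norm_integral_le_of_norm_le ht0 (Filter.Eventually.of_forall fun s _ => ?_)
        (Continuous.intervalIntegrable (by fun_prop) _ _)
      rw [← dist_eq_norm]
      refine (hV.dist_le_mul _ _).trans ?_
      rw [mul_assoc]
      refine mul_le_mul_of_nonneg_left ?_ K.2
      simp only [ext]
      rw [dist_eq_norm, ← smul_sub, norm_smul, Real.norm_eq_abs, abs_of_pos (Real.exp_pos _), mul_comm,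
        ← dist_eq_norm]
      exact mul_le_mul_of_nonneg_right (ContinuousMap.dist_apply_le_dist _) (Real.exp_pos _).le
    change dist (Real.exp (-(c * t)) • U w t) (Real.exp (-(c * t)) • U z t) ≤ _
    rw [dist_eq_norm, ← smul_sub, norm_smul, Real.norm_eq_abs, abs_of_pos (Real.exp_pos _), Real.exp_neg]
    have hE := Real.exp_pos (c * t)
    rw [inv_mul_le_iff₀ hE]
    refine e3.trans ?_
    have hK : (K : ℝ) / c ≤ 1 / 2 := by
      rw [div_le_iff₀ hc0]; linarith
    calc K * dist w z * (Real.exp (c * t) / c - 1 / c) ≤ K * dist w z * (Real.exp (c * t) / c) := by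
          gcongr
          have : 0 < 1 / c := by positivity
          linarith
      _ = (K / c) * (dist w z * Real.exp (c * t)) := by ring
      _ ≤ (1 / 2) * (dist w z * Real.exp (c * t)) := by gcongr
      _ = _ := by push_cast; ring
  have hfix := hcon.fixedPoint_isFixedPt
  set w := ContractingWith.fixedPoint Ψ hcon with hw
  refine ⟨U w, hUc w, by simp [U], fun t ht => ?_⟩
  have : ext w t = U w t := by
    simp only [ext]
    rw [Set.projIcc_of_mem hT ht]
    have h1 : w ⟨t, ht⟩ = Real.exp (-(c * t)) • U w t := by
      conv_lhs => rw [← hfix]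
      rfl
    rw [h1, smul_smul, ← Real.exp_add]; simp
  rw [← this]; exact hUd w t

/-- Gronwall -/
lemma gronwall (y y' : ℝ → ℝ) (C T : ℝ) (hT : 0 ≤ T) (hd : ∀ t ∈ Set.Icc 0 T, HasDerivAt y (y' t) t)
    (hle : ∀ t ∈ Set.Icc 0 T, y' t ≤ C * y t) : ∀ t ∈ Set.Icc 0 T, y t ≤ Real.exp (C * t) * y 0 := by
  have hz : ∀ t ∈ Set.Icc 0 T, HasDerivAt (fun t => Real.exp (-(C * t)) * y t)
      (Real.exp (-(C * t)) * (-(C * 1)) * y t + Real.exp (-(C * t)) * y' t) t := fun t ht =>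
    (((hasDerivAt_id t).const_mul C).neg.exp).mul (hd t ht)
  have hanti : AntitoneOn (fun t => Real.exp (-(C * t)) * y t) (Set.Icc 0 T) := by
    refine antitoneOn_of_deriv_nonpos (convex_Icc 0 T) (fun t ht => (hz t ht).continuousAt.continuousWithinAt)
      (fun t ht => (hz t (interior_subset ht)).differentiableAt.differentiableWithinAt) fun t ht => ?_
    have ht' := interior_subset ht
    rw [(hz t ht').deriv]
    have := mul_le_mul_of_nonneg_left (hle t ht') (Real.exp_pos (-(C * t))).le
    linarith
  intro t ht
  have := hanti (Set.left_mem_Icc.2 hT) ht ht.1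
  simp only [mul_zero, neg_zero, Real.exp_zero, one_mul] at this
  rw [Real.exp_neg, inv_mul_le_iff₀ (Real.exp_pos _)] at this
  exact this

end VWS

namespace VWS

/-- truncation to `[0,n]` -/
noncomputable def clamp (n s : ℝ) : ℝ := max (min s n) 0

lemma clamp_lip (n : ℝ) : LipschitzWith 1 (clamp n) :=
  ((LipschitzWith.id).min_const n).max_const 0

lemma clamp_eq {n s : ℝ} (h0 : 0 ≤ s) (h1 : s ≤ n) : clamp n s = s := by
  simp [clamp, h0, h1]

lemma clamp_nonneg (n s : ℝ) : 0 ≤ clamp n s := le_max_right _ _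

lemma clamp_le {n : ℝ} (hn : 0 ≤ n) (s : ℝ) : clamp n s ≤ n := max_le (min_le_right _ _) hn

lemma clamp_mono (n : ℝ) : Monotone (clamp n) := fun _ _ h =>
  max_le_max (min_le_min h le_rfl) le_rfl

lemma exists_pow (n ε β : ℝ) (hn : 0 ≤ n) (hβ : 0 < β) (hε : 0 < ε ∨ ε = 0 ∧ 1 ≤ β) :
    ∃ g : LF, ∀ s, g.f s = (max (clamp n s) ε) ^ β - ε ^ β := by
  have hε0 : 0 ≤ ε := by
    rcases hε with h | h
    · exact h.le
    · exact h.1.ge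
  have hne : ∀ x ∈ Set.Icc ε (max n ε), x ≠ 0 ∨ 1 ≤ β := by
    intro x hx
    rcases hε with h | h
    · exact Or.inl (by linarith [hx.1])
    · exact Or.inr h.2
  obtain ⟨C, hC⟩ := (isCompact_Icc (a := ε) (b := max n ε)).exists_bound_of_continuousOn
    (f := fun x : ℝ => β * x ^ (β - 1)) (by
      refine continuousOn_const.mul (continuousOn_id.rpow_const fun x hx => ?_)
      rcases hne x hx with h | h
      · exact Or.inl h
      · exact Or.inr (by linarith))
  have hlip : LipschitzOnWith C.toNNReal (fun x : ℝ => x ^ β) (Set.Icc ε (max n ε)) := by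
    refine (convex_Icc _ _).lipschitzOnWith_of_nnnorm_hasDerivWithin_le
      (f' := fun x => β * x ^ (β - 1)) (fun x hx =>
        (Real.hasDerivAt_rpow_const (hne x hx)).hasDerivWithinAt) fun x hx => ?_
    rw [← NNReal.coe_le_coe, coe_nnnorm]
    exact (hC x hx).trans (Real.le_coe_toNNReal C)
  have hX : LipschitzWith 1 (fun s => max (clamp n s) ε) := (clamp_lip n).max_const ε
  have hm : ∀ s, max (clamp n s) ε ∈ Set.Icc ε (max n ε) := fun s =>
    ⟨le_max_right _ _, max_le_max (clamp_le hn s) le_rfl⟩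
  refine ⟨⟨fun s => (max (clamp n s) ε) ^ β - ε ^ β, C.toNNReal, ?_, ?_⟩, fun s => rfl⟩
  · refine LipschitzWith.of_dist_le_mul fun a b => ?_
    rw [dist_sub_right]
    refine (hlip.dist_le_mul _ (hm a) _ (hm b)).trans ?_
    refine mul_le_mul_of_nonneg_left ?_ (NNReal.coe_nonneg _)
    simpa using hX.dist_le_mul a b
  · have : clamp n 0 = 0 := clamp_eq le_rfl hn
    simp [this, hε0]

lemma one_sub_rpow {w α β : ℝ} (hw0 : 0 ≤ w) (hw1 : w ≤ 1) (hα : 0 < α) (hβ : 0 < β) :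
    min 1 (β / α) * (1 - w ^ α) ≤ 1 - w ^ β := by
  have h0 : 0 ≤ w ^ α := Real.rpow_nonneg hw0 _
  have h1 : w ^ α ≤ 1 := Real.rpow_le_one hw0 hw1 hα.le
  rcases le_total α β with h | h
  · have h2 : w ^ β ≤ w ^ α := Real.rpow_le_rpow_of_exponent_ge' hw0 hw1 hα.le h
    have := mul_le_mul_of_nonneg_right (min_le_left 1 (β / α)) (sub_nonneg.2 h1)
    linarith
  · have h2 := _root_.rpow_one_add_le_one_add_mul_self (s := w ^ α - 1) (by linarith) (p := β / α)
      (by positivity) (by rw [div_le_one hα]; exact h)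
    rw [add_sub_cancel, ← Real.rpow_mul hw0, mul_div_cancel₀ _ hα.ne'] at h2
    have := mul_le_mul_of_nonneg_right (min_le_right 1 (β / α)) (sub_nonneg.2 h1)
    linarith

/-- power inequality of Stroock-Varopoulos type -/
lemma pow_sv {a b : ℝ} (ha : 0 < a) (hb : 0 < b) : ∃ c : ℝ, 0 < c ∧ ∀ x y : ℝ, 0 ≤ x → 0 ≤ y →
    c * (x ^ ((a + b) / 2) - y ^ ((a + b) / 2)) ^ 2 ≤ (x ^ a - y ^ a) * (x ^ b - y ^ b) := by
  set α := (a + b) / 2 with hα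
  have hαp : 0 < α := by positivity
  refine ⟨min 1 (a / α) * min 1 (b / α), by positivity, ?_⟩
  have main : ∀ x y : ℝ, 0 < x → 0 ≤ y → y ≤ x →
    min 1 (a / α) * min 1 (b / α) * (x ^ α - y ^ α) ^ 2 ≤ (x ^ a - y ^ a) * (x ^ b - y ^ b) := by
    intro x y hx hy hyx
    obtain ⟨w, hw0, hw1, rfl⟩ : ∃ w, 0 ≤ w ∧ w ≤ 1 ∧ y = x * w :=
      ⟨y / x, by positivity, by rw [div_le_one hx]; exact hyx, by field_simp⟩
    rw [Real.mul_rpow hx.le hw0, Real.mul_rpow hx.le hw0, Real.mul_rpow hx.le hw0]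
    have e : (x ^ α) ^ 2 = x ^ a * x ^ b := by
      rw [← Real.rpow_natCast, ← Real.rpow_mul hx.le, ← Real.rpow_add hx]
      congr 1; push_cast; rw [hα]; ring
    have h1 := one_sub_rpow hw0 hw1 hαp ha
    have h2 := one_sub_rpow hw0 hw1 hαp hb
    have h3 : 0 ≤ 1 - w ^ α := sub_nonneg.2 (Real.rpow_le_one hw0 hw1 hαp.le)
    have h4 := mul_le_mul h1 h2 (by positivity) (le_trans (by positivity) h1)
    have h5 : 0 ≤ x ^ a * x ^ b := by positivity
    calc min 1 (a / α) * min 1 (b / α) * (x ^ α - x ^ α * w ^ α) ^ 2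
        = (x ^ α) ^ 2 * (min 1 (a / α) * (1 - w ^ α) * (min 1 (b / α) * (1 - w ^ α))) := by ring
      _ ≤ (x ^ α) ^ 2 * ((1 - w ^ a) * (1 - w ^ b)) := by gcongr
      _ = _ := by rw [e]; ring
  intro x y hx hy
  rcases hx.eq_or_lt with rfl | hx'
  · rcases hy.eq_or_lt with rfl | hy'
    · simp
    · have := main y 0 hy' le_rfl hy
      nlinarith
  · rcases le_total y x with h | h
    · exact main x y hx' hy h
    · have := main y x (hx'.trans_le h) hx h
      nlinarith

lemma taylor_deriv (G g : ℝ → ℝ) (K a : ℝ) (h : ∀ b, |G b - G a - g a * (b - a)| ≤ K * (b - a) ^ 2) :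
    HasDerivAt G (g a) a := by
  rw [hasDerivAt_iff_isLittleO]
  refine Asymptotics.IsBigO.trans_isLittleO (g := fun b => (b - a) ^ 2) ?_ ?_
  · refine Asymptotics.IsBigO.of_bound K (Filter.Eventually.of_forall fun b => ?_)
    have := h b
    rw [Real.norm_eq_abs, Real.norm_eq_abs, abs_of_nonneg (sq_nonneg (b - a))]
    convert this using 2
    simp; ring
  · have h2 : Asymptotics.IsLittleO (nhds a) (fun w : ℝ => w - a) (fun _ => (1 : ℝ)) := by
      rw [Asymptotics.isLittleO_one_iff]
      have : Continuous fun w : ℝ => w - a := by fun_prop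
      simpa using this.tendsto a
    simpa [sq] using h2.mul_isBigO (Asymptotics.isBigO_refl (fun w : ℝ => w - a) (nhds a))

lemma LF.prim_eq (g : LF) (G : ℝ → ℝ) (hG : ∀ s, HasDerivAt G (g.f s) s) (h0 : G 0 = 0) (s : ℝ) :
    g.prim s = G s := by
  unfold LF.prim
  rw [intervalIntegral.integral_eq_sub_of_hasDerivAt (fun x _ => hG x)
    (g.cont.intervalIntegrable _ _), h0, sub_zero]

/-- identity -/
noncomputable def idL : LF := ⟨fun s => s, 1, LipschitzWith.id, rfl⟩
/-- zero -/
noncomputable def zeroL : LF := ⟨fun _ => 0, 0, LipschitzWith.const 0, rfl⟩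
/-- positive part above level n -/
noncomputable def posL (n : ℝ) (hn : 0 ≤ n) : LF :=
  ⟨fun s => max (s - n) 0, 1, by
    have : LipschitzWith 1 (fun s : ℝ => s - n) := LipschitzWith.of_dist_le_mul fun a b => by simp
    exact this.max_const 0, by simp [hn]⟩
/-- negative part -/
noncomputable def negL : LF := ⟨fun s => min s 0, 1, (LipschitzWith.id).min_const 0, by simp⟩

lemma idL_prim (s : ℝ) : idL.prim s = s ^ 2 / 2 :=
  idL.prim_eq (fun s => s ^ 2 / 2) (fun s => by
    refine ((hasDerivAt_pow 2 s).div_const 2).congr_deriv ?_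
    simp [idL]) (by simp) s

lemma posL_prim (n : ℝ) (hn : 0 ≤ n) (s : ℝ) : (posL n hn).prim s = (max (s - n) 0) ^ 2 / 2 :=
  (posL n hn).prim_eq (fun s => (max (s - n) 0) ^ 2 / 2) (fun s => by
    refine taylor_deriv _ _ 1 s fun b => ?_
    simp only [posL]
    rw [abs_le]
    rcases le_total (s - n) 0 with h1 | h1 <;> rcases le_total (b - n) 0 with h2 | h2 <;>
    simp only [max_eq_left, max_eq_right, h1, h2] <;> constructor <;> nlinarith) (by simp [hn]) s

lemma negL_prim (s : ℝ) : negL.prim s = (min s 0) ^ 2 / 2 :=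
  negL.prim_eq (fun s => (min s 0) ^ 2 / 2) (fun s => by
    refine taylor_deriv _ _ 1 s fun b => ?_
    simp only [negL]
    rw [abs_le]
    rcases le_total s 0 with h1 | h1 <;> rcases le_total b 0 with h2 | h2 <;>
    simp only [min_eq_left, min_eq_right, h1, h2] <;> constructor <;> nlinarith) (by simp) s

end VWS

namespace VWS

variable {X : Type*} [MeasurableSpace X] {μ : Measure X}
variable {H : Type*} [NormedAddCommGroup H] [InnerProductSpace ℝ H] [CompleteSpace H]

/-- regularised evolution -/
structure Sol (B : Lp ℝ 2 μ →L[ℝ] Lp ℝ 2 μ) (Φ F : LF) (T : ℝ) (u : ℝ → Lp ℝ 2 μ) : Prop where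
  cont : Continuous u
  deriv : ∀ t ∈ Set.Icc 0 T, HasDerivAt u (F.app (u t) - B (Φ.app (u t))) t

lemma exists_sol (B : Lp ℝ 2 μ →L[ℝ] Lp ℝ 2 μ) (Φ F : LF) (T : ℝ) (hT : 0 ≤ T) (x0 : Lp ℝ 2 μ) :
    ∃ u, Sol B Φ F T u ∧ u 0 = x0 := by
  obtain ⟨u, h1, h2, h3⟩ := exists_ode (fun x => F.app x - B (Φ.app x)) _
    (F.app_lip.sub (B.lipschitz.comp Φ.app_lip)) x0 T hT
  exact ⟨u, ⟨h1, h3⟩, h2⟩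

/-- structural assumptions on the truncated nonlinearities -/
structure Dat (m p n σ : ℝ) (Φ F : LF) : Prop where
  hn : 0 < n
  hm : 1 < m
  hσ : 0 < σ
  Φeq : ∀ s, Φ.f s = clamp n s ^ m
  F0 : ∀ s, s ≤ σ → F.f s = 0
  Fn : ∀ s, n ≤ s → F.f s = 0
  Fnn : ∀ s, 0 ≤ F.f s
  Fle : ∀ s, 0 ≤ s → F.f s ≤ s ^ p

variable {ι : H →L[ℝ] Lp ℝ 2 μ} {l : ℝ} {B : Lp ℝ 2 μ →L[ℝ] Lp ℝ 2 μ}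

lemma Res.inner_B (h : Res ι l B) (f g : Lp ℝ 2 μ) :
    inner ℝ f (B g) = l⁻¹ * (inner ℝ f g - inner ℝ f ((ContinuousLinearMap.id ℝ (Lp ℝ 2 μ) - l • B) g)) := by
  have := h.pos
  simp [inner_sub_right, real_inner_smul_right]
  field_simp

section
variable {m p n σ T : ℝ} {Φ F : LF} {u : ℝ → Lp ℝ 2 μ}

lemma Dat.mono (D : Dat m p n σ Φ F) : Monotone Φ.f := fun a b h => by
  rw [D.Φeq, D.Φeq]
  exact Real.rpow_le_rpow (clamp_nonneg _ _) (clamp_mono n h) (by linarith [D.hm])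

lemma zero_of_prim (g : LF) (hg : ∀ s, 0 ≤ g.prim s) {v : Lp ℝ 2 μ}
    (h : ∫ x, g.prim (v x) ∂μ ≤ 0) : ∀ᵐ x ∂μ, g.prim (v x) = 0 := by
  have h0 : ∫ x, g.prim (v x) ∂μ = 0 := le_antisymm h (integral_nonneg fun x => hg _)
  rw [integral_eq_zero_iff_of_nonneg (fun x => hg _) (g.prim_integrable v)] at h0
  exact h0

lemma prim_start (g : LF) {v : Lp ℝ 2 μ} (h : ∀ᵐ x ∂μ, g.prim (v x) = 0) :
    ∫ x, g.prim (v x) ∂μ = 0 := integral_eq_zero_of_ae h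

lemma Sol.le_n (hs : Sol B Φ F T u) (D : Dat m p n σ Φ F) (hB : Res ι l B) (hnc : NC ι)
    (h0 : ∀ᵐ x ∂μ, u 0 x ≤ n) (t : ℝ) (ht : t ∈ Set.Icc 0 T) : ∀ᵐ x ∂μ, u t x ≤ n := by
  have hJ := hB.markov hnc
  set g := posL n D.hn.le with hg
  have hle := gronwall (fun t => ∫ x, g.prim (u t x) ∂μ) _ 0 T (ht.1.trans ht.2)
    (fun t ht => g.hasDerivAt_integral (hs.deriv t ht)) (fun t ht => by
      rw [zero_mul, inner_sub_right, hB.inner_B]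
      have h1 : inner ℝ (g.app (u t)) (F.app (u t)) ≤ 0 := by
        refine inner_nonpos' ?_
        filter_upwards [g.coe_app (u t), F.coe_app (u t)] with x h1 h2
        rw [h1, h2]
        rcases le_total n (u t x) with h | h
        · rw [D.Fn _ h]; simp
        · have : g.f (u t x) = 0 := by simp [hg, posL, h]
          rw [this]; simp
      have h2 : inner ℝ (g.app (u t)) ((ContinuousLinearMap.id ℝ (Lp ℝ 2 μ) - l • B) (Φ.app (u t))) ≤
          inner ℝ (g.app (u t)) (Φ.app (u t)) := by
        refine inner_mono ?_
        have h3 := hJ.sub (Φ.app (u t)) (n ^ m) (Real.rpow_nonneg D.hn.le _) (by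
          filter_upwards [Φ.coe_app (u t)] with x h1
          rw [h1, D.Φeq]
          exact Real.rpow_le_rpow (clamp_nonneg _ _) (clamp_le D.hn.le _) (by linarith [D.hm]))
        filter_upwards [g.coe_app (u t), Φ.coe_app (u t), h3] with x h1 h2 h3
        rw [h1, h2]
        rcases le_total n (u t x) with h | h
        · have e1 : Φ.f (u t x) = n ^ m := by
            rw [D.Φeq]; simp [clamp, h, D.hn.le]
          rw [e1]
          exact mul_le_mul_of_nonneg_left h3 (le_max_right _ _)
        · have : g.f (u t x) = 0 := by simp [hg, posL, h]
          rw [this]; simp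
      have := mul_nonneg (inv_pos.2 hB.pos).le (sub_nonneg.2 h2)
      linarith) t ht
  have e0 := prim_start g (v := u 0) (by
    filter_upwards [h0] with x hx
    rw [hg, posL_prim]; simp [hx])
  rw [e0, mul_zero] at hle
  filter_upwards [zero_of_prim g (fun s => by rw [hg, posL_prim]; positivity) hle] with x hx
  rw [hg, posL_prim] at hx
  have : max (u t x - n) 0 = 0 := by simpa using hx
  have := max_eq_right_iff.1 this
  linarith

lemma Sol.nonneg (hs : Sol B Φ F T u) (D : Dat m p n σ Φ F) (hB : Res ι l B) (hnc : NC ι)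
    (h0 : ∀ᵐ x ∂μ, 0 ≤ u 0 x) (t : ℝ) (ht : t ∈ Set.Icc 0 T) : ∀ᵐ x ∂μ, 0 ≤ u t x := by
  have hJ := hB.markov hnc
  have hle := gronwall (fun t => ∫ x, negL.prim (u t x) ∂μ) _ 0 T (ht.1.trans ht.2)
    (fun t ht => negL.hasDerivAt_integral (hs.deriv t ht)) (fun t ht => by
      rw [zero_mul, inner_sub_right, hB.inner_B]
      have h1 : inner ℝ (negL.app (u t)) (F.app (u t)) ≤ 0 := by
        refine inner_nonpos' ?_
        filter_upwards [negL.coe_app (u t), F.coe_app (u t)] with x h1 h2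
        rw [h1, h2]
        exact mul_nonpos_of_nonpos_of_nonneg (min_le_right _ _) (D.Fnn _)
      have h2 : inner ℝ (negL.app (u t)) ((ContinuousLinearMap.id ℝ (Lp ℝ 2 μ) - l • B) (Φ.app (u t))) ≤
          inner ℝ (negL.app (u t)) (Φ.app (u t)) := by
        refine inner_mono ?_
        have h3 := hJ.nonneg (Φ.app (u t)) (by
          filter_upwards [Φ.coe_app (u t)] with x h1
          rw [h1, D.Φeq]
          exact Real.rpow_nonneg (clamp_nonneg _ _) _)
        filter_upwards [negL.coe_app (u t), Φ.coe_app (u t), h3] with x h1 h2 h3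
        rw [h1, h2]
        rcases le_total (u t x) 0 with h | h
        · have e1 : Φ.f (u t x) = 0 := by
            rw [D.Φeq]
            have : clamp n (u t x) = 0 := max_eq_right ((min_le_left _ _).trans h)
            rw [this, Real.zero_rpow (by linarith [D.hm])]
          rw [e1, mul_zero]
          exact mul_nonpos_of_nonpos_of_nonneg (min_le_right _ _) h3
        · have : negL.f (u t x) = 0 := by simp [negL, h]
          rw [this]; simp
      have := mul_nonneg (inv_pos.2 hB.pos).le (sub_nonneg.2 h2)
      linarith) t ht
  have e0 := prim_start negL (v := u 0) (by
    filter_upwards [h0] with x hx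
    rw [negL_prim]; simp [hx])
  rw [e0, mul_zero] at hle
  filter_upwards [zero_of_prim negL (fun s => by rw [negL_prim]; positivity) hle] with x hx
  rw [negL_prim] at hx
  have : min (u t x) 0 = 0 := by simpa using hx
  exact min_eq_right_iff.1 this

/-- comparison principle -/
lemma Sol.compare {Φ' F' : LF} {v : ℝ → Lp ℝ 2 μ} (hs : Sol B Φ F T u) (hs' : Sol B Φ' F' T v)
    (hB : Res ι l B) (hnc : NC ι) (hmono : Monotone Φ'.f)
    (hΦ : ∀ s, 0 ≤ s → s ≤ n → Φ.f s = Φ'.f s) (hF : ∀ s, 0 ≤ s → s ≤ n → F.f s ≤ F'.f s)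
    (hu : ∀ t ∈ Set.Icc 0 T, ∀ᵐ x ∂μ, 0 ≤ u t x ∧ u t x ≤ n)
    (h0 : ∀ᵐ x ∂μ, u 0 x ≤ v 0 x) (t : ℝ) (ht : t ∈ Set.Icc 0 T) : ∀ᵐ x ∂μ, u t x ≤ v t x := by
  have hJ := hB.markov hnc
  set J := (ContinuousLinearMap.id ℝ (Lp ℝ 2 μ) - l • B) with hJdef
  set g := posL 0 le_rfl with hg
  have hgf : ∀ s, g.f s = max s 0 := fun s => by simp [hg, posL]
  have hgp : ∀ s, g.prim s = (max s 0) ^ 2 / 2 := fun s => by rw [hg, posL_prim]; simp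
  have hle := gronwall (fun t => ∫ x, g.prim ((u t - v t) x) ∂μ) _
    (2 * (l⁻¹ * (Φ'.K * ‖J‖) + F'.K)) T (ht.1.trans ht.2)
    (fun t ht => g.hasDerivAt_integral ((hs.deriv t ht).sub (hs'.deriv t ht))) (fun t ht => by
      set d := u t - v t with hd
      have hd' : ∀ᵐ x ∂μ, d x = u t x - v t x := Lp.coeFn_sub _ _
      have en : ‖g.app d‖ ^ 2 = 2 * ∫ x, g.prim (d x) ∂μ := by
        rw [norm_sq_eq, ← integral_const_mul]
        refine integral_congr_ae ?_
        filter_upwards [g.coe_app d] with x hx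
        rw [hx, hgp, hgf]; ring
      have hΦe : Φ.app (u t) = Φ'.app (u t) := by
        refine Lp.ext ?_
        filter_upwards [Φ.coe_app (u t), Φ'.coe_app (u t), hu t ht] with x h1 h2 h3
        rw [h1, h2, hΦ _ h3.1 h3.2]
      have e1 : F.app (u t) - B (Φ.app (u t)) - (F'.app (v t) - B (Φ'.app (v t))) =
          (F.app (u t) - F'.app (v t)) - B (Φ'.app (u t) - Φ'.app (v t)) := by
        rw [hΦe, map_sub]; abel
      rw [e1, inner_sub_right, hB.inner_B]
      have h1 : inner ℝ (g.app d) (F.app (u t) - F'.app (v t)) ≤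
          inner ℝ (g.app d) ((F'.K : ℝ) • g.app d) := by
        refine inner_mono ?_
        filter_upwards [g.coe_app d, hd', Lp.coeFn_sub (F.app (u t)) (F'.app (v t)), F.coe_app (u t),
          F'.coe_app (v t), Lp.coeFn_smul (F'.K : ℝ) (g.app d), hu t ht] with x a1 a2 a3 a4 a5 a6 a7
        rw [a3, a6, Pi.sub_apply, Pi.smul_apply, a1, a2, a4, a5, hgf, smul_eq_mul]
        have b1 := hF _ a7.1 a7.2
        have b2 := (le_abs_self _).trans (F'.abs_sub (u t x) (v t x))
        rcases le_total (u t x - v t x) 0 with h | h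
        · simp [h]
        · rw [max_eq_left h]
          rw [abs_of_nonneg h] at b2
          exact mul_le_mul_of_nonneg_left (by linarith) h
      rw [real_inner_smul_right, real_inner_self_eq_norm_sq] at h1
      have h2 : 0 ≤ inner ℝ (g.app d) (Φ'.app (u t) - Φ'.app (v t)) := by
        refine inner_nonneg' ?_
        filter_upwards [g.coe_app d, hd', Lp.coeFn_sub (Φ'.app (u t)) (Φ'.app (v t)), Φ'.coe_app (u t),
          Φ'.coe_app (v t)] with x a1 a2 a3 a4 a5
        rw [a3, Pi.sub_apply, a1, a2, a4, a5, hgf]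
        rcases le_total (u t x - v t x) 0 with h | h
        · simp [h]
        · exact mul_nonneg (le_max_right _ _) (sub_nonneg.2 (hmono (by linarith)))
      have h3 : inner ℝ (g.app d) (J (Φ'.app (u t) - Φ'.app (v t))) ≤
          inner ℝ (g.app d) (J ((Φ'.K : ℝ) • g.app d)) := by
        refine inner_mono ?_
        have := hJ.nonneg ((Φ'.K : ℝ) • g.app d - (Φ'.app (u t) - Φ'.app (v t))) (by
          filter_upwards [g.coe_app d, hd', Lp.coeFn_sub (Φ'.app (u t)) (Φ'.app (v t)), Φ'.coe_app (u t),
            Φ'.coe_app (v t), Lp.coeFn_smul (Φ'.K : ℝ) (g.app d),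
            Lp.coeFn_sub ((Φ'.K : ℝ) • g.app d) (Φ'.app (u t) - Φ'.app (v t))] with x a1 a2 a3 a4 a5 a6 a7
          rw [a7, Pi.sub_apply, a6, Pi.smul_apply, a3, Pi.sub_apply, a1, a2, a4, a5, hgf, smul_eq_mul,
            sub_nonneg]
          have b2 := (le_abs_self _).trans (Φ'.abs_sub (u t x) (v t x))
          rcases le_total (u t x - v t x) 0 with h | h
          · have := hmono (show u t x ≤ v t x by linarith)
            rw [max_eq_right h]; linarith
          · rw [max_eq_left h]
            rwa [abs_of_nonneg h] at b2)
        rw [map_sub] at this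
        filter_upwards [this, g.coe_app d, Lp.coeFn_sub (J ((Φ'.K : ℝ) • g.app d))
          (J (Φ'.app (u t) - Φ'.app (v t)))] with x a1 a2 a3
        rw [a3, Pi.sub_apply, sub_nonneg] at a1
        rw [a2, hgf]
        exact mul_le_mul_of_nonneg_left a1 (le_max_right _ _)
      have h4 : inner ℝ (g.app d) (J ((Φ'.K : ℝ) • g.app d)) ≤ Φ'.K * ‖J‖ * ‖g.app d‖ ^ 2 := by
        rw [map_smul, real_inner_smul_right, mul_assoc]
        refine mul_le_mul_of_nonneg_left ?_ Φ'.K.2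
        refine (real_inner_le_norm _ _).trans ?_
        have := mul_le_mul_of_nonneg_left (J.le_opNorm (g.app d)) (norm_nonneg (g.app d))
        linarith
      have h5 : l⁻¹ * (inner ℝ (g.app d) (J (Φ'.app (u t) - Φ'.app (v t)))
          - inner ℝ (g.app d) (Φ'.app (u t) - Φ'.app (v t))) ≤ l⁻¹ * (Φ'.K * ‖J‖ * ‖g.app d‖ ^ 2) :=
        mul_le_mul_of_nonneg_left (by linarith) (inv_pos.2 hB.pos).le
      calc _ ≤ (l⁻¹ * (Φ'.K * ‖J‖) + F'.K) * ‖g.app d‖ ^ 2 := by linarith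
        _ = _ := by rw [en]; ring) t ht
  have e0 := prim_start g (v := u 0 - v 0) (by
    filter_upwards [h0, Lp.coeFn_sub (u 0) (v 0)] with x hx hx2
    rw [hgp, hx2]; simp [hx])
  rw [e0, mul_zero] at hle
  filter_upwards [zero_of_prim g (fun s => by rw [hgp]; positivity) hle,
    Lp.coeFn_sub (u t) (v t)] with x hx hx2
  rw [hgp, hx2] at hx
  have : max ((u t - v t : X → ℝ) x) 0 = 0 := by simpa using hx
  have := max_eq_right_iff.1 this
  simpa using this

end
end VWS

namespace VWS

/-- scalar multiple -/
noncomputable def LF.smul (c : ℝ) (g : LF) : LF := ⟨fun s => c * g.f s, ‖c‖₊ * g.K, by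
  refine LipschitzWith.of_dist_le_mul fun a b => ?_
  have := g.abs_sub a b
  rw [Real.dist_eq, Real.dist_eq, ← mul_sub, abs_mul]
  push_cast
  rw [mul_assoc, Real.norm_eq_abs]
  exact mul_le_mul_of_nonneg_left this (abs_nonneg c), by simp [g.zero]⟩

lemma rpow_interp {a b δ : ℝ} (ha : 0 < a) (hab : a < b) (hδ : 0 < δ) :
    ∃ C > 0, ∀ s : ℝ, 0 ≤ s → s ^ a ≤ δ * s ^ b + C := by
  set S : ℝ := (1 / δ) ^ (1 / (b - a)) with hS
  have hba : 0 < b - a := sub_pos.2 hab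
  have hSp : 0 < S := by positivity
  refine ⟨S ^ a, by positivity, fun s hs => ?_⟩
  rcases le_total s S with h | h
  · have h1 : s ^ a ≤ S ^ a := Real.rpow_le_rpow hs h ha.le
    have h2 : 0 ≤ δ * s ^ b := by positivity
    linarith
  · have hs' : 0 < s := hSp.trans_le h
    have h1 : 1 / δ ≤ s ^ (b - a) := by
      calc 1 / δ = S ^ (b - a) := by
            rw [hS, ← Real.rpow_mul (by positivity), one_div_mul_cancel hba.ne', Real.rpow_one]
        _ ≤ _ := Real.rpow_le_rpow hSp.le h hba.le
    have h2 : s ^ b = s ^ (b - a) * s ^ a := by rw [← Real.rpow_add hs']; congr 1; ring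
    have h3 : 0 < S ^ a := by positivity
    have h4 : 0 < s ^ a := by positivity
    rw [div_le_iff₀ hδ] at h1
    have := mul_le_mul_of_nonneg_right h1 h4.le
    rw [h2]; nlinarith

section gfun
variable {n ε r : ℝ} {g : LF}

lemma g_bounds (hε : 0 < ε) (hr : 1 < r) (hg : ∀ s, g.f s = (max (clamp n s) ε) ^ (r - 1) - ε ^ (r - 1))
    {s : ℝ} (hs : 0 ≤ s) (hsn : s ≤ n) :
    0 ≤ g.f s ∧ g.f s ≤ s ^ (r - 1) ∧ s ^ (r - 1) - ε ^ (r - 1) ≤ g.f s := by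
  rw [hg, clamp_eq hs hsn]
  have hr' : 0 ≤ r - 1 := by linarith
  have h0 : 0 ≤ ε ^ (r - 1) := by positivity
  have h0' : 0 ≤ s ^ (r - 1) := by positivity
  refine ⟨?_, ?_, ?_⟩
  · exact sub_nonneg.2 (Real.rpow_le_rpow hε.le (le_max_right _ _) hr')
  · rcases le_total s ε with h | h
    · rw [max_eq_right h]; linarith
    · rw [max_eq_left h]; linarith
  · exact sub_le_sub_right (Real.rpow_le_rpow hs (le_max_left _ _) hr') _

lemma G_bounds (hε : 0 < ε) (hr : 1 < r) (hg : ∀ s, g.f s = (max (clamp n s) ε) ^ (r - 1) - ε ^ (r - 1))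
    {s : ℝ} (hs : 0 ≤ s) (hsn : s ≤ n) :
    0 ≤ g.prim s ∧ g.prim s ≤ s ^ r / r ∧ s ^ r / r - ε ^ (r - 1) * s ≤ g.prim s := by
  have hb := fun x (hx : x ∈ Set.Icc 0 s) => g_bounds hε hr hg hx.1 (hx.2.trans hsn)
  have hi1 : IntervalIntegrable (fun x : ℝ => x ^ (r - 1)) volume 0 s :=
    intervalIntegral.intervalIntegrable_rpow' (by linarith)
  have e1 : ∫ x in (0 : ℝ)..s, x ^ (r - 1) = s ^ r / r := by
    rw [integral_rpow (Or.inl (by linarith)), sub_add_cancel, Real.zero_rpow (by linarith), sub_zero]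
  have hi2 := g.cont.intervalIntegrable (μ := volume) 0 s
  unfold LF.prim
  refine ⟨intervalIntegral.integral_nonneg hs fun x hx => (hb x hx).1, ?_, ?_⟩
  · rw [← e1]
    exact intervalIntegral.integral_mono_on hs hi2 hi1 fun x hx => (hb x hx).2.1
  · have e2 : ∫ x in (0 : ℝ)..s, (x ^ (r - 1) - ε ^ (r - 1)) = s ^ r / r - ε ^ (r - 1) * s := by
      rw [intervalIntegral.integral_sub hi1 (by simp), e1]
      simp [mul_comm]
    rw [← e2]
    exact intervalIntegral.integral_mono_on hs (hi1.sub (by simp)) hi2 fun x hx => (hb x hx).2.2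

end gfun

lemma sv_pointwise {a b c x y ε : ℝ} (ha : 0 < a) (hb : 0 < b) (hε : 0 < ε) (hx : 0 ≤ x) (hy : 0 ≤ y)
    (hc : ∀ x y : ℝ, 0 ≤ x → 0 ≤ y →
      c * (x ^ ((a + b) / 2) - y ^ ((a + b) / 2)) ^ 2 ≤ (x ^ a - y ^ a) * (x ^ b - y ^ b)) :
    c * ((max x ε) ^ ((a + b) / 2) - (max y ε) ^ ((a + b) / 2)) ^ 2 ≤
      ((max x ε) ^ a - (max y ε) ^ a) * (x ^ b - y ^ b) := by
  have main : ∀ x y : ℝ, 0 ≤ x → 0 ≤ y → y ≤ x →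
    c * ((max x ε) ^ ((a + b) / 2) - (max y ε) ^ ((a + b) / 2)) ^ 2 ≤
      ((max x ε) ^ a - (max y ε) ^ a) * (x ^ b - y ^ b) := by
    intro x y hx hy hyx
    rcases le_total x ε with h | h
    · rw [max_eq_right h, max_eq_right (hyx.trans h)]; simp
    · rw [max_eq_left h]
      have h0 : 0 ≤ max y ε := hy.trans (le_max_left _ _)
      refine (hc x (max y ε) hx h0).trans ?_
      refine mul_le_mul_of_nonneg_left ?_ (sub_nonneg.2 (Real.rpow_le_rpow h0 (max_le hyx h) ha.le))
      exact sub_le_sub_left (Real.rpow_le_rpow hy (le_max_left _ _) hb.le) _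
  rcases le_total y x with h | h
  · exact main x y hx hy h
  · have := main y x hy hx h
    nlinarith

variable {X : Type*} [MeasurableSpace X] {μ : Measure X}
variable {H : Type*} [NormedAddCommGroup H] [InnerProductSpace ℝ H] [CompleteSpace H]

lemma Lr_eps {m p r k : ℝ} (hp : 1 < p) (hpm : p < m) (hr : 1 < r) (hk : 0 < k) :
    ∃ C : ℝ, 0 < C ∧ ∀ (ι : H →L[ℝ] Lp ℝ 2 μ) (l n σ T ε : ℝ) (B) (Φ F : LF) (u : ℝ → Lp ℝ 2 μ),
      NC ι → Res ι l B → ‖ι‖ ^ 2 + 2 * l ≤ k → Dat m p n σ Φ F → Sol B Φ F T u →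
      (∀ t ∈ Set.Icc 0 T, ∀ᵐ x ∂μ, 0 ≤ u t x ∧ u t x ≤ n) →
      0 < ε → ε ≤ σ → ε ^ ((r - 1 + m) / 2) ≤ σ ^ ((r - 1 + m) / 2) / 2 →
      ε ^ (r - 1) ≤ σ ^ (r - 1) / (2 * r) →
      ∀ g : LF, (∀ s, g.f s = (max (clamp n s) ε) ^ (r - 1) - ε ^ (r - 1)) →
      ∀ t ∈ Set.Icc 0 T, ∫ x, g.prim (u t x) ∂μ ≤ Real.exp (C * t) * ∫ x, g.prim (u 0 x) ∂μ := by
  obtain ⟨c, hc, hsv⟩ := pow_sv (a := r - 1) (b := m) (by linarith) (by linarith)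
  obtain ⟨C, hC, hint⟩ := rpow_interp (a := p - 1) (b := m - 1) (δ := c / (4 * k)) (by linarith) (by linarith)
    (by positivity)
  refine ⟨2 * r * C, by positivity, ?_⟩
  intro ι l n σ T ε B Φ F u hnc hB hlk D hs hu hε hεσ hε1 hε2 g hg t ht
  have hJ := hB.markov hnc
  set α := (r - 1 + m) / 2 with hα
  have hαp : 0 < α := by rw [hα]; linarith
  obtain ⟨h0, hh0⟩ := exists_pow n ε α D.hn.le hαp (Or.inl hε)
  set h := h0.smul (Real.sqrt c) with hh
  have hhf : ∀ s, h.f s = Real.sqrt c * ((max (clamp n s) ε) ^ α - ε ^ α) := fun s => by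
    rw [← hh0]; rfl
  have hhsq : ∀ s t, (h.f s - h.f t) * (h.f s - h.f t) =
      c * ((max (clamp n s) ε) ^ α - (max (clamp n t) ε) ^ α) ^ 2 := fun s t => by
    rw [hhf, hhf]
    calc _ = (Real.sqrt c) ^ 2 * ((max (clamp n s) ε) ^ α - (max (clamp n t) ε) ^ α) ^ 2 := by ring
      _ = _ := by rw [Real.sq_sqrt hc.le]
  refine gronwall (fun t => ∫ x, g.prim (u t x) ∂μ) _ (2 * r * C) T (ht.1.trans ht.2)
    (fun t ht => g.hasDerivAt_integral (hs.deriv t ht)) (fun t ht => ?_) t ht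
  have h1 := hJ.sv g Φ h (fun s t => by
    rw [hhsq, hg, hg, D.Φeq, D.Φeq]
    refine (sv_pointwise (by linarith) (by linarith) hε (clamp_nonneg _ _) (clamp_nonneg _ _) hsv).trans
      (le_of_eq ?_)
    ring) (u t)
  have h2 : inner ℝ (h.app (u t)) (B (h.app (u t))) ≤ inner ℝ (g.app (u t)) (B (Φ.app (u t))) := by
    rw [hB.inner_B, hB.inner_B]
    exact mul_le_mul_of_nonneg_left h1 (inv_pos.2 hB.pos).le
  have h3 := hB.coercive hlk (h.app (u t))
  have h4 : k⁻¹ * ‖h.app (u t)‖ ^ 2 ≤ inner ℝ (g.app (u t)) (B (Φ.app (u t))) := by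
    rw [inv_mul_le_iff₀ hk]
    exact h3.trans (mul_le_mul_of_nonneg_left h2 hk.le)
  have h5 : inner ℝ (g.app (u t)) (F.app (u t)) ≤ k⁻¹ * ‖h.app (u t)‖ ^ 2 +
      2 * r * C * ∫ x, g.prim (u t x) ∂μ := by
    rw [inner_eq, norm_sq_eq, ← integral_const_mul, ← integral_const_mul,
      ← integral_add ((Lp.memLp (h.app (u t))).integrable_sq.const_mul _) ((g.prim_integrable _).const_mul _)]
    refine integral_mono_ae (integrable_mul _ _)
      (((Lp.memLp (h.app (u t))).integrable_sq.const_mul _).add ((g.prim_integrable _).const_mul _)) ?_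
    filter_upwards [g.coe_app (u t), F.coe_app (u t), h.coe_app (u t), hu t ht] with x a1 a2 a3 a4
    rw [a1, a2, a3]
    set s := u t x with hsdef
    obtain ⟨g1, g2, g3⟩ := g_bounds hε hr hg a4.1 a4.2
    obtain ⟨G1, G2, G3⟩ := G_bounds hε hr hg a4.1 a4.2
    rcases le_total s σ with hsσ | hsσ
    · rw [D.F0 _ hsσ, mul_zero]; positivity
    · have hs0 : 0 < s := D.hσ.trans_le hsσ
      have b1 : g.f s * F.f s ≤ s ^ (r - 1) * s ^ p :=
        mul_le_mul g2 (D.Fle s a4.1) (D.Fnn s) (by positivity)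
      have b2 : s ^ (r - 1) * s ^ p = s ^ (p - 1) * s ^ r := by
        rw [← Real.rpow_add hs0, ← Real.rpow_add hs0]; congr 1; ring
      have b3 := mul_le_mul_of_nonneg_right (hint s hs0.le) (Real.rpow_nonneg hs0.le r)
      have b4 : s ^ α / 2 ≤ (max (clamp n s) ε) ^ α - ε ^ α := by
        rw [clamp_eq a4.1 a4.2, max_eq_left (hεσ.trans hsσ)]
        have := Real.rpow_le_rpow D.hσ.le hsσ hαp.le
        linarith
      have b5 : c * (s ^ α / 2) ^ 2 ≤ h.f s ^ 2 := by
        rw [hhf, mul_pow, Real.sq_sqrt hc.le]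
        gcongr
      have b6 : (s ^ α) ^ 2 = s ^ (m - 1) * s ^ r := by
        rw [← Real.rpow_natCast, ← Real.rpow_mul hs0.le, ← Real.rpow_add hs0]
        congr 1; rw [hα]; push_cast; ring
      have b7 : s ^ r / (2 * r) ≤ g.prim s := by
        have c1 := Real.rpow_le_rpow D.hσ.le hsσ (show 0 ≤ r - 1 by linarith)
        have c2 : ε ^ (r - 1) * s ≤ s ^ (r - 1) / (2 * r) * s := by
          gcongr
          exact hε2.trans (by gcongr)
        have c3 : s ^ (r - 1) * s = s ^ r := by
          rw [← Real.rpow_add_one hs0.ne']; congr 1; ring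
        have c4 : s ^ (r - 1) / (2 * r) * s = s ^ r / (2 * r) := by rw [← c3]; ring
        have c5 : s ^ r / r - s ^ r / (2 * r) = s ^ r / (2 * r) := by field_simp; ring
        linarith
      have b8 : C * s ^ r ≤ 2 * r * C * g.prim s := by
        rw [div_le_iff₀ (by positivity)] at b7
        nlinarith
      have b9 : c / (4 * k) * (s ^ (m - 1) * s ^ r) ≤ k⁻¹ * h.f s ^ 2 := by
        rw [← b6]
        calc _ = k⁻¹ * (c * (s ^ α / 2) ^ 2) := by field_simp; ring
          _ ≤ _ := by gcongr
      rw [add_mul, mul_assoc] at b3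
      linarith
  rw [inner_sub_right]
  linarith

lemma Lr_estimate {m p r k : ℝ} (hp : 1 < p) (hpm : p < m) (hr : 1 < r) (hk : 0 < k) :
    ∃ C : ℝ, 0 < C ∧ ∀ (ι : H →L[ℝ] Lp ℝ 2 μ) (l n σ T : ℝ) (B) (Φ F : LF) (u : ℝ → Lp ℝ 2 μ),
      NC ι → Res ι l B → ‖ι‖ ^ 2 + 2 * l ≤ k → Dat m p n σ Φ F → Sol B Φ F T u →
      (∀ t ∈ Set.Icc 0 T, ∀ᵐ x ∂μ, 0 ≤ u t x ∧ u t x ≤ n) →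
      ∀ t ∈ Set.Icc 0 T, ∫⁻ x, ENNReal.ofReal (u t x ^ r) ∂μ ≤
        ENNReal.ofReal (Real.exp (C * t)) * ∫⁻ x, ENNReal.ofReal (u 0 x ^ r) ∂μ := by
  obtain ⟨C, hC, hmain⟩ := Lr_eps (μ := μ) (H := H) hp hpm hr hk
  refine ⟨C, hC, ?_⟩
  intro ι l n σ T B Φ F u hnc hB hlk D hs hu t ht
  have hr0 : 0 < r := by linarith
  set ε : ℕ → ℝ := fun j => 1 / ((j : ℝ) + 1) with hεdef
  have hε0 : ∀ j, 0 < ε j := fun j => by simp only [hεdef]; positivity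
  have hεt : Filter.Tendsto ε Filter.atTop (nhds 0) := tendsto_one_div_add_atTop_nhds_zero_nat
  have hεp : ∀ β : ℝ, 0 < β → Filter.Tendsto (fun j => ε j ^ β) Filter.atTop (nhds 0) := fun β hβ => by
    have := hεt.rpow_const (p := β) (Or.inr hβ.le)
    rwa [Real.zero_rpow hβ.ne'] at this
  have hσ := D.hσ
  choose g hg using fun j => exists_pow n (ε j) (r - 1) D.hn.le (by linarith) (Or.inl (hε0 j))
  have ht0 : (0 : ℝ) ∈ Set.Icc 0 T := ⟨le_rfl, ht.1.trans ht.2⟩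
  have hev : ∀ᶠ j in Filter.atTop, ∫⁻ x, ENNReal.ofReal ((g j).prim (u t x)) ∂μ ≤
      ENNReal.ofReal (Real.exp (C * t)) * ∫⁻ x, ENNReal.ofReal (u 0 x ^ r / r) ∂μ := by
    filter_upwards [hεt.eventually_le_const hσ,
      (hεp ((r - 1 + m) / 2) (by linarith)).eventually_le_const (show 0 < σ ^ ((r - 1 + m) / 2) / 2 by positivity),
      (hεp (r - 1) (by linarith)).eventually_le_const (show 0 < σ ^ (r - 1) / (2 * r) by positivity)]
      with j h1 h2 h3
    have := hmain ι l n σ T (ε j) B Φ F u hnc hB hlk D hs hu (hε0 j) h1 h2 h3 (g j) (hg j) t ht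
    have hnn : ∀ t ∈ Set.Icc 0 T, 0 ≤ᵐ[μ] fun x => (g j).prim (u t x) := fun t ht => by
      filter_upwards [hu t ht] with x hx
      exact (G_bounds (hε0 j) hr (hg j) hx.1 hx.2).1
    rw [← ofReal_integral_eq_lintegral_ofReal ((g j).prim_integrable _) (hnn t ht)]
    refine (ENNReal.ofReal_le_ofReal this).trans ?_
    rw [ENNReal.ofReal_mul (Real.exp_pos _).le, ofReal_integral_eq_lintegral_ofReal
      ((g j).prim_integrable _) (hnn 0 ht0)]
    refine mul_le_mul' le_rfl (lintegral_mono_ae ?_)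
    filter_upwards [hu 0 ht0] with x hx
    exact ENNReal.ofReal_le_ofReal (G_bounds (hε0 j) hr (hg j) hx.1 hx.2).2.1
  have hlim : ∫⁻ x, ENNReal.ofReal (u t x ^ r / r) ∂μ ≤
      ENNReal.ofReal (Real.exp (C * t)) * ∫⁻ x, ENNReal.ofReal (u 0 x ^ r / r) ∂μ := by
    calc _ = ∫⁻ x, Filter.liminf (fun j => ENNReal.ofReal ((g j).prim (u t x))) Filter.atTop ∂μ := by
          refine lintegral_congr_ae ?_
          filter_upwards [hu t ht] with x hx
          refine (Filter.Tendsto.liminf_eq ?_).symm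
          refine ENNReal.tendsto_ofReal ?_
          have h1 : Filter.Tendsto (fun j => u t x ^ r / r - ε j ^ (r - 1) * u t x) Filter.atTop
              (nhds (u t x ^ r / r - 0 * u t x)) :=
            tendsto_const_nhds.sub ((hεp (r - 1) (by linarith)).mul_const _)
          rw [zero_mul, sub_zero] at h1
          exact tendsto_of_tendsto_of_tendsto_of_le_of_le h1 tendsto_const_nhds
            (fun j => (G_bounds (hε0 j) hr (hg j) hx.1 hx.2).2.2)
            (fun j => (G_bounds (hε0 j) hr (hg j) hx.1 hx.2).2.1)
      _ ≤ Filter.liminf (fun j => ∫⁻ x, ENNReal.ofReal ((g j).prim (u t x)) ∂μ) Filter.atTop :=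
          lintegral_liminf_le' fun j => ((g j).prim_cont.comp_aestronglyMeasurable
            (Lp.aestronglyMeasurable (u t))).aemeasurable.ennreal_ofReal
      _ ≤ _ := Filter.liminf_le_of_frequently_le' hev.frequently
  have e : ∀ v : Lp ℝ 2 μ, ∫⁻ x, ENNReal.ofReal (v x ^ r / r) ∂μ =
      (∫⁻ x, ENNReal.ofReal (v x ^ r) ∂μ) * ENNReal.ofReal r⁻¹ := fun v => by
    rw [← lintegral_mul_const' _ _ ENNReal.ofReal_ne_top]
    congr 1; ext x
    rw [div_eq_mul_inv, ENNReal.ofReal_mul' (by positivity)]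
  rw [e, e, ← mul_assoc] at hlim
  have hri : 0 < r⁻¹ := by positivity
  exact (ENNReal.mul_le_mul_iff_left (by simpa using hr0) ENNReal.ofReal_ne_top).1 hlim

end VWS

namespace VWS

lemma sub_le_of_deriv (y y' k : ℝ → ℝ) (T : ℝ) (hT : 0 ≤ T)
    (hd : ∀ t ∈ Set.Icc 0 T, HasDerivAt y (y' t) t) (hk : Continuous k)
    (hle : ∀ t ∈ Set.Icc 0 T, y' t ≤ k t) : y T - y 0 ≤ ∫ t in (0 : ℝ)..T, k t := by
  have := gronwall (fun t => y t - ∫ s in (0 : ℝ)..t, k s) _ 0 T hT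
    (fun t ht => (hd t ht).sub (hk.integral_hasStrictDerivAt 0 t).hasDerivAt)
    (fun t ht => by have := hle t ht; linarith) T ⟨hT, le_rfl⟩
  simp at this
  linarith

section hilbert
variable {L H : Type*} [NormedAddCommGroup L] [InnerProductSpace ℝ L] [CompleteSpace L]
  [NormedAddCommGroup H] [InnerProductSpace ℝ H] [CompleteSpace H]
variable {ι : H →L[ℝ] L} {l : ℝ} {B : L →L[ℝ] L}

lemma Res.ident (h : Res ι l B) (f φ : L) :
    ι (ι.adjoint (f - B φ)) = ι (ι.adjoint f) - φ + l • (f - (f - B φ)) := by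
  have e : ι (ι.adjoint (B φ)) = φ - l • B φ := eq_sub_of_add_eq (h.eq φ)
  rw [map_sub, map_sub, e, sub_sub_cancel]
  abel

lemma adj_le (ι : H →L[ℝ] L) (f : L) : ‖ι.adjoint f‖ ≤ ‖ι‖ * ‖f‖ := by
  have := ι.adjoint.le_opNorm f
  rwa [LinearIsometryEquiv.norm_map] at this

lemma Res.energy (h : Res ι l B) (f φ : L) :
    l * ‖f - B φ‖ ^ 2 ≤ -2 * inner ℝ φ (f - B φ) + (‖ι‖ ^ 2 + l) * ‖f‖ ^ 2 := by
  have h1 := h.ident f φ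
  set w := f - B φ with hw
  have h2 : inner ℝ (ι (ι.adjoint w)) w = inner ℝ (ι (ι.adjoint f) - φ + l • (f - w)) w := by rw [← h1]
  rw [inner_add_left, inner_sub_left, real_inner_smul_left, inner_sub_left,
    ← ContinuousLinearMap.adjoint_inner_right ι, ← ContinuousLinearMap.adjoint_inner_right ι,
    real_inner_self_eq_norm_sq, real_inner_self_eq_norm_sq] at h2
  have h3 : inner ℝ (ι.adjoint f) (ι.adjoint w) ≤ (‖ι.adjoint f‖ ^ 2 + ‖ι.adjoint w‖ ^ 2) / 2 := by
    have := real_inner_le_norm (ι.adjoint f) (ι.adjoint w)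
    nlinarith [sq_nonneg (‖ι.adjoint f‖ - ‖ι.adjoint w‖)]
  have h4 : inner ℝ f w ≤ (‖f‖ ^ 2 + ‖w‖ ^ 2) / 2 := by
    have := real_inner_le_norm f w
    nlinarith [sq_nonneg (‖f‖ - ‖w‖)]
  have h5 := mul_le_mul_of_nonneg_left h4 h.pos.le
  have h6 : ‖ι.adjoint f‖ ^ 2 ≤ ‖ι‖ ^ 2 * ‖f‖ ^ 2 := by
    rw [← mul_pow]; gcongr; exact adj_le ι f
  nlinarith [sq_nonneg ‖ι.adjoint w‖]

lemma Res.rem (h : Res ι l B) (hl : l ≤ 1) (f φ : L) {R : ℝ} (hR : ‖f‖ ≤ R) :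
    l * ‖f - (f - B φ)‖ ≤ Real.sqrt l * ((R + 1 / 2 + (‖ι‖ ^ 2 + 1) * R ^ 2 / 2) - inner ℝ φ (f - B φ)) := by
  have h1 := h.energy f φ
  set w := f - B φ with hw
  have hp := h.pos
  set q := Real.sqrt l with hq
  have hq2 : l = q ^ 2 := (Real.sq_sqrt hp.le).symm
  have hq0 : 0 ≤ q := Real.sqrt_nonneg _
  have hq1 : q ≤ 1 := by rw [hq]; exact Real.sqrt_le_one.2 hl
  have h2 : ‖f - w‖ ≤ R + ‖w‖ := (norm_sub_le _ _).trans (by linarith)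
  have h3 : ‖f‖ ^ 2 ≤ R ^ 2 := by gcongr
  have h4 : (‖ι‖ ^ 2 + l) * ‖f‖ ^ 2 ≤ (‖ι‖ ^ 2 + 1) * R ^ 2 := by gcongr
  have hR0 : 0 ≤ R := (norm_nonneg f).trans hR
  have h5 : q * ‖w‖ ≤ (1 + l * ‖w‖ ^ 2) / 2 := by
    rw [hq2]; nlinarith [sq_nonneg (1 - q * ‖w‖)]
  calc l * ‖f - w‖ ≤ l * (R + ‖w‖) := by gcongr
    _ = q * (q * R + q * ‖w‖) := by rw [hq2]; ring
    _ ≤ q * (R + (1 + l * ‖w‖ ^ 2) / 2) := by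
        gcongr
        nlinarith
    _ ≤ _ := by
        gcongr
        linarith

end hilbert

variable {X : Type*} [MeasurableSpace X] {μ : Measure X}
variable {H : Type*} [NormedAddCommGroup H] [InnerProductSpace ℝ H] [CompleteSpace H]
variable {ι : H →L[ℝ] Lp ℝ 2 μ} {l : ℝ} {B : Lp ℝ 2 μ →L[ℝ] Lp ℝ 2 μ}
variable {m p n σ T : ℝ} {Φ F : LF} {u : ℝ → Lp ℝ 2 μ}

lemma idL_app (v : Lp ℝ 2 μ) : idL.app v = v := Lp.ext (by
  filter_upwards [idL.coe_app v] with x hx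
  rw [hx]; rfl)

lemma zeroL_app (v : Lp ℝ 2 μ) : zeroL.app v = 0 := Lp.ext (by
  filter_upwards [zeroL.coe_app v, Lp.coeFn_zero ℝ 2 μ] with x hx h2
  rw [hx, h2]; rfl)

lemma Sol.norm_le (hs : Sol B Φ F T u) (D : Dat m p n σ Φ F) (hB : Res ι l B) (hnc : NC ι)
    (t : ℝ) (ht : t ∈ Set.Icc 0 T) : ‖u t‖ ^ 2 ≤ Real.exp (2 * F.K * T) * ‖u 0‖ ^ 2 := by
  have hJ := hB.markov hnc
  have h1 := gronwall (fun t => ‖u t‖ ^ 2) _ (2 * F.K) T (ht.1.trans ht.2)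
    (fun t ht => (hs.deriv t ht).norm_sq) (fun t ht => by
      have h1 := hJ.sv idL Φ zeroL (fun s t => by
        simp only [zeroL, idL]
        rcases le_total s t with h | h
        · have := D.mono h
          nlinarith
        · have := D.mono h
          nlinarith) (u t)
      rw [zeroL_app, idL_app, map_zero, inner_zero_left, sub_zero] at h1
      have h2 : 0 ≤ inner ℝ (u t) (B (Φ.app (u t))) := by
        rw [hB.inner_B]
        exact mul_nonneg (inv_pos.2 hB.pos).le h1
      have h3 : inner ℝ (u t) (F.app (u t)) ≤ F.K * ‖u t‖ ^ 2 := by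
        refine (real_inner_le_norm _ _).trans ?_
        have := mul_le_mul_of_nonneg_left (F.app_norm (u t)) (norm_nonneg (u t))
        linarith
      rw [inner_sub_right]
      linarith) t ht
  refine h1.trans ?_
  have := F.K.2
  gcongr
  exact ht.2

lemma Dat.F_sq (D : Dat m p n σ Φ F) : ∃ A : ℝ, 0 < A ∧ ∀ a b, 0 ≤ a → a ≤ n → 0 ≤ b → b ≤ n →
    (F.f a - F.f b) ^ 2 ≤ A * ((a - b) * (Φ.f a - Φ.f b)) := by
  have hσ := D.hσ
  have hm := D.hm
  have hσm : 0 < σ ^ (m - 1) := by positivity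
  refine ⟨((F.K : ℝ) ^ 2 + 1) / σ ^ (m - 1), by positivity, ?_⟩
  have main : ∀ a b, 0 ≤ a → a ≤ n → 0 ≤ b → b ≤ n → b ≤ a →
    (F.f a - F.f b) ^ 2 ≤ ((F.K : ℝ) ^ 2 + 1) / σ ^ (m - 1) * ((a - b) * (Φ.f a - Φ.f b)) := by
    intro a b ha han hb hbn hba
    rcases le_total a σ with h | h
    · rw [D.F0 a h, D.F0 b (hba.trans h)]
      have := D.mono hba
      have h1 : 0 ≤ (a - b) * (Φ.f a - Φ.f b) := mul_nonneg (by linarith) (by linarith)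
      have h2 : 0 ≤ ((F.K : ℝ) ^ 2 + 1) / σ ^ (m - 1) := by positivity
      have := mul_nonneg h2 h1
      simpa using this
    · have ha0 : 0 < a := hσ.trans_le h
      rw [D.Φeq, D.Φeq, clamp_eq ha han, clamp_eq hb hbn]
      have h1 := F.abs_sub a b
      rw [abs_of_nonneg (sub_nonneg.2 hba)] at h1
      have h2 : (F.f a - F.f b) ^ 2 ≤ (F.K * (a - b)) ^ 2 := by
        rw [← sq_abs]; gcongr
      have h3 : a ^ m = a ^ (m - 1) * a := by
        rw [← Real.rpow_add_one ha0.ne']; congr 1; ring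
      have h4 : b ^ m ≤ a ^ (m - 1) * b := by
        rcases hb.eq_or_lt with rfl | hb'
        · rw [Real.zero_rpow (by linarith), mul_zero]
        · have : b ^ m = b ^ (m - 1) * b := by
            rw [← Real.rpow_add_one hb'.ne']; congr 1; ring
          rw [this]
          have := Real.rpow_le_rpow hb hba (show 0 ≤ m - 1 by linarith)
          gcongr
      have h5 : σ ^ (m - 1) * (a - b) ≤ a ^ m - b ^ m := by
        have h6 := Real.rpow_le_rpow hσ.le h (show 0 ≤ m - 1 by linarith)
        have h7 := mul_le_mul_of_nonneg_right h6 (sub_nonneg.2 hba)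
        nlinarith
      have h8 : (a - b) * (σ ^ (m - 1) * (a - b)) ≤ (a - b) * (a ^ m - b ^ m) :=
        mul_le_mul_of_nonneg_left h5 (sub_nonneg.2 hba)
      rw [div_mul_eq_mul_div, le_div_iff₀ hσm]
      have h9 := mul_le_mul_of_nonneg_left h8 (show 0 ≤ (F.K : ℝ) ^ 2 + 1 by positivity)
      have h10 := mul_le_mul_of_nonneg_right h2 hσm.le
      nlinarith [mul_nonneg hσm.le (sq_nonneg (a - b))]
  intro a b ha han hb hbn
  rcases le_total b a with h | h
  · exact main a b ha han hb hbn h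
  · have := main b a hb hbn ha han h
    nlinarith

lemma Dat.pow_le (D : Dat m p n σ Φ F) (a b : ℝ) (ha : 0 ≤ a) (han : a ≤ n) (hb : 0 ≤ b) (hbn : b ≤ n) :
    |a - b| ^ (m + 1) ≤ (a - b) * (Φ.f a - Φ.f b) := by
  have hm := D.hm
  have main : ∀ a b, 0 ≤ a → a ≤ n → 0 ≤ b → b ≤ n → b ≤ a →
     (a - b) ^ (m + 1) ≤ (a - b) * (Φ.f a - Φ.f b) := by
    intro a b ha han hb hbn hba
    have h0 := sub_nonneg.2 hba
    rw [D.Φeq, D.Φeq, clamp_eq ha han, clamp_eq hb hbn, add_comm, Real.rpow_add' h0 (by linarith),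
      Real.rpow_one]
    refine mul_le_mul_of_nonneg_left ?_ h0
    have := Real.add_rpow_le_rpow_add h0 hb (p := m) hm.le
    rw [sub_add_cancel] at this
    linarith
  rcases le_total b a with h | h
  · rw [abs_of_nonneg (sub_nonneg.2 h)]; exact main a b ha han hb hbn h
  · have := main b a hb hbn ha han h
    rw [abs_sub_comm, abs_of_nonneg (sub_nonneg.2 h)]
    linarith

lemma Dat.prim_nonneg (D : Dat m p n σ Φ F) {s : ℝ} (hs : 0 ≤ s) : 0 ≤ Φ.prim s :=
  intervalIntegral.integral_nonneg hs fun x _ => by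
    rw [D.Φeq]; exact Real.rpow_nonneg (clamp_nonneg _ _) _

/-- remainder constant -/
noncomputable def remC (ι : H →L[ℝ] Lp ℝ 2 μ) (F : LF) (T : ℝ) (x0 : Lp ℝ 2 μ) : ℝ :=
  (F.K * (Real.exp (F.K * T) * ‖x0‖) + 1 / 2 +
    (‖ι‖ ^ 2 + 1) * (F.K * (Real.exp (F.K * T) * ‖x0‖)) ^ 2 / 2)

lemma remC_nonneg (x0 : Lp ℝ 2 μ) : 0 ≤ remC ι F T x0 := by
  unfold remC; positivity

lemma Sol.norm_le' (hs : Sol B Φ F T u) (D : Dat m p n σ Φ F) (hB : Res ι l B) (hnc : NC ι)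
    (t : ℝ) (ht : t ∈ Set.Icc 0 T) : ‖u t‖ ≤ Real.exp (F.K * T) * ‖u 0‖ := by
  have := hs.norm_le D hB hnc t ht
  refine le_of_sq_le_sq ?_ (by positivity)
  refine this.trans (le_of_eq ?_)
  rw [mul_pow, ← Real.exp_nat_mul]; congr 2; push_cast; ring

lemma Sol.rem (hs : Sol B Φ F T u) (D : Dat m p n σ Φ F) (hB : Res ι l B) (hnc : NC ι) (hl : l ≤ 1)
    (t : ℝ) (ht : t ∈ Set.Icc 0 T) :
    l * ‖F.app (u t) - (F.app (u t) - B (Φ.app (u t)))‖ ≤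
      Real.sqrt l * (remC ι F T (u 0) - inner ℝ (Φ.app (u t)) (F.app (u t) - B (Φ.app (u t)))) := by
  refine hB.rem hl _ _ ?_
  refine (F.app_norm _).trans ?_
  exact mul_le_mul_of_nonneg_left (hs.norm_le' D hB hnc t ht) F.K.2

/-- approximate weak formulation -/
lemma Sol.weak (hs : Sol B Φ F T u) (D : Dat m p n σ Φ F) (hB : Res ι l B) (hnc : NC ι) (hl : l ≤ 1)
    (hT : 0 ≤ T) (hu : ∀ t ∈ Set.Icc 0 T, ∀ᵐ x ∂μ, 0 ≤ u t x ∧ u t x ≤ n)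
    (φ φ' ζ : ℝ → Lp ℝ 2 μ) (hφ : ∀ t, HasDerivAt φ (φ' t) t) (hφ' : Continuous φ')
    (hζ : Continuous ζ) (hζφ : ∀ t, ι (ι.adjoint (ζ t)) = φ t) (Z : ℝ) (hZ : ∀ t, ‖ζ t‖ ≤ Z) :
    |inner ℝ (u T) (φ T) - inner ℝ (u 0) (φ 0) -
      ∫ t in (0 : ℝ)..T, (inner ℝ (u t) (φ' t) - inner ℝ (Φ.app (u t)) (ζ t) + inner ℝ (F.app (u t)) (φ t))|
    ≤ Real.sqrt l * (Z * (remC ι F T (u 0) * T + ∫ x, Φ.prim (u 0 x) ∂μ)) := by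
  have hφc : Continuous φ := continuous_iff_continuousAt.2 fun t => (hφ t).continuousAt
  have hΦc := Φ.app_cont (μ := μ)
  have hFc := F.app_cont (μ := μ)
  have huc := hs.cont
  set k : ℝ → ℝ := fun t => inner ℝ (u t) (φ' t) - inner ℝ (Φ.app (u t)) (ζ t) + inner ℝ (F.app (u t)) (φ t)
    with hk
  have hkc : Continuous k := by fun_prop
  set q := Real.sqrt l with hq
  have hq0 : 0 ≤ q := Real.sqrt_nonneg _
  have hZ0 : 0 ≤ Z := (norm_nonneg _).trans (hZ 0)
  set R := remC ι F T (u 0) with hR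
  have hPT : 0 ≤ ∫ x, Φ.prim (u T x) ∂μ := integral_nonneg_of_ae (by
    filter_upwards [hu T ⟨hT, le_rfl⟩] with x hx
    exact D.prim_nonneg hx.1)
  have key : ∀ t ∈ Set.Icc 0 T, |(inner ℝ (u t) (φ' t) +
      inner ℝ (F.app (u t) - B (Φ.app (u t))) (φ t)) - k t| ≤
      Z * q * (R - inner ℝ (Φ.app (u t)) (F.app (u t) - B (Φ.app (u t)))) := by
    intro t ht
    have h1 := hB.ident (F.app (u t)) (Φ.app (u t))
    have h2 := hs.rem D hB hnc hl t ht
    set w := F.app (u t) - B (Φ.app (u t)) with hw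
    have h3 : inner ℝ w (φ t) = inner ℝ (F.app (u t)) (φ t) - inner ℝ (Φ.app (u t)) (ζ t)
        + l * inner ℝ (F.app (u t) - w) (ζ t) := by
      have a1 : ∀ f, inner ℝ f (φ t) = inner ℝ (ι (ι.adjoint f)) (ζ t) := fun f => by
        rw [← hζφ, ← ContinuousLinearMap.adjoint_inner_left ι, ← ContinuousLinearMap.adjoint_inner_right ι]
      rw [a1 w, h1, inner_add_left, inner_sub_left, real_inner_smul_left, ← a1]
    have h4 : inner ℝ (u t) (φ' t) + inner ℝ w (φ t) - k t = l * inner ℝ (F.app (u t) - w) (ζ t) := by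
      rw [h3, hk]; ring
    rw [h4, abs_mul, abs_of_pos hB.pos]
    calc l * |inner ℝ (F.app (u t) - w) (ζ t)| ≤ l * (‖F.app (u t) - w‖ * ‖ζ t‖) := by
          have := abs_real_inner_le_norm (F.app (u t) - w) (ζ t)
          have := hB.pos
          gcongr
      _ ≤ l * (‖F.app (u t) - w‖ * Z) := by
          have := hB.pos
          gcongr
          exact hZ t
      _ = Z * (l * ‖F.app (u t) - w‖) := by ring
      _ ≤ Z * (q * (R - inner ℝ (Φ.app (u t)) w)) := by gcongr
      _ = _ := by ring
  have hd1 : ∀ t ∈ Set.Icc 0 T, HasDerivAt (fun t => inner ℝ (u t) (φ t)) _ t :=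
    fun t ht => (hs.deriv t ht).inner ℝ (hφ t)
  have hd2 : ∀ t ∈ Set.Icc 0 T, HasDerivAt (fun t => Z * q * ∫ x, Φ.prim (u t x) ∂μ) _ t :=
    fun t ht => (Φ.hasDerivAt_integral (hs.deriv t ht)).const_mul (Z * q)
  have i1 := sub_le_of_deriv (fun t => inner ℝ (u t) (φ t) + Z * q * ∫ x, Φ.prim (u t x) ∂μ) _
    (fun t => k t + Z * q * R) T hT (fun t ht => (hd1 t ht).add (hd2 t ht)) (by fun_prop)
    (fun t ht => by
      have := (abs_le.1 (key t ht)).2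
      linarith)
  have i2 := sub_le_of_deriv (fun t => - inner ℝ (u t) (φ t) + Z * q * ∫ x, Φ.prim (u t x) ∂μ) _
    (fun t => - k t + Z * q * R) T hT (fun t ht => (hd1 t ht).neg.add (hd2 t ht)) (by fun_prop)
    (fun t ht => by
      have := (abs_le.1 (key t ht)).1
      linarith)
  rw [intervalIntegral.integral_add (hkc.intervalIntegrable _ _) (by simp)] at i1
  rw [intervalIntegral.integral_add (f := fun t => - k t) (g := fun _ => Z * q * R)
    (hkc.neg.intervalIntegrable _ _) (by simp), intervalIntegral.integral_neg] at i2
  simp only [intervalIntegral.integral_const, sub_zero, smul_eq_mul] at i1 i2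
  have := mul_nonneg (mul_nonneg hZ0 hq0) hPT
  rw [abs_le]
  constructor <;> nlinarith

end VWS

namespace VWS
variable {X : Type*} [MeasurableSpace X] {μ : Measure X}
variable {H : Type*} [NormedAddCommGroup H] [InnerProductSpace ℝ H] [CompleteSpace H]
variable {ι : H →L[ℝ] Lp ℝ 2 μ}
variable {m p n σ T : ℝ} {Φ F : LF}

lemma Dat.F_inner (D : Dat m p n σ Φ F) : ∃ A : ℝ, 0 < A ∧ ∀ a b : Lp ℝ 2 μ,
    (∀ᵐ x ∂μ, 0 ≤ a x ∧ a x ≤ n) → (∀ᵐ x ∂μ, 0 ≤ b x ∧ b x ≤ n) →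
    ‖F.app a - F.app b‖ ^ 2 ≤ A * inner ℝ (a - b) (Φ.app a - Φ.app b) := by
  obtain ⟨A, hA, h⟩ := D.F_sq
  refine ⟨A, hA, fun a b ha hb => ?_⟩
  rw [← real_inner_self_eq_norm_sq, ← real_inner_smul_left]
  apply inner_mono
  filter_upwards [ha, hb, Lp.coeFn_sub a b, Lp.coeFn_sub (F.app a) (F.app b),
    Lp.coeFn_sub (Φ.app a) (Φ.app b), Lp.coeFn_smul A (a - b), F.coe_app a, F.coe_app b,
    Φ.coe_app a, Φ.coe_app b] with x h1 h2 h3 h4 h5 h6 h7 h8 h9 h10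
  rw [h4, h6, h5, Pi.smul_apply, h3]
  simp only [Pi.sub_apply, smul_eq_mul]
  rw [h7, h8, h9, h10]
  have := h _ _ h1.1 h1.2 h2.1 h2.2
  linarith

set_option maxHeartbeats 2000000 in
/-- Cauchy estimate in the regularisation parameter -/
lemma Dat.cauchy (D : Dat m p n σ Φ F) (hT : 0 ≤ T) (hnc : NC ι) (x0 : Lp ℝ 2 μ) :
    ∃ K : ℝ, 0 ≤ K ∧ ∀ (l l' : ℝ) (B B' : Lp ℝ 2 μ →L[ℝ] Lp ℝ 2 μ) (u v : ℝ → Lp ℝ 2 μ),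
      Res ι l B → Res ι l' B' → l ≤ 1 → l' ≤ 1 → Sol B Φ F T u → Sol B' Φ F T v →
      u 0 = x0 → v 0 = x0 → (∀ t ∈ Set.Icc 0 T, ∀ᵐ x ∂μ, 0 ≤ u t x ∧ u t x ≤ n) →
      (∀ t ∈ Set.Icc 0 T, ∀ᵐ x ∂μ, 0 ≤ v t x ∧ v t x ≤ n) →
      ∫ t in (0 : ℝ)..T, inner ℝ (u t - v t) (Φ.app (u t) - Φ.app (v t)) ≤
        K * (Real.sqrt l + Real.sqrt l') := by
  obtain ⟨A, hA, hF⟩ := D.F_inner (μ := μ)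
  set C := A * ‖ι‖ ^ 2 with hC
  have hC0 : 0 ≤ C := by positivity
  set M := Real.exp (F.K * T) * ‖x0‖ with hM
  have hM0 : 0 ≤ M := by positivity
  set a0 := remC ι F T x0 with ha0
  have ha00 : 0 ≤ a0 := remC_nonneg x0
  set P0 := ∫ x, Φ.prim (x0 x) ∂μ with hP0
  refine ⟨|Real.exp (C * T) * (4 * M * P0 + 4 * M * a0 * T)|, abs_nonneg _, ?_⟩
  intro l l' B B' u v hB hB' hl hl' hu hv hu0 hv0 hub hvb
  have s0 : 0 ≤ Real.sqrt l := Real.sqrt_nonneg _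
  have s0' : 0 ≤ Real.sqrt l' := Real.sqrt_nonneg _
  refine le_trans ?_ (mul_le_mul_of_nonneg_right (le_abs_self _) (add_nonneg s0 s0'))
  set q : ℝ → ℝ := fun t => inner ℝ (u t - v t) (Φ.app (u t) - Φ.app (v t)) with hq
  have hqc : Continuous q := by
    have := hu.cont
    have := hv.cont
    have := Φ.app_cont (μ := μ)
    fun_prop
  have hq0 : ∀ t ∈ Set.Icc 0 T, 0 ≤ q t := fun t ht => by
    have := hF _ _ (hub t ht) (hvb t ht)
    have h2 := sq_nonneg ‖F.app (u t) - F.app (v t)‖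
    exact nonneg_of_mul_nonneg_right (h2.trans this) hA
  set Q : ℝ → ℝ := fun t => ‖ι.adjoint (u t - v t)‖ ^ 2 +
    (4 * M * Real.sqrt l * ∫ x, Φ.prim (u t x) ∂μ) + 4 * M * Real.sqrt l' * ∫ x, Φ.prim (v t x) ∂μ with hQ
  have hP : ∀ (w : ℝ → Lp ℝ 2 μ), (∀ t ∈ Set.Icc 0 T, ∀ᵐ x ∂μ, 0 ≤ w t x ∧ w t x ≤ n) →
      ∀ t ∈ Set.Icc 0 T, 0 ≤ ∫ x, Φ.prim (w t x) ∂μ := fun w hw t ht =>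
    integral_nonneg_of_ae (by
      filter_upwards [hw t ht] with x hx
      exact D.prim_nonneg hx.1)
  have hQd : ∀ t ∈ Set.Icc 0 T, ∃ Q', HasDerivAt Q Q' t ∧
      Q' ≤ C * Q t - q t + 4 * M * a0 * (Real.sqrt l + Real.sqrt l') := by
    intro t ht
    have r1 := hu.rem D hB hnc hl t ht
    have r2 := hv.rem D hB' hnc hl' t ht
    have e1 := hB.ident (F.app (u t)) (Φ.app (u t))
    have e2 := hB'.ident (F.app (v t)) (Φ.app (v t))
    have d1 := hu.deriv t ht
    have d2 := hv.deriv t ht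
    have nu := hu.norm_le' D hB hnc t ht
    have nv := hv.norm_le' D hB' hnc t ht
    have hFq := hF _ _ (hub t ht) (hvb t ht)
    have p1 := mul_nonneg (mul_nonneg (mul_nonneg (by norm_num : (0:ℝ) ≤ 4) hM0) s0) (hP u hub t ht)
    have p2 := mul_nonneg (mul_nonneg (mul_nonneg (by norm_num : (0:ℝ) ≤ 4) hM0) s0') (hP v hvb t ht)
    have d3 := (((ι.adjoint.hasFDerivAt.comp_hasDerivAt t (d1.sub d2)).norm_sq).add
      ((Φ.hasDerivAt_integral d1).const_mul (4 * M * Real.sqrt l))).add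
      ((Φ.hasDerivAt_integral d2).const_mul (4 * M * Real.sqrt l'))
    refine ⟨_, d3, ?_⟩
    rw [hu0] at r1 nu
    rw [hv0] at r2 nv
    rw [← ha0] at r1 r2
    rw [← hM] at nu nv
    simp only [hQ, hq, Function.comp_apply, Pi.sub_apply] at *
    set f := F.app (u t)
    set g := F.app (v t)
    set w := f - B (Φ.app (u t)) with hw
    set w' := g - B' (Φ.app (v t)) with hw'
    set d := u t - v t with hd
    have hdn : ‖d‖ ≤ 2 * M := (norm_sub_le _ _).trans (by linarith)
    have k1 : inner ℝ (ι.adjoint d) (ι.adjoint (w - w')) =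
        inner ℝ (ι.adjoint d) (ι.adjoint (f - g)) - inner ℝ d (Φ.app (u t) - Φ.app (v t))
         + l * inner ℝ d (f - w) - l' * inner ℝ d (g - w') := by
      rw [ContinuousLinearMap.adjoint_inner_left ι, ContinuousLinearMap.adjoint_inner_left ι, map_sub, map_sub, e1, e2,
        map_sub, map_sub, ← real_inner_smul_right, ← real_inner_smul_right, ← inner_sub_right,
        ← inner_add_right, ← inner_sub_right]
      congr 1
      abel
    have k2 : 2 * inner ℝ (ι.adjoint d) (ι.adjoint (f - g)) ≤ C * ‖ι.adjoint d‖ ^ 2 +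
        inner ℝ d (Φ.app (u t) - Φ.app (v t)) := by
      have h1 := real_inner_le_norm (ι.adjoint d) (ι.adjoint (f - g))
      have h2 := mul_le_mul_of_nonneg_left (adj_le ι (f - g)) (norm_nonneg (ι.adjoint d))
      refine le_of_mul_le_mul_left ?_ hA
      have h3 := sq_nonneg (A * ‖ι‖ * ‖ι.adjoint d‖ - ‖f - g‖)
      have h4 := mul_le_mul_of_nonneg_left (h1.trans h2) hA.le
      rw [hC]
      nlinarith
    have k3 : l * inner ℝ d (f - w) ≤ 2 * M * (Real.sqrt l * (a0 - inner ℝ (Φ.app (u t)) w)) := by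
      calc l * inner ℝ d (f - w) ≤ l * (‖d‖ * ‖f - w‖) :=
            mul_le_mul_of_nonneg_left (real_inner_le_norm _ _) hB.pos.le
        _ = ‖d‖ * (l * ‖f - w‖) := by ring
        _ ≤ 2 * M * (l * ‖f - w‖) :=
            mul_le_mul_of_nonneg_right hdn (mul_nonneg hB.pos.le (norm_nonneg _))
        _ ≤ _ := mul_le_mul_of_nonneg_left r1 (by positivity)
    have k4 : - (l' * inner ℝ d (g - w')) ≤ 2 * M * (Real.sqrt l' * (a0 - inner ℝ (Φ.app (v t)) w')) := by
      calc - (l' * inner ℝ d (g - w')) ≤ l' * (‖d‖ * ‖g - w'‖) := by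
            have := (abs_le.1 (abs_real_inner_le_norm d (g - w'))).1
            have := mul_le_mul_of_nonneg_left this hB'.pos.le
            linarith
        _ = ‖d‖ * (l' * ‖g - w'‖) := by ring
        _ ≤ 2 * M * (l' * ‖g - w'‖) :=
            mul_le_mul_of_nonneg_right hdn (mul_nonneg hB'.pos.le (norm_nonneg _))
        _ ≤ _ := mul_le_mul_of_nonneg_left r2 (by positivity)
    rw [k1]
    have p3 := mul_nonneg hC0 (add_nonneg p1 p2)
    linarith
  choose! Q' hQ1 hQ2 using hQd
  have fin := sub_le_of_deriv (fun t => Real.exp (-C * t) * Q t)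
    (fun t => Real.exp (-C * t) * (-C * 1) * Q t + Real.exp (-C * t) * Q' t)
    (fun t => - Real.exp (-C * T) * q t + 4 * M * a0 * (Real.sqrt l + Real.sqrt l')) T hT
    (fun t ht => ((((hasDerivAt_id t).const_mul (-C)).exp).mul (hQ1 t ht))) (by fun_prop)
    (fun t ht => by
      have e0 := Real.exp_pos (-C * t)
      have e1 : Real.exp (-C * t) ≤ 1 := Real.exp_le_one_iff.2 (by nlinarith [ht.1])
      have e2 : Real.exp (-C * T) ≤ Real.exp (-C * t) := Real.exp_le_exp.2 (by nlinarith [ht.2])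
      have h1 := mul_le_mul_of_nonneg_left (hQ2 t ht) e0.le
      have h2 := mul_le_mul_of_nonneg_right e2 (hq0 t ht)
      have h3 : 0 ≤ 4 * M * a0 * (Real.sqrt l + Real.sqrt l') := by positivity
      have h4 := mul_le_mul_of_nonneg_right e1 h3
      linarith)
  rw [intervalIntegral.integral_add (f := fun t => - Real.exp (-C * T) * q t)
    ((continuous_const.mul hqc).intervalIntegrable _ _) (by simp), intervalIntegral.integral_const_mul] at fin
  simp only [intervalIntegral.integral_const, sub_zero, smul_eq_mul, mul_zero, Real.exp_zero, one_mul] at fin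
  have hQT : 0 ≤ Q T := by
    have p1 := mul_nonneg (mul_nonneg (mul_nonneg (by norm_num : (0:ℝ) ≤ 4) hM0) s0) (hP u hub T ⟨hT, le_rfl⟩)
    have p2 := mul_nonneg (mul_nonneg (mul_nonneg (by norm_num : (0:ℝ) ≤ 4) hM0) s0') (hP v hvb T ⟨hT, le_rfl⟩)
    simp only [hQ]
    positivity
  have hQ0 : Q 0 = 4 * M * P0 * (Real.sqrt l + Real.sqrt l') := by
    simp only [hQ, hu0, hv0, sub_self, map_zero, norm_zero, ← hP0]
    ring
  have hET : Real.exp (C * T) * Real.exp (-C * T) = 1 := by rw [← Real.exp_add]; simp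
  have h1 : Real.exp (-C * T) * (∫ t in (0 : ℝ)..T, q t) ≤
      (4 * M * P0 + 4 * M * a0 * T) * (Real.sqrt l + Real.sqrt l') := by
    have := mul_nonneg (Real.exp_pos (-C * T)).le hQT
    rw [hQ0] at fin
    linarith
  have h2 := mul_le_mul_of_nonneg_left h1 (Real.exp_pos (C * T)).le
  rw [← mul_assoc, hET, one_mul] at h2
  linarith

end VWS

namespace VWS
variable {X : Type*} [MeasurableSpace X] {μ : Measure X}

lemma ae_tendsto_zero_of_tsum {Y : Type*} [MeasurableSpace Y] {ν : Measure Y} (g : ℕ → Y → ENNReal)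
    (hg : ∀ k, AEMeasurable (g k) ν)
    (h : ∑' k, ∫⁻ x, g k x ∂ν ≠ ⊤) :
    ∀ᵐ x ∂ν, Filter.Tendsto (fun k => g k x) Filter.atTop (nhds 0) := by
  rw [← lintegral_tsum hg] at h
  have := ae_lt_top' (AEMeasurable.tsum hg) h
  filter_upwards [this] with x hx
  exact ENNReal.tendsto_atTop_zero_of_tsum_ne_top hx.ne

lemma lintegral_sq (f : Lp ℝ 2 μ) : ∫⁻ x, ENNReal.ofReal (f x ^ 2) ∂μ = ENNReal.ofReal (‖f‖ ^ 2) := by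
  rw [norm_sq_eq, ofReal_integral_eq_lintegral_ofReal]
  · have := integrable_mul f f
    simpa [sq] using this
  · exact Filter.Eventually.of_forall fun x => sq_nonneg _

lemma exists_joint (u : ℝ → Lp ℝ 2 μ) (hu : Continuous u) (T : ℝ) :
    ∃ U : X × ℝ → ℝ, Measurable U ∧ ∀ t ∈ Set.Icc 0 T, ∀ᵐ x ∂μ, U (x, t) = u t x := by
  have huc : UniformContinuousOn u (Set.Icc 0 T) :=
    isCompact_Icc.uniformContinuousOn_of_continuous hu.continuousOn
  have hδ : ∀ k : ℕ, ∃ δ > 0, ∀ s ∈ Set.Icc 0 T, ∀ t ∈ Set.Icc 0 T, dist s t < δ →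
      dist (u s) (u t) < (1 / 2 : ℝ) ^ k := fun k => by
    obtain ⟨δ, h1, h2⟩ := Metric.uniformContinuousOn_iff.1 huc ((1 / 2 : ℝ) ^ k) (by positivity)
    exact ⟨δ, h1, fun s hs t ht h => h2 s hs t ht h⟩
  choose δ hδ0 hδ using hδ
  set s : ℕ → ℝ → ℝ := fun k t => δ k / 2 * ⌊t / (δ k / 2)⌋ with hs
  have hsm : ∀ k, ∀ t ∈ Set.Icc 0 T, dist (u (s k t)) (u t) < (1 / 2 : ℝ) ^ k := fun k t ht => by
    have h2 : 0 < δ k / 2 := by have := hδ0 k; positivity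
    have e : t = δ k / 2 * (t / (δ k / 2)) := (mul_div_cancel₀ t h2.ne').symm
    have h1 : s k t ≤ t := by
      conv_rhs => rw [e]
      exact mul_le_mul_of_nonneg_left (Int.floor_le _) h2.le
    have h3 : t ≤ s k t + δ k / 2 := by
      conv_lhs => rw [e]
      have := mul_le_mul_of_nonneg_left (Int.lt_floor_add_one (t / (δ k / 2))).le h2.le
      simp only [hs]
      linarith
    have h0 : 0 ≤ s k t := by
      have : 0 ≤ ⌊t / (δ k / 2)⌋ := Int.floor_nonneg.2 (div_nonneg ht.1 h2.le)
      have : (0 : ℝ) ≤ ⌊t / (δ k / 2)⌋ := by exact_mod_cast this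
      exact mul_nonneg h2.le this
    refine hδ k _ ⟨h0, h1.trans ht.2⟩ _ ht ?_
    rw [Real.dist_eq, abs_lt]
    constructor <;> linarith
  have hUm : ∀ k, Measurable (fun z : X × ℝ => u (s k z.2) z.1) := fun k => by
    have h1 : Measurable (fun z : X × ℤ => u (δ k / 2 * z.2) z.1) :=
      measurable_from_prod_countable_left fun j => (Lp.stronglyMeasurable (u (δ k / 2 * j))).measurable
    have h2 : Measurable (fun z : X × ℝ => (z.1, ⌊z.2 / (δ k / 2)⌋)) :=
      measurable_fst.prodMk (measurable_snd.div_const _).floor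
    exact h1.comp h2
  refine ⟨fun z => Filter.limUnder Filter.atTop (fun k => u (s k z.2) z.1),
    (StronglyMeasurable.limUnder fun k => (hUm k).stronglyMeasurable).measurable, fun t ht => ?_⟩
  have hconv := ae_tendsto_zero_of_tsum (ν := μ)
    (fun k x => ENNReal.ofReal ((u (s k t) - u t : Lp ℝ 2 μ) x ^ 2))
    (fun k => ((Lp.stronglyMeasurable _).measurable.pow_const 2).ennreal_ofReal.aemeasurable) (by
      simp_rw [lintegral_sq]
      refine ne_top_of_le_ne_top ?_ (ENNReal.tsum_le_tsum (g := fun k => ENNReal.ofReal ((1 / 4 : ℝ) ^ k))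
        fun k => ENNReal.ofReal_le_ofReal ?_)
      · rw [← ENNReal.ofReal_tsum_of_nonneg (fun k => by positivity)
          (summable_geometric_of_lt_one (by norm_num) (by norm_num))]
        exact ENNReal.ofReal_ne_top
      · have := hsm k t ht
        rw [dist_eq_norm] at this
        calc _ ≤ ((1 / 2 : ℝ) ^ k) ^ 2 := by gcongr
          _ = _ := by rw [← pow_mul, mul_comm, pow_mul]; norm_num)
  have hall : ∀ᵐ x ∂μ, ∀ k, (u (s k t) - u t : Lp ℝ 2 μ) x = u (s k t) x - u t x :=
    ae_all_iff.2 fun k => Lp.coeFn_sub _ _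
  filter_upwards [hconv, hall] with x h1 h2
  apply Filter.Tendsto.limUnder_eq
  have h3 := (ENNReal.tendsto_toReal ENNReal.zero_ne_top).comp h1
  simp only [Function.comp_def, ENNReal.toReal_ofReal (sq_nonneg _), h2, ENNReal.toReal_zero] at h3
  have h4 := (Real.continuous_sqrt.tendsto 0).comp h3
  simp only [Function.comp_def, Real.sqrt_sq_eq_abs, Real.sqrt_zero] at h4
  have h5 := (tendsto_zero_iff_abs_tendsto_zero _).2 h4
  have h6 := h5.add_const (u t x)
  simpa using h6

variable {H : Type*} [NormedAddCommGroup H] [InnerProductSpace ℝ H] [CompleteSpace H]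
variable {ι : H →L[ℝ] Lp ℝ 2 μ}
variable {m p n σ T : ℝ} {Φ F : LF}

lemma Dat.cauchy_lint [SFinite μ] (D : Dat m p n σ Φ F) (hT : 0 ≤ T) (u v : ℝ → Lp ℝ 2 μ) (hu : Continuous u)
    (hv : Continuous v)
    (hub : ∀ t ∈ Set.Icc 0 T, ∀ᵐ x ∂μ, 0 ≤ u t x ∧ u t x ≤ n)
    (hvb : ∀ t ∈ Set.Icc 0 T, ∀ᵐ x ∂μ, 0 ≤ v t x ∧ v t x ≤ n)
    (U V : X × ℝ → ℝ) (hU : Measurable U) (hV : Measurable V)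
    (hUu : ∀ t ∈ Set.Icc 0 T, ∀ᵐ x ∂μ, U (x, t) = u t x)
    (hVv : ∀ t ∈ Set.Icc 0 T, ∀ᵐ x ∂μ, V (x, t) = v t x) :
    ∫⁻ z, ENNReal.ofReal (|U z - V z| ^ (m + 1)) ∂(μ.prod (volume.restrict (Set.Icc 0 T))) ≤
      ENNReal.ofReal (∫ t in (0 : ℝ)..T, inner ℝ (u t - v t) (Φ.app (u t) - Φ.app (v t))) := by
  have hm := D.hm
  have hmeas : Measurable fun z => ENNReal.ofReal (|U z - V z| ^ (m + 1)) :=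
    ((hU.sub hV).abs.pow_const _).ennreal_ofReal
  rw [lintegral_prod_symm _ hmeas.aemeasurable]
  set q : ℝ → ℝ := fun t => inner ℝ (u t - v t) (Φ.app (u t) - Φ.app (v t)) with hq
  have hqc : Continuous q := by
    have := Φ.app_cont (μ := μ)
    fun_prop
  have key : ∀ t ∈ Set.Icc 0 T, 0 ≤ q t ∧ ∫⁻ x, ENNReal.ofReal (|U (x, t) - V (x, t)| ^ (m + 1)) ∂μ ≤
      ENNReal.ofReal (q t) := fun t ht => by
    have e1 : ∀ᵐ x ∂μ, |U (x, t) - V (x, t)| ^ (m + 1) ≤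
        (u t - v t : Lp ℝ 2 μ) x * (Φ.app (u t) - Φ.app (v t) : Lp ℝ 2 μ) x := by
      filter_upwards [hub t ht, hvb t ht, hUu t ht, hVv t ht, Lp.coeFn_sub (u t) (v t),
        Lp.coeFn_sub (Φ.app (u t)) (Φ.app (v t)), Φ.coe_app (u t), Φ.coe_app (v t)] with x h1 h2 h3 h4 h5 h6 h7 h8
      rw [h3, h4, h5, h6]
      simp only [Pi.sub_apply]
      rw [h7, h8]
      exact D.pow_le _ _ h1.1 h1.2 h2.1 h2.2
    have e2 : 0 ≤ᵐ[μ] fun x => (u t - v t : Lp ℝ 2 μ) x * (Φ.app (u t) - Φ.app (v t) : Lp ℝ 2 μ) x := by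
      filter_upwards [e1] with x hx
      exact le_trans (by positivity) hx
    refine ⟨inner_nonneg' e2, ?_⟩
    simp only [hq]
    rw [inner_eq, ofReal_integral_eq_lintegral_ofReal (integrable_mul _ _) e2]
    refine lintegral_mono_ae ?_
    filter_upwards [e1] with x hx
    exact ENNReal.ofReal_le_ofReal hx
  rw [intervalIntegral.integral_of_le hT, ← integral_Icc_eq_integral_Ioc,
    ofReal_integral_eq_lintegral_ofReal (hqc.continuousOn.integrableOn_Icc)
      ((ae_restrict_iff' measurableSet_Icc).2 (Filter.Eventually.of_forall fun t ht => (key t ht).1))]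
  exact setLIntegral_mono_ae' measurableSet_Icc (Filter.Eventually.of_forall fun t ht => (key t ht).2)

/-- solution of the truncated problem as a limit of regularised ones -/
lemma Dat.level [SFinite μ] (D : Dat m p n σ Φ F) (hT : 0 ≤ T) (hnc : NC ι) (x0 : Lp ℝ 2 μ)
    (h0 : ∀ᵐ x ∂μ, 0 ≤ x0 x ∧ x0 x ≤ n) (l : ℕ → ℝ) (B : ℕ → Lp ℝ 2 μ →L[ℝ] Lp ℝ 2 μ)
    (hB : ∀ j, Res ι (l j) (B j)) (hl1 : ∀ j, l j ≤ 1)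
    (hl : ∀ j, Real.sqrt (l j) ≤ ((2 : ℝ) ^ (-(m + 2))) ^ j) :
    ∃ (u : ℕ → ℝ → Lp ℝ 2 μ) (U : X × ℝ → ℝ),
      (∀ j, Sol (B j) Φ F T (u j) ∧ u j 0 = x0 ∧ ∀ t ∈ Set.Icc 0 T, ∀ᵐ x ∂μ, 0 ≤ u j t x ∧ u j t x ≤ n) ∧
      Measurable U ∧ (∀ z, 0 ≤ U z ∧ U z ≤ n) ∧
      ∀ᵐ t ∂(volume.restrict (Set.Icc 0 T)), ∀ᵐ x ∂μ,
        Filter.Tendsto (fun j => u j t x) Filter.atTop (nhds (U (x, t))) := by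
  have hm := D.hm
  obtain ⟨K, hK0, hK⟩ := D.cauchy hT hnc x0
  have hex := fun j => exists_sol (B j) Φ F T hT x0
  choose u hu hu0 using hex
  have hb : ∀ j, ∀ t ∈ Set.Icc 0 T, ∀ᵐ x ∂μ, 0 ≤ u j t x ∧ u j t x ≤ n := fun j t ht => by
    have a1 := (hu j).nonneg D (hB j) hnc (by rw [hu0]; exact h0.mono fun x h => h.1) t ht
    have a2 := (hu j).le_n D (hB j) hnc (by rw [hu0]; exact h0.mono fun x h => h.2) t ht
    exact a1.and a2
  have hV := fun j => exists_joint (u j) (hu j).cont T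
  choose V hVm hVu using hV
  set ν := μ.prod (volume.restrict (Set.Icc (0 : ℝ) T)) with hν
  have hd : ∀ j, ∫⁻ z, ENNReal.ofReal (((2 : ℝ) ^ (m + 1)) ^ j * |V (j + 1) z - V j z| ^ (m + 1)) ∂ν ≤
      ENNReal.ofReal (2 * K * (1 / 2) ^ j) := fun j => by
    have c0 : (0 : ℝ) ≤ ((2 : ℝ) ^ (m + 1)) ^ j := by positivity
    simp_rw [ENNReal.ofReal_mul c0]
    rw [lintegral_const_mul' _ _ ENNReal.ofReal_ne_top]
    refine (mul_le_mul_right (D.cauchy_lint hT (u (j + 1)) (u j) (hu _).cont (hu _).cont (hb _) (hb _) _ _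
      (hVm _) (hVm _) (hVu _) (hVu _)) _).trans ?_
    rw [← ENNReal.ofReal_mul c0]
    refine ENNReal.ofReal_le_ofReal ?_
    have h1 := hK _ _ _ _ _ _ (hB (j + 1)) (hB j) (hl1 _) (hl1 _) (hu (j + 1)) (hu j) (hu0 _) (hu0 _) (hb _) (hb _)
    have r0 : (0 : ℝ) ≤ (2 : ℝ) ^ (-(m + 2)) := by positivity
    have r1 : (2 : ℝ) ^ (-(m + 2)) ≤ 1 := Real.rpow_le_one_of_one_le_of_nonpos (by norm_num) (by linarith)
    have h2 : Real.sqrt (l (j + 1)) ≤ ((2 : ℝ) ^ (-(m + 2))) ^ j :=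
      (hl (j + 1)).trans (pow_le_pow_of_le_one r0 r1 (Nat.le_succ j))
    have h3 := hl j
    have h4 := h1.trans (mul_le_mul_of_nonneg_left (add_le_add h2 h3) hK0)
    refine (mul_le_mul_of_nonneg_left h4 c0).trans (le_of_eq ?_)
    have h5 : ((2 : ℝ) ^ (m + 1)) ^ j * ((2 : ℝ) ^ (-(m + 2))) ^ j = (1 / 2) ^ j := by
      rw [← mul_pow, ← Real.rpow_add (by norm_num)]
      congr 1
      rw [show m + 1 + -(m + 2) = (-1 : ℝ) by ring, Real.rpow_neg_one]
      norm_num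
    rw [← h5]; ring
  have hconv := ae_tendsto_zero_of_tsum (ν := ν)
    (fun j z => ENNReal.ofReal (((2 : ℝ) ^ (m + 1)) ^ j * |V (j + 1) z - V j z| ^ (m + 1)))
    (fun j => ((((hVm _).sub (hVm _)).abs.pow_const _).const_mul _).ennreal_ofReal.aemeasurable) (by
      refine ne_top_of_le_ne_top ?_ (ENNReal.tsum_le_tsum hd)
      rw [← ENNReal.ofReal_tsum_of_nonneg (fun k => by positivity)
          ((summable_geometric_of_lt_one (by norm_num) (by norm_num)).mul_left _)]
      exact ENNReal.ofReal_ne_top)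
  have hcv : ∀ᵐ z ∂ν, Filter.Tendsto (fun j => V j z) Filter.atTop
      (nhds (Filter.limUnder Filter.atTop (fun j => V j z))) := by
    filter_upwards [hconv] with z hz
    refine CauchySeq.tendsto_limUnder (cauchySeq_of_summable_dist ?_)
    refine Summable.of_norm_bounded_eventually_nat (g := fun j => (1 / 2 : ℝ) ^ j)
      (summable_geometric_of_lt_one (by norm_num) (by norm_num)) ?_
    filter_upwards [hz.eventually (gt_mem_nhds (zero_lt_one))] with j hj
    rw [ENNReal.ofReal_lt_one] at hj
    rw [Real.norm_of_nonneg dist_nonneg, dist_comm, Real.dist_eq]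
    by_contra hcon
    push Not at hcon
    have e : ((2 : ℝ) ^ (m + 1)) ^ j * |V (j + 1) z - V j z| ^ (m + 1) =
        (2 ^ j * |V (j + 1) z - V j z|) ^ (m + 1) := by
      rw [Real.mul_rpow (by positivity) (abs_nonneg _), ← Real.rpow_natCast, ← Real.rpow_natCast,
        ← Real.rpow_mul (by norm_num), ← Real.rpow_mul (by norm_num), mul_comm (m + 1)]
    rw [e] at hj
    have h1 : 1 ≤ 2 ^ j * |V (j + 1) z - V j z| := by
      have := mul_le_mul_of_nonneg_left hcon.le (show (0 : ℝ) ≤ 2 ^ j by positivity)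
      rwa [← mul_pow, show (2 : ℝ) * (1 / 2) = 1 by norm_num, one_pow] at this
    exact absurd (Real.one_le_rpow h1 (by linarith)) (not_le.2 hj)
  have hcv2 := Measure.ae_ae_of_ae_prod
    ((Measure.measurePreserving_swap (μ := volume.restrict (Set.Icc (0 : ℝ) T)) (ν := μ)).quasiMeasurePreserving.ae hcv)
  refine ⟨u, fun z => clamp n (Filter.limUnder Filter.atTop (fun j => V j z)), fun j => ⟨hu j, hu0 j, hb j⟩,
    (clamp_lip n).continuous.measurable.comp
    (StronglyMeasurable.limUnder fun k => (hVm k).stronglyMeasurable).measurable,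
    fun z => ⟨clamp_nonneg _ _, clamp_le D.hn.le _⟩, ?_⟩
  filter_upwards [hcv2, ae_restrict_mem measurableSet_Icc] with t h1 ht
  have h2 := ae_all_iff.2 fun j => hVu j t ht
  have h3 := ae_all_iff.2 fun j => hb j t ht
  filter_upwards [h1, h2, h3] with x k1 k2 k3
  have k4 := ((clamp_lip n).continuous.tendsto _).comp k1
  refine k4.congr fun j => ?_
  simp only [Function.comp_apply, Prod.swap_prod_mk]
  rw [k2 j, clamp_eq (k3 j).1 (k3 j).2]

end VWS

namespace VWS
variable {X : Type*} [MeasurableSpace X] {μ : Measure X}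
variable {m p : ℝ}

lemma exists_trunc (hp : 1 < p) (hm : 1 < m) (n : ℝ) (hn : 0 < n) : ∃ (Φ F : LF) (σ : ℝ), Dat m p n σ Φ F ∧
    ∀ s, F.f s = max 0 (min (clamp n s ^ p - 1 / n) (n * (n - s))) := by
  obtain ⟨Φ, hΦ⟩ := exists_pow n 0 m hn.le (by linarith) (Or.inr ⟨rfl, hm.le⟩)
  obtain ⟨P, hP⟩ := exists_pow n 0 p hn.le (by linarith) (Or.inr ⟨rfl, hp.le⟩)
  have hΦ' : ∀ s, Φ.f s = clamp n s ^ m := fun s => by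
    rw [hΦ, max_eq_left (clamp_nonneg _ _), Real.zero_rpow (by linarith), sub_zero]
  have hP' : ∀ s, P.f s = clamp n s ^ p := fun s => by
    rw [hP, max_eq_left (clamp_nonneg _ _), Real.zero_rpow (by linarith), sub_zero]
  have hc0 : clamp n 0 = 0 := clamp_eq le_rfl hn.le
  have l1 : LipschitzWith P.K (fun s => P.f s - 1 / n) := by
    simpa using P.lip.sub (LipschitzWith.const (1 / n))
  have l2 : LipschitzWith (Real.toNNReal n) (fun s => n * (n - s)) :=
    LipschitzWith.of_dist_le_mul fun x y => by
      rw [Real.dist_eq, Real.dist_eq, Real.coe_toNNReal _ hn.le,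
        show n * (n - x) - n * (n - y) = n * (y - x) by ring, abs_mul, abs_of_pos hn, abs_sub_comm]
  let F : LF := ⟨fun s => max 0 (min (P.f s - 1 / n) (n * (n - s))), _, (l1.min l2).const_max 0, by
    rw [hP', hc0, Real.zero_rpow (by linarith)]
    refine max_eq_left ((min_le_left _ _).trans ?_)
    have : 0 < 1 / n := by positivity
    linarith⟩
  have hF : ∀ s, F.f s = max 0 (min (clamp n s ^ p - 1 / n) (n * (n - s))) := fun s => by
    rw [← hP']
  have hs0 : 0 ≤ n ^ (-(1 / p)) := by positivity
  refine ⟨Φ, F, n ^ (-(1 / p)), ⟨hn, hm, by positivity, hΦ', ?_, ?_, ?_, ?_⟩, hF⟩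
  · intro s hs
    rw [hF]
    refine max_eq_left ((min_le_left _ _).trans ?_)
    have h1 : clamp n s ≤ n ^ (-(1 / p)) := max_le ((min_le_left _ _).trans hs) hs0
    have h2 := Real.rpow_le_rpow (clamp_nonneg n s) h1 (show 0 ≤ p by linarith)
    rw [← Real.rpow_mul hn.le, show -(1 / p) * p = -1 by field_simp, Real.rpow_neg_one] at h2
    rw [one_div]; linarith
  · intro s hs
    rw [hF]
    refine max_eq_left ((min_le_right _ _).trans ?_)
    nlinarith
  · intro s
    rw [hF]; exact le_max_left _ _
  · intro s hs
    rw [hF]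
    refine max_le (by positivity) ((min_le_left _ _).trans ?_)
    have h1 : clamp n s ≤ s := max_le (min_le_left _ _) hs
    have h2 := Real.rpow_le_rpow (clamp_nonneg n s) h1 (show 0 ≤ p by linarith)
    have : 0 < 1 / n := by positivity
    linarith

lemma trunc_mono {n n' s : ℝ} (hn : 0 < n) (hnn : n ≤ n') (hs : 0 ≤ s) (hsn : s ≤ n) :
    max 0 (min (clamp n s ^ p - 1 / n) (n * (n - s))) ≤
    max 0 (min (clamp n' s ^ p - 1 / n') (n' * (n' - s))) := by
  rw [clamp_eq hs hsn, clamp_eq hs (hsn.trans hnn)]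
  refine max_le_max le_rfl (min_le_min ?_ ?_)
  · have := one_div_le_one_div_of_le hn hnn
    linarith
  · nlinarith

lemma trunc_tendsto (hp : 1 < p) {a : ℕ → ℝ} {A : ℝ} (h0 : ∀ k, 0 ≤ a k) (h1 : ∀ k, a k ≤ (k : ℝ) + 1)
    (hc : Filter.Tendsto a Filter.atTop (nhds A)) :
    Filter.Tendsto (fun k : ℕ => max 0 (min (clamp ((k : ℝ) + 1) (a k) ^ p - 1 / ((k : ℝ) + 1))
      (((k : ℝ) + 1) * (((k : ℝ) + 1) - a k)))) Filter.atTop (nhds (A ^ p)) := by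
  have hA : 0 ≤ A := ge_of_tendsto' hc h0
  have e1 : Filter.Tendsto (fun k : ℕ => a k ^ p - 1 / ((k : ℝ) + 1)) Filter.atTop (nhds (A ^ p)) := by
    have := (hc.rpow_const (p := p) (Or.inr (by linarith))).sub tendsto_one_div_add_atTop_nhds_zero_nat
    simpa using this
  have e2 : Filter.Tendsto (fun k : ℕ => ((k : ℝ) + 1)) Filter.atTop Filter.atTop :=
    Filter.tendsto_atTop_add_const_right _ _ tendsto_natCast_atTop_atTop
  have e3 := (tendsto_const_nhds (x := (0 : ℝ)) (f := Filter.atTop)).max e1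
  rw [max_eq_right (by positivity)] at e3
  refine e3.congr' ?_
  filter_upwards [e2.eventually_ge_atTop (A + 2 + A ^ p), hc.eventually (gt_mem_nhds (show A < A + 1 by linarith)),
    e1.eventually (gt_mem_nhds (show A ^ p < A ^ p + 1 by linarith))] with k k1 k2 k3
  rw [clamp_eq (h0 k) (h1 k), min_eq_left]
  have : 0 ≤ A ^ p := by positivity
  nlinarith

lemma one_term {a : ℕ → X → ℝ} {A ψ w : X → ℝ} {S : Set X} {L c : ℝ}
    (ha : ∀ k, AEStronglyMeasurable (a k) μ) (hψ : AEStronglyMeasurable ψ μ) (hw : Integrable w μ)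
    (hS : MeasurableSet S) (hSf : μ S ≠ ⊤) (hL : 0 ≤ L) (hw0 : ∀ x, 0 ≤ w x)
    (hψb : ∀ᵐ x ∂μ, |ψ x| ≤ S.indicator (fun _ => L) x) (hab : ∀ k, ∀ᵐ x ∂μ, |a k x| ≤ c + w x)
    (hc : ∀ᵐ x ∂μ, Filter.Tendsto (fun k => a k x) Filter.atTop (nhds (A x))) :
    Filter.Tendsto (fun k => ∫ x, a k x * ψ x ∂μ) Filter.atTop (nhds (∫ x, A x * ψ x ∂μ)) ∧
    ∀ k, |∫ x, a k x * ψ x ∂μ| ≤ L * (c * μ.real S + ∫ x, w x ∂μ) := by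
  have hi : Integrable (fun x => S.indicator (fun _ => c) x) μ :=
    (integrable_indicator_iff hS).2 (integrableOn_const hSf)
  have hd : Integrable (fun x => L * (S.indicator (fun _ => c) x + w x)) μ := (hi.add hw).const_mul L
  have hb : ∀ k, ∀ᵐ x ∂μ, ‖a k x * ψ x‖ ≤ L * (S.indicator (fun _ => c) x + w x) := fun k => by
    filter_upwards [hψb, hab k] with x h1 h2
    rw [norm_mul, Real.norm_eq_abs, Real.norm_eq_abs]
    by_cases hx : x ∈ S
    · rw [Set.indicator_of_mem hx] at h1 ⊢
      have := mul_le_mul h2 h1 (abs_nonneg _) ((abs_nonneg _).trans h2)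
      linarith
    · rw [Set.indicator_of_notMem hx] at h1 ⊢
      have h3 : |ψ x| = 0 := le_antisymm h1 (abs_nonneg _)
      rw [h3, mul_zero, zero_add]
      exact mul_nonneg hL (hw0 x)
  refine ⟨tendsto_integral_of_dominated_convergence _ (fun k => (ha k).mul hψ) hd hb ?_, fun k => ?_⟩
  · filter_upwards [hc] with x hx
    exact hx.mul_const _
  · rw [← Real.norm_eq_abs]
    refine (norm_integral_le_of_norm_le hd (hb k)).trans (le_of_eq ?_)
    rw [integral_const_mul, integral_add hi hw, integral_indicator hS]
    simp [mul_comm]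

lemma two_term {τ : Measure ℝ} [IsFiniteMeasure τ] {k : ℕ → ℝ → ℝ} {K : ℝ → ℝ} {R : ℝ}
    (hk : ∀ j, AEStronglyMeasurable (k j) τ)
    (hb : ∀ᵐ t ∂τ, Filter.Tendsto (fun j => k j t) Filter.atTop (nhds (K t)) ∧ ∀ j, |k j t| ≤ R) :
    Filter.Tendsto (fun j => ∫ t, k j t ∂τ) Filter.atTop (nhds (∫ t, K t ∂τ)) ∧
    AEStronglyMeasurable K τ ∧ Integrable K τ ∧ ∀ j, Integrable (k j) τ := by
  have hm : AEStronglyMeasurable K τ := aestronglyMeasurable_of_tendsto_ae Filter.atTop hk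
    (hb.mono fun t h => h.1)
  refine ⟨tendsto_integral_of_dominated_convergence (fun _ => R) hk (integrable_const _)
    (fun j => hb.mono fun t h => h.2 j) (hb.mono fun t h => h.1), hm, ?_, fun j => ?_⟩
  · refine (integrable_const R).mono' hm (hb.mono fun t h => ?_)
    exact le_of_tendsto' h.1.norm fun j => h.2 j
  · exact (integrable_const R).mono' (hk j) (hb.mono fun t h => h.2 j)

end VWS

namespace VWS
variable {X : Type*} [MeasurableSpace X] {μ : Measure X}
variable {H : Type*} [NormedAddCommGroup H] [InnerProductSpace ℝ H] [CompleteSpace H]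
variable {ι : H →L[ℝ] Lp ℝ 2 μ}
variable {m p n σ T : ℝ} {Φ F : LF}

/-- admissible test functions -/
structure Test (ι : H →L[ℝ] Lp ℝ 2 μ) (T : ℝ) (S : Set X) (L : ℝ) (φ φ' ζ : ℝ → Lp ℝ 2 μ) : Prop where
  der : ∀ t, HasDerivAt φ (φ' t) t
  c1 : Continuous φ'
  c2 : Continuous ζ
  eq : ∀ t, ι (ι.adjoint (ζ t)) = φ t
  fin : φ T = 0
  hS : MeasurableSet S
  hSf : μ S ≠ ⊤
  hL : 0 ≤ L
  b0 : ∀ t, ∀ᵐ x ∂μ, |φ t x| ≤ S.indicator (fun _ => L) x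
  b1 : ∀ t, ∀ᵐ x ∂μ, |φ' t x| ≤ S.indicator (fun _ => L) x
  b2 : ∀ t, ∀ᵐ x ∂μ, |ζ t x| ≤ S.indicator (fun _ => L) x

lemma level_term (u : ℕ → ℝ → Lp ℝ 2 μ) (U : X × ℝ → ℝ) (hn : 0 ≤ n)
    (hu : ∀ j, Continuous (u j)) (hub : ∀ j, ∀ t ∈ Set.Icc 0 T, ∀ᵐ x ∂μ, 0 ≤ u j t x ∧ u j t x ≤ n)
    (hc : ∀ᵐ t ∂(volume.restrict (Set.Icc 0 T)), ∀ᵐ x ∂μ,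
        Filter.Tendsto (fun j => u j t x) Filter.atTop (nhds (U (x, t))))
    (g : LF) (ψ : ℝ → Lp ℝ 2 μ) (hψ : Continuous ψ) {S : Set X} {L : ℝ}
    (hS : MeasurableSet S) (hSf : μ S ≠ ⊤) (hL : 0 ≤ L)
    (hψb : ∀ t, ∀ᵐ x ∂μ, |ψ t x| ≤ S.indicator (fun _ => L) x) :
    Filter.Tendsto (fun j => ∫ t in Set.Icc 0 T, inner ℝ (g.app (u j t)) (ψ t)) Filter.atTop
      (nhds (∫ t in Set.Icc 0 T, ∫ x, g.f (U (x, t)) * ψ t x ∂μ)) ∧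
    AEStronglyMeasurable (fun t => ∫ x, g.f (U (x, t)) * ψ t x ∂μ) (volume.restrict (Set.Icc 0 T)) ∧
    Integrable (fun t => ∫ x, g.f (U (x, t)) * ψ t x ∂μ) (volume.restrict (Set.Icc 0 T)) ∧
    ∀ j, Integrable (fun t => inner ℝ (g.app (u j t)) (ψ t)) (volume.restrict (Set.Icc 0 T)) := by
  have hg := g.app_cont (μ := μ)
  refine two_term (R := L * (g.K * n * μ.real S + ∫ x, (0 : ℝ) ∂μ)) (fun j => ?_) ?_
  · have := hu j
    have : Continuous (fun t => (inner ℝ (g.app (u j t)) (ψ t) : ℝ)) := by fun_prop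
    exact this.aestronglyMeasurable
  · filter_upwards [hc, ae_restrict_mem measurableSet_Icc] with t h1 ht
    have h2 := ae_all_iff.2 fun j => g.coe_app (u j t)
    simp_rw [inner_eq]
    refine one_term (w := fun _ => 0) (fun j => (Lp.stronglyMeasurable _).aestronglyMeasurable)
      (Lp.stronglyMeasurable _).aestronglyMeasurable (integrable_zero _ _ _) hS hSf hL (fun _ => le_rfl)
      (hψb t) (fun j => ?_) ?_
    · filter_upwards [g.coe_app (u j t), hub j t ht] with x k1 k2
      rw [k1, add_zero]
      refine (g.abs_le _).trans ?_
      rw [abs_of_nonneg k2.1]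
      exact mul_le_mul_of_nonneg_left k2.2 g.K.2
    · filter_upwards [h1, h2] with x k1 k2
      simp_rw [k2]
      exact (g.cont.tendsto _).comp k1

lemma Test.norm_le {S : Set X} {L : ℝ} {φ φ' ζ : ℝ → Lp ℝ 2 μ} (ht : Test ι T S L φ φ' ζ) :
    ∃ Z, ∀ t, ‖ζ t‖ ≤ Z := by
  refine ⟨Real.sqrt (L ^ 2 * μ.real S), fun t => Real.le_sqrt_of_sq_le ?_⟩
  have hi : Integrable (fun x => S.indicator (fun _ => L ^ 2) x) μ :=
    (integrable_indicator_iff ht.hS).2 (integrableOn_const ht.hSf)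
  have h1 : ‖ζ t‖ ^ 2 ≤ ∫ x, S.indicator (fun _ => L ^ 2) x ∂μ := by
    rw [← real_inner_self_eq_norm_sq, inner_eq]
    refine integral_mono_ae (integrable_mul _ _) hi ?_
    filter_upwards [ht.b2 t] with x hx
    by_cases hxS : x ∈ S
    · rw [Set.indicator_of_mem hxS] at hx ⊢
      have := sq_le_sq' (by linarith [neg_abs_le (ζ t x), abs_nonneg (ζ t x)]) ((le_abs_self _).trans hx)
      show ζ t x * ζ t x ≤ L ^ 2
      nlinarith
    · rw [Set.indicator_of_notMem hxS] at hx ⊢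
      have := abs_eq_zero.1 (le_antisymm hx (abs_nonneg _))
      show ζ t x * ζ t x ≤ 0
      rw [this, mul_zero]
  refine h1.trans (le_of_eq ?_)
  rw [integral_indicator ht.hS]
  simp [mul_comm]

lemma Dat.level_weak (D : Dat m p n σ Φ F) (hT : 0 ≤ T) (hnc : NC ι) (x0 : Lp ℝ 2 μ)
    (l : ℕ → ℝ) (B : ℕ → Lp ℝ 2 μ →L[ℝ] Lp ℝ 2 μ)
    (hB : ∀ j, Res ι (l j) (B j)) (hl1 : ∀ j, l j ≤ 1)
    (hl : Filter.Tendsto (fun j => Real.sqrt (l j)) Filter.atTop (nhds 0))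
    (u : ℕ → ℝ → Lp ℝ 2 μ) (U : X × ℝ → ℝ)
    (hu : ∀ j, Sol (B j) Φ F T (u j) ∧ u j 0 = x0 ∧ ∀ t ∈ Set.Icc 0 T, ∀ᵐ x ∂μ, 0 ≤ u j t x ∧ u j t x ≤ n)
    (hc : ∀ᵐ t ∂(volume.restrict (Set.Icc 0 T)), ∀ᵐ x ∂μ,
        Filter.Tendsto (fun j => u j t x) Filter.atTop (nhds (U (x, t))))
    {S : Set X} {L : ℝ} {φ φ' ζ : ℝ → Lp ℝ 2 μ} (ht : Test ι T S L φ φ' ζ) :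
    AEStronglyMeasurable (fun t => ∫ x, U (x, t) * φ' t x ∂μ) (volume.restrict (Set.Icc 0 T)) ∧
    AEStronglyMeasurable (fun t => ∫ x, Φ.f (U (x, t)) * ζ t x ∂μ) (volume.restrict (Set.Icc 0 T)) ∧
    AEStronglyMeasurable (fun t => ∫ x, F.f (U (x, t)) * φ t x ∂μ) (volume.restrict (Set.Icc 0 T)) ∧
    (∫ t in Set.Icc 0 T, ∫ x, U (x, t) * φ' t x ∂μ) - (∫ t in Set.Icc 0 T, ∫ x, Φ.f (U (x, t)) * ζ t x ∂μ)
      + (∫ t in Set.Icc 0 T, ∫ x, F.f (U (x, t)) * φ t x ∂μ) = - ∫ x, x0 x * φ 0 x ∂μ := by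
  obtain ⟨Z, hZ⟩ := ht.norm_le
  have hφc : Continuous φ := continuous_iff_continuousAt.2 fun t => (ht.der t).continuousAt
  obtain ⟨a1, a2, a3, a4⟩ := level_term u U D.hn.le (fun j => (hu j).1.cont) (fun j => (hu j).2.2) hc idL φ' ht.c1 ht.hS ht.hSf ht.hL ht.b1
  obtain ⟨b1, b2, b3, b4⟩ := level_term u U D.hn.le (fun j => (hu j).1.cont) (fun j => (hu j).2.2) hc Φ ζ ht.c2 ht.hS ht.hSf ht.hL ht.b2
  obtain ⟨c1, c2, c3, c4⟩ := level_term u U D.hn.le (fun j => (hu j).1.cont) (fun j => (hu j).2.2) hc F φ hφc ht.hS ht.hSf ht.hL ht.b0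
  simp only [idL_app] at a1 a4
  refine ⟨a2, b2, c2, ?_⟩
  have hw : ∀ j, |(∫ t in Set.Icc 0 T, inner ℝ (u j t) (φ' t)) - (∫ t in Set.Icc 0 T, inner ℝ (Φ.app (u j t)) (ζ t))
      + (∫ t in Set.Icc 0 T, inner ℝ (F.app (u j t)) (φ t)) + ∫ x, x0 x * φ 0 x ∂μ| ≤
      Real.sqrt (l j) * (Z * (remC ι F T x0 * T + ∫ x, Φ.prim (x0 x) ∂μ)) := fun j => by
    have := (hu j).1.weak D (hB j) hnc (hl1 j) hT (hu j).2.2 φ φ' ζ ht.der ht.c1 ht.c2 ht.eq Z hZ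
    rw [ht.fin, inner_zero_right, (hu j).2.1, intervalIntegral.integral_of_le hT, ← integral_Icc_eq_integral_Ioc,
      integral_add (f := fun t => (inner ℝ (u j t) (φ' t) - inner ℝ (Φ.app (u j t)) (ζ t) : ℝ)) ((a4 j).sub (b4 j)) (c4 j),
      integral_sub (a4 j) (b4 j), inner_eq] at this
    rw [← abs_neg]
    refine le_trans (le_of_eq ?_) this
    congr 1
    ring
  have h1 := (((a1.sub b1).add c1).add_const (∫ x, x0 x * φ 0 x ∂μ)).abs
  have h2 := hl.mul_const (Z * (remC ι F T x0 * T + ∫ x, Φ.prim (x0 x) ∂μ))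
  rw [zero_mul] at h2
  have h3 := le_of_tendsto_of_tendsto' h1 h2 hw
  have h4 := abs_eq_zero.1 (le_antisymm h3 (abs_nonneg _))
  simp only [idL] at h4
  linarith

end VWS

namespace VWS
variable {X : Type*} [MeasurableSpace X] {μ : Measure X}
variable {H : Type*} [NormedAddCommGroup H] [InnerProductSpace ℝ H] [CompleteSpace H]

lemma fatou_rpow {a : ℕ → X → ℝ} {A : X → ℝ} {r : ℝ} {R : ENNReal} (hr : 0 < r) (ha : ∀ k, AEMeasurable (a k) μ)
    (hc : ∀ᵐ x ∂μ, Filter.Tendsto (fun k => a k x) Filter.atTop (nhds (A x)))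
    (hR : ∀ k, ∫⁻ x, ENNReal.ofReal (a k x ^ r) ∂μ ≤ R) : ∫⁻ x, ENNReal.ofReal (A x ^ r) ∂μ ≤ R := by
  calc ∫⁻ x, ENNReal.ofReal (A x ^ r) ∂μ
      = ∫⁻ x, Filter.liminf (fun k => ENNReal.ofReal (a k x ^ r)) Filter.atTop ∂μ := by
        refine lintegral_congr_ae ?_
        filter_upwards [hc] with x hx
        exact ((ENNReal.continuous_ofReal.tendsto _).comp (hx.rpow_const (Or.inr hr.le))).liminf_eq.symm
    _ ≤ Filter.liminf (fun k => ∫⁻ x, ENNReal.ofReal (a k x ^ r) ∂μ) Filter.atTop :=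
        lintegral_liminf_le' fun k => ((ha k).pow_const r).ennreal_ofReal
    _ ≤ Filter.liminf (fun _ : ℕ => R) Filter.atTop := Filter.liminf_le_liminf (Filter.Eventually.of_forall hR)
    _ = R := Filter.liminf_const R

lemma sup_rpow {a : ℕ → X → ℝ} {r : ℝ} {R : ENNReal} (hr : 0 < r) (ha : ∀ k, Measurable (a k))
    (h0 : ∀ k x, 0 ≤ a k x) (hmono : ∀ᵐ x ∂μ, Monotone (fun k => a k x)) (hRt : R ≠ ⊤)
    (hR : ∀ k, ∫⁻ x, ENNReal.ofReal (a k x ^ r) ∂μ ≤ R) :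
    ∀ᵐ x ∂μ, Filter.Tendsto (fun k => a k x) Filter.atTop (nhds ((⨆ k, ENNReal.ofReal (a k x)).toReal)) ∧
      ∀ k, a k x ≤ (⨆ k, ENNReal.ofReal (a k x)).toReal := by
  have ht : ∀ᵐ x ∂μ, Filter.Tendsto (fun k => ENNReal.ofReal (a k x)) Filter.atTop (nhds (⨆ k, ENNReal.ofReal (a k x))) := by
    filter_upwards [hmono] with x hx
    exact tendsto_atTop_iSup fun i j h => ENNReal.ofReal_le_ofReal (hx h)
  have hV : ∫⁻ x, (⨆ k, ENNReal.ofReal (a k x)) ^ r ∂μ ≤ R := by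
    calc ∫⁻ x, (⨆ k, ENNReal.ofReal (a k x)) ^ r ∂μ
        = ∫⁻ x, Filter.liminf (fun k => ENNReal.ofReal (a k x ^ r)) Filter.atTop ∂μ := by
          refine lintegral_congr_ae ?_
          filter_upwards [ht] with x hx
          have := ((ENNReal.continuous_rpow_const (y := r)).tendsto _).comp hx
          refine (Filter.Tendsto.liminf_eq (this.congr fun k => ?_)).symm
          simp only [Function.comp_apply]
          rw [ENNReal.ofReal_rpow_of_nonneg (h0 k x) hr.le]
      _ ≤ Filter.liminf (fun k => ∫⁻ x, ENNReal.ofReal (a k x ^ r) ∂μ) Filter.atTop :=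
          lintegral_liminf_le fun k => ((ha k).pow_const r).ennreal_ofReal
      _ ≤ Filter.liminf (fun _ : ℕ => R) Filter.atTop := Filter.liminf_le_liminf (Filter.Eventually.of_forall hR)
      _ = R := Filter.liminf_const R
  have hVm : Measurable fun x => (⨆ k, ENNReal.ofReal (a k x)) ^ r :=
    (Measurable.iSup fun k => (ha k).ennreal_ofReal).pow_const r
  have hfin := ae_lt_top hVm (ne_top_of_le_ne_top hRt hV)
  filter_upwards [ht, hfin, hmono] with x h1 h2 h3
  have h4 : (⨆ k, ENNReal.ofReal (a k x)) ≠ ⊤ := fun h => by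
    rw [h, ENNReal.top_rpow_of_pos hr] at h2
    exact lt_irrefl _ h2
  have h5 : Filter.Tendsto (fun k => a k x) Filter.atTop (nhds ((⨆ k, ENNReal.ofReal (a k x)).toReal)) := by
    refine ((ENNReal.tendsto_toReal h4).comp h1).congr fun k => ?_
    simp [ENNReal.toReal_ofReal (h0 k x)]
  exact ⟨h5, fun k => h3.ge_of_tendsto h5 k⟩

variable {m p q : ℝ}

set_option maxHeartbeats 1000000 in
theorem abstract_main [SigmaFinite μ] (ι : H →L[ℝ] Lp ℝ 2 μ) (hnc : NC ι) (hp : 1 < p) (hpm : p < m)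
    (hq : 1 < q) : ∃ C : ℝ, 0 < C ∧ ∀ (u0 : X → ℝ), Measurable u0 → (∀ x, 0 ≤ u0 x) →
      ∫⁻ x, ENNReal.ofReal (u0 x ^ m) ∂μ ≠ ⊤ → ∀ T : ℝ, 0 < T → ∃ U : X × ℝ → ℝ,
      (∀ z, 0 ≤ U z) ∧ Measurable U ∧
      (∀ t > 0, ∫⁻ x, ENNReal.ofReal (U (x, t) ^ q) ∂μ ≤
        ENNReal.ofReal (Real.exp (C * t)) * ∫⁻ x, ENNReal.ofReal (u0 x ^ q) ∂μ) ∧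
      (∃ R : ENNReal, R ≠ ⊤ ∧ ∀ t, ∫⁻ x, ENNReal.ofReal (U (x, t) ^ m) ∂μ ≤ R) ∧
      ∀ (S : Set X) (L : ℝ) (φ φ' ζ : ℝ → Lp ℝ 2 μ), Test ι T S L φ φ' ζ →
        (∫ t in Set.Icc 0 T, ∫ x, U (x, t) * φ' t x ∂μ) - (∫ t in Set.Icc 0 T, ∫ x, U (x, t) ^ m * ζ t x ∂μ)
        + (∫ t in Set.Icc 0 T, ∫ x, U (x, t) ^ p * φ t x ∂μ) = - ∫ x, u0 x * φ 0 x ∂μ := by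
  have hm : 1 < m := hp.trans hpm
  have hm0 : 0 < m := by linarith
  have hk : 0 < ‖ι‖ ^ 2 + 2 := by positivity
  obtain ⟨C, hC, hLq⟩ := Lr_estimate (μ := μ) (H := H) hp hpm hq hk
  obtain ⟨C', hC', hLm⟩ := Lr_estimate (μ := μ) (H := H) hp hpm hm hk
  refine ⟨C, hC, fun u0 hu0m hu0 hu0i T hT => ?_⟩
  -- regularisation parameters
  set r := (2 : ℝ) ^ (-(m + 2)) with hr
  have r0 : 0 < r := by positivity
  have r1 : r < 1 := Real.rpow_lt_one_of_one_lt_of_neg (by norm_num) (by linarith)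
  set l : ℕ → ℝ := fun j => (r ^ j) ^ 2 with hl
  have hl0 : ∀ j, 0 < l j := fun j => by simp only [hl]; positivity
  have hl1 : ∀ j, l j ≤ 1 := fun j => pow_le_one₀ (by positivity) (pow_le_one₀ r0.le r1.le)
  have hsq : ∀ j, Real.sqrt (l j) = r ^ j := fun j => Real.sqrt_sq (by positivity)
  have hlt : Filter.Tendsto (fun j => Real.sqrt (l j)) Filter.atTop (nhds 0) := by
    simp_rw [hsq]; exact tendsto_pow_atTop_nhds_zero_of_lt_one r0.le r1
  choose B hB using fun j => exists_res ι (l j) (hl0 j)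
  -- truncations
  have hn0 : ∀ k : ℕ, (0 : ℝ) < (k : ℝ) + 1 := fun k => by positivity
  choose Φ F σ D hF using fun k : ℕ => exists_trunc hp hm ((k : ℝ) + 1) (hn0 k)
  set z : ℕ → X → ℝ := fun k => (spanningSets μ k).indicator (fun x => min (u0 x) ((k : ℝ) + 1)) with hz
  have hz0 : ∀ k x, 0 ≤ z k x := fun k x => Set.indicator_nonneg (fun x _ => le_min (hu0 x) (hn0 k).le) x
  have hzn : ∀ k x, z k x ≤ (k : ℝ) + 1 := fun k x =>
    Set.indicator_apply_le' (fun _ => min_le_right _ _) (fun _ => (hn0 k).le)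
  have hzu : ∀ k x, z k x ≤ u0 x := fun k x =>
    Set.indicator_apply_le' (fun _ => min_le_left _ _) (fun _ => hu0 x)
  have hzm : ∀ k, Measurable (z k) := fun k =>
    (hu0m.min measurable_const).indicator (measurableSet_spanningSets μ k)
  have hzmono : ∀ k x, z k x ≤ z (k + 1) x := fun k x => by
    simp only [hz]
    by_cases hx : x ∈ spanningSets μ k
    · rw [Set.indicator_of_mem hx, Set.indicator_of_mem (monotone_spanningSets μ (Nat.le_succ k) hx)]
      exact min_le_min le_rfl (by push_cast; linarith)
    · rw [Set.indicator_of_notMem hx]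
      exact hz0 (k + 1) x
  have hzlp : ∀ k, MemLp (z k) 2 μ := fun k => by
    refine (memLp_indicator_const 2 (measurableSet_spanningSets μ k) ((k : ℝ) + 1)
      (Or.inr (measure_spanningSets_lt_top μ k).ne)).mono (hzm k).aestronglyMeasurable
      (Filter.Eventually.of_forall fun x => ?_)
    rw [Real.norm_of_nonneg (hz0 k x)]
    refine le_trans ?_ (le_abs_self _)
    exact Set.indicator_le_indicator (min_le_right _ _)
  set x0 : ℕ → Lp ℝ 2 μ := fun k => (hzlp k).toLp (z k) with hx0
  have hx0c : ∀ k, ∀ᵐ x ∂μ, x0 k x = z k x := fun k => (hzlp k).coeFn_toLp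
  have hx0b : ∀ k, ∀ᵐ x ∂μ, 0 ≤ x0 k x ∧ x0 k x ≤ (k : ℝ) + 1 := fun k => by
    filter_upwards [hx0c k] with x hx
    rw [hx]; exact ⟨hz0 k x, hzn k x⟩
  choose u U hu hUm hUb hUc using fun k => (D k).level hT.le hnc (x0 k) (hx0b k) l B hB hl1
    (fun j => (hsq j).le)
  set τ := volume.restrict (Set.Icc (0 : ℝ) T) with hτ
  -- order
  have hord : ∀ᵐ t ∂τ, ∀ k, ∀ᵐ x ∂μ, U k (x, t) ≤ U (k + 1) (x, t) := by
    have h1 := ae_all_iff.2 hUc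
    filter_upwards [h1, ae_restrict_mem measurableSet_Icc] with t h1 ht k
    have h2 : ∀ j, ∀ᵐ x ∂μ, u k j t x ≤ u (k + 1) j t x := fun j => by
      refine (hu k j).1.compare (hu (k + 1) j).1 (hB j) hnc (D (k + 1)).mono (fun s hs hsn => ?_)
        (fun s hs hsn => ?_) (hu k j).2.2 ?_ t ht
      · rw [(D k).Φeq, (D (k + 1)).Φeq, clamp_eq hs hsn, clamp_eq hs (hsn.trans (by push_cast; linarith))]
      · rw [hF, hF]
        exact trunc_mono (hn0 k) (by push_cast; linarith) hs hsn
      · rw [(hu k j).2.1, (hu (k + 1) j).2.1]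
        filter_upwards [hx0c k, hx0c (k + 1)] with x e1 e2
        rw [e1, e2]; exact hzmono k x
    filter_upwards [ae_all_iff.2 h2, h1 k, h1 (k + 1)] with x e1 e2 e3
    exact le_of_tendsto_of_tendsto' e2 e3 e1
  have hest : ∀ (s c : ℝ), 0 < s → (∀ k j, ∀ t ∈ Set.Icc 0 T, ∫⁻ x, ENNReal.ofReal (u k j t x ^ s) ∂μ ≤
        ENNReal.ofReal (Real.exp (c * t)) * ∫⁻ x, ENNReal.ofReal (u k j 0 x ^ s) ∂μ) →
      ∀ᵐ t ∂τ, ∀ k, ∫⁻ x, ENNReal.ofReal (U k (x, t) ^ s) ∂μ ≤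
        ENNReal.ofReal (Real.exp (c * t)) * ∫⁻ x, ENNReal.ofReal (u0 x ^ s) ∂μ := by
    intro s c hs hyp
    have h1 := ae_all_iff.2 hUc
    filter_upwards [h1, ae_restrict_mem measurableSet_Icc] with t h1 ht k
    refine fatou_rpow hs (fun j => (Lp.stronglyMeasurable _).measurable.aemeasurable) (h1 k) (fun j => ?_)
    refine (hyp k j t ht).trans (mul_le_mul_right ?_ _)
    rw [(hu k j).2.1]
    refine lintegral_mono_ae ?_
    filter_upwards [hx0c k] with x e1
    rw [e1]
    exact ENNReal.ofReal_le_ofReal (Real.rpow_le_rpow (hz0 k x) (hzu k x) hs.le)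
  have hestq := hest q C (by linarith) fun k j t ht => hLq ι (l j) _ _ T (B j) _ _ _ hnc (hB j)
    (by linarith [hl1 j]) (D k) (hu k j).1 (hu k j).2.2 t ht
  have hestm := hest m C' hm0 fun k j t ht => hLm ι (l j) _ _ T (B j) _ _ _ hnc (hB j)
    (by linarith [hl1 j]) (D k) (hu k j).1 (hu k j).2.2 t ht
  set P : ℝ → Prop := fun t => (∀ k, ∀ᵐ x ∂μ, U k (x, t) ≤ U (k + 1) (x, t)) ∧
    (∀ k, ∫⁻ x, ENNReal.ofReal (U k (x, t) ^ q) ∂μ ≤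
        ENNReal.ofReal (Real.exp (C * t)) * ∫⁻ x, ENNReal.ofReal (u0 x ^ q) ∂μ) ∧
    (∀ k, ∫⁻ x, ENNReal.ofReal (U k (x, t) ^ m) ∂μ ≤
        ENNReal.ofReal (Real.exp (C' * t)) * ∫⁻ x, ENNReal.ofReal (u0 x ^ m) ∂μ) with hP
  have hPae : ∀ᵐ t ∂τ, P t := by
    filter_upwards [hord, hestq, hestm] with t e1 e2 e3 using ⟨e1, e2, e3⟩
  set N := toMeasurable τ {t | ¬ P t} with hN
  have hN0 : τ N = 0 := by rw [hN, measure_toMeasurable]; exact hPae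
  set G := Set.Icc 0 T \ N with hG
  have hGm : MeasurableSet G := measurableSet_Icc.diff (measurableSet_toMeasurable _ _)
  have hGP : ∀ t ∈ G, P t := fun t ht => by
    by_contra hcon
    exact ht.2 (subset_toMeasurable _ _ hcon)
  have hGae : ∀ᵐ t ∂τ, t ∈ G := by
    have h1 : ∀ᵐ t ∂τ, t ∉ N := measure_eq_zero_iff_ae_notMem.1 hN0
    filter_upwards [h1, ae_restrict_mem measurableSet_Icc] with t e1 e2 using ⟨e2, e1⟩
  set W : X × ℝ → ℝ := fun y => (⨆ k, ENNReal.ofReal (U k y)).toReal with hW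
  have hWm : Measurable W := (Measurable.iSup fun k => (hUm k).ennreal_ofReal).ennreal_toReal
  set V : X × ℝ → ℝ := (Set.univ ×ˢ G).indicator W with hV
  have hVG : ∀ t ∈ G, ∀ x, V (x, t) = W (x, t) := fun t ht x =>
    Set.indicator_of_mem (Set.mk_mem_prod (Set.mem_univ _) ht) _
  have hVN : ∀ t ∉ G, ∀ x, V (x, t) = 0 := fun t ht x =>
    Set.indicator_of_notMem (fun h => ht h.2) _
  have hRt : ∀ t, ENNReal.ofReal (Real.exp (C' * t)) * ∫⁻ x, ENNReal.ofReal (u0 x ^ m) ∂μ ≠ ⊤ := fun t =>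
    ENNReal.mul_ne_top ENNReal.ofReal_ne_top hu0i
  have hconv : ∀ t ∈ G, ∀ᵐ x ∂μ, Filter.Tendsto (fun k => U k (x, t)) Filter.atTop (nhds (V (x, t))) ∧
      ∀ k, U k (x, t) ≤ V (x, t) := fun t ht => by
    have h1 := sup_rpow (μ := μ) (a := fun k x => U k (x, t)) hm0 (fun k => (hUm k).comp (measurable_id.prodMk measurable_const))
      (fun k x => (hUb k _).1) (by
        filter_upwards [ae_all_iff.2 (hGP t ht).1] with x hx
        exact monotone_nat_of_le_succ hx) (hRt t) (hGP t ht).2.2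
    simp_rw [hVG t ht]
    exact h1
  have hV0 : ∀ y, 0 ≤ V y := fun y => Set.indicator_nonneg (fun y _ => ENNReal.toReal_nonneg) y
  have hVm : Measurable V := hWm.indicator (MeasurableSet.univ.prod hGm)
  have hVmx : ∀ t, Measurable (fun x => V (x, t)) := fun t => hVm.comp (measurable_id.prodMk measurable_const)
  have hUmx : ∀ k t, Measurable (fun x => U k (x, t)) := fun k t => (hUm k).comp (measurable_id.prodMk measurable_const)
  have hVest : ∀ (s c : ℝ), 0 < s → (∀ t ∈ G, ∀ k, ∫⁻ x, ENNReal.ofReal (U k (x, t) ^ s) ∂μ ≤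
        ENNReal.ofReal (Real.exp (c * t)) * ∫⁻ x, ENNReal.ofReal (u0 x ^ s) ∂μ) → ∀ t, 
      ∫⁻ x, ENNReal.ofReal (V (x, t) ^ s) ∂μ ≤
        ENNReal.ofReal (Real.exp (c * t)) * ∫⁻ x, ENNReal.ofReal (u0 x ^ s) ∂μ := by
    intro s c hs hyp t
    by_cases ht : t ∈ G
    · exact fatou_rpow hs (fun k => (hUmx k t).aemeasurable) ((hconv t ht).mono fun x h => h.1) (hyp t ht)
    · simp_rw [hVN t ht, Real.zero_rpow hs.ne']
      simp
  set R := ENNReal.ofReal (Real.exp (C' * T)) * ∫⁻ x, ENNReal.ofReal (u0 x ^ m) ∂μ with hR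
  have hVR : ∀ t, ∫⁻ x, ENNReal.ofReal (V (x, t) ^ m) ∂μ ≤ R := fun t => by
    by_cases ht : t ∈ G
    · refine (hVest m C' hm0 (fun t ht => (hGP t ht).2.2) t).trans (mul_le_mul_left ?_ _)
      refine ENNReal.ofReal_le_ofReal (Real.exp_le_exp.2 ?_)
      exact mul_le_mul_of_nonneg_left ht.1.2 hC'.le
    · simp_rw [hVN t ht, Real.zero_rpow hm0.ne']
      simp
  refine ⟨V, hV0, hVm, fun t _ => hVest q C (by linarith) (fun t ht => (hGP t ht).2.1) t, ⟨R, hRt T, hVR⟩, ?_⟩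
  intro S L φ φ' ζ hte
  have hwk := fun k => (D k).level_weak hT.le hnc (x0 k) l B hB hl1 hlt (u k) (U k) (hu k) (hUc k) hte
  have hint : ∀ f : X → ℝ, Measurable f → (∀ x, 0 ≤ f x) → ∫⁻ x, ENNReal.ofReal (f x ^ m) ∂μ ≠ ⊤ →
      Integrable (fun x => f x ^ m) μ := fun f hf h0 hfin =>
    ⟨(hf.pow_const m).aestronglyMeasurable, by
      rw [hasFiniteIntegral_iff_ofReal (Filter.Eventually.of_forall fun x => Real.rpow_nonneg (h0 x) _)]
      exact hfin.lt_top⟩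
  have hVint : ∀ t, Integrable (fun x => V (x, t) ^ m) μ := fun t =>
    hint _ (hVmx t) (fun x => hV0 _) (ne_top_of_le_ne_top (hRt T) (hVR t))
  have hVIb : ∀ t, ∫ x, V (x, t) ^ m ∂μ ≤ R.toReal := fun t => by
    rw [integral_eq_lintegral_of_nonneg_ae (Filter.Eventually.of_forall fun x => Real.rpow_nonneg (hV0 _) _)
      (hVint t).1]
    exact ENNReal.toReal_mono (hRt T) (hVR t)
  have hpow : ∀ s a b : ℝ, 0 ≤ a → a ≤ b → 0 < s → s ≤ m → a ^ s ≤ 1 + b ^ m := by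
    intro s a b ha hab hs hsm
    have hb : 0 ≤ b := ha.trans hab
    rcases le_total a 1 with h | h
    · have h1 := Real.rpow_le_one ha h hs.le
      have h2 := Real.rpow_nonneg hb m
      linarith
    · have h1 := Real.rpow_le_rpow_of_exponent_le h hsm
      have h2 := Real.rpow_le_rpow ha hab hm0.le
      linarith
  -- passage to the limit in one term
  have term : ∀ (g : ℕ → ℝ → ℝ) (G' : ℝ → ℝ) (ψ : ℝ → Lp ℝ 2 μ), (∀ k, Measurable (g k)) →
      (∀ (k : ℕ) (s : ℝ), 0 ≤ s → s ≤ (k : ℝ) + 1 → ∀ b, s ≤ b → |g k s| ≤ 1 + b ^ m) →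
      (∀ (a : ℕ → ℝ) (A : ℝ), (∀ k, 0 ≤ a k) → (∀ k, a k ≤ (k : ℝ) + 1) → Filter.Tendsto a Filter.atTop (nhds A) →
        Filter.Tendsto (fun k => g k (a k)) Filter.atTop (nhds (G' A))) →
      (∀ t, ∀ᵐ x ∂μ, |ψ t x| ≤ S.indicator (fun _ => L) x) →
      (∀ k, AEStronglyMeasurable (fun t => ∫ x, g k (U k (x, t)) * ψ t x ∂μ) τ) →
      Filter.Tendsto (fun k => ∫ t, ∫ x, g k (U k (x, t)) * ψ t x ∂μ ∂τ) Filter.atTop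
        (nhds (∫ t, ∫ x, G' (V (x, t)) * ψ t x ∂μ ∂τ)) := by
    intro g G' ψ hgm hgb hgc hψ hgas
    refine (two_term (R := L * (1 * μ.real S + R.toReal)) hgas ?_).1
    filter_upwards [hGae] with t ht
    have h1 := one_term (a := fun k x => g k (U k (x, t))) (A := fun x => G' (V (x, t))) (w := fun x => V (x, t) ^ m) (c := 1)
      (fun k => ((hgm k).comp (hUmx k t)).aestronglyMeasurable)
      (Lp.stronglyMeasurable (ψ t)).aestronglyMeasurable (hVint t) hte.hS hte.hSf hte.hL
      (fun x => Real.rpow_nonneg (hV0 _) _) (hψ t) (fun k => by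
        filter_upwards [hconv t ht] with x hx
        exact hgb k _ (hUb k _).1 (hUb k _).2 _ (hx.2 k)) (by
        filter_upwards [hconv t ht] with x hx
        exact hgc _ _ (fun k => (hUb k _).1) (fun k => (hUb k _).2) hx.1)
    refine ⟨h1.1, fun k => (h1.2 k).trans ?_⟩
    have := hVIb t
    have := hte.hL
    gcongr
  have t1 := term (fun _ s => s) (fun s => s) φ' (fun _ => measurable_id) (fun k s hs _ b hb => by
      have := hpow 1 s b hs hb one_pos hm.le
      rwa [Real.rpow_one, ← abs_of_nonneg hs] at this) (fun a A _ _ h => h) hte.b1 (fun k => (hwk k).1)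
  have t2 := term (fun k => (Φ k).f) (fun s => s ^ m) ζ (fun k => (Φ k).cont.measurable) (fun k s hs hsn b hb => by
      rw [(D k).Φeq, clamp_eq hs hsn, abs_of_nonneg (Real.rpow_nonneg hs _)]
      exact hpow m s b hs hb hm0 le_rfl) (fun a A h0 h1 h => by
        simp_rw [(D _).Φeq]
        refine (h.rpow_const (Or.inr hm0.le)).congr fun k => ?_
        rw [clamp_eq (h0 k) (h1 k)]) hte.b2 (fun k => (hwk k).2.1)
  have t3 := term (fun k => (F k).f) (fun s => s ^ p) φ (fun k => (F k).cont.measurable) (fun k s hs hsn b hb => by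
      rw [abs_of_nonneg ((D k).Fnn s)]
      exact ((D k).Fle s hs).trans (hpow p s b hs hb (by linarith) hpm.le)) (fun a A h0 h1 h => by
        simp_rw [hF]
        exact trunc_tendsto hp h0 h1 h) hte.b0 (fun k => (hwk k).2.2.1)
  have t4 : Filter.Tendsto (fun k => ∫ x, x0 k x * φ 0 x ∂μ) Filter.atTop (nhds (∫ x, u0 x * φ 0 x ∂μ)) := by
    refine (one_term (w := fun x => u0 x ^ m) (c := 1) (fun k => (Lp.stronglyMeasurable (x0 k)).aestronglyMeasurable)
      (Lp.stronglyMeasurable (φ 0)).aestronglyMeasurable (hint u0 hu0m hu0 hu0i) hte.hS hte.hSf hte.hL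
      (fun x => Real.rpow_nonneg (hu0 _) _) (hte.b0 0) (fun k => ?_) ?_).1
    · filter_upwards [hx0c k] with x hx
      rw [hx, abs_of_nonneg (hz0 k x)]
      have := hpow 1 _ _ (hz0 k x) (hzu k x) one_pos hm.le
      rwa [Real.rpow_one] at this
    · filter_upwards [ae_all_iff.2 hx0c] with x hx
      simp_rw [hx]
      refine tendsto_const_nhds.congr' ?_
      obtain ⟨k0, hk0⟩ := exists_nat_ge (u0 x)
      obtain ⟨k1, hk1⟩ := Set.mem_iUnion.1 (by rw [iUnion_spanningSets μ]; exact Set.mem_univ x : x ∈ ⋃ i, spanningSets μ i)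
      filter_upwards [Filter.eventually_ge_atTop k0, Filter.eventually_ge_atTop k1] with k h1 h2
      simp only [hz]
      rw [Set.indicator_of_mem (monotone_spanningSets μ h2 hk1), min_eq_left]
      have : (k0 : ℝ) ≤ k := by exact_mod_cast h1
      linarith
  have t5 := (t1.sub t2).add t3
  exact tendsto_nhds_unique (t5.congr fun k => (hwk k).2.2.2) t4.neg

end VWS

namespace VWS

lemma refl_lip {X : Type*} [MeasurableSpace X] {μ : Measure X} (u v : Lp ℝ 2 μ) :
    ‖refl.app u - refl.app v‖ ≤ ‖u - v‖ := by
  have h5 := refl.app_lip.dist_le_mul u v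
  have hk : (refl.K : ℝ) = 1 := rfl
  rwa [hk, one_mul, dist_eq_norm, dist_eq_norm] at h5

lemma NC_of_dense {X : Type*} [MeasurableSpace X] {μ : Measure X}
    {H : Type*} [NormedAddCommGroup H] [InnerProductSpace ℝ H] [CompleteSpace H] {D : Type*}
    (e : D → H) (hd : DenseRange e) (ι : H →L[ℝ] Lp ℝ 2 μ)
    (hyp : ∀ v, ∀ ε > 0, ∃ w, ‖e w‖ ≤ ‖e v‖ ∧ ‖ι (e w) - refl.app (ι (e v))‖ ≤ ε) : NC ι := by
  intro h ε hε
  obtain ⟨δ, hδ, hδ1, hδ2⟩ : ∃ δ : ℝ, 0 < δ ∧ δ ≤ ε ∧ ‖ι‖ * δ ≤ ε / 2 := by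
    refine ⟨min ε (ε / 2 / (‖ι‖ + 1)), by positivity, min_le_left _ _, ?_⟩
    calc ‖ι‖ * min ε (ε / 2 / (‖ι‖ + 1)) ≤ (‖ι‖ + 1) * (ε / 2 / (‖ι‖ + 1)) := by
          gcongr
          · linarith
          · exact min_le_right _ _
      _ = ε / 2 := by field_simp
  obtain ⟨v, hv⟩ := Metric.denseRange_iff.1 hd h δ hδ
  rw [dist_eq_norm] at hv
  obtain ⟨w, hw1, hw2⟩ := hyp v (ε / 2) (by positivity)
  refine ⟨e w, ?_, ?_⟩
  · have := norm_sub_norm_le (e v) h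
    rw [norm_sub_rev] at this
    linarith
  · have h5 := refl_lip (ι (e v)) (ι h)
    have h7 : ‖e v - h‖ ≤ δ := by rw [norm_sub_rev]; exact hv.le
    rw [← map_sub] at h5
    have h2 := h5.trans ((ι.le_opNorm _).trans ((mul_le_mul_of_nonneg_left h7 (norm_nonneg _)).trans hδ2))
    calc _ = ‖(ι (e w) - refl.app (ι (e v))) + (refl.app (ι (e v)) - refl.app (ι h))‖ := by
          congr 1; abel
      _ ≤ _ := norm_add_le _ _
      _ ≤ ε := by linarith

section conc
variable {N : ℕ}

/-- smooth compactly supported functions -/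
def Dsp (N : ℕ) : Submodule ℝ (EuclideanSpace ℝ (Fin N) → ℝ) where
  carrier := {v | ContDiff ℝ (⊤ : ℕ∞) v ∧ HasCompactSupport v}
  add_mem' := fun ha hb => ⟨ha.1.add hb.1, ha.2.add hb.2⟩
  zero_mem' := ⟨contDiff_const, HasCompactSupport.zero⟩
  smul_mem' := fun _ _ hv => ⟨contDiff_const.mul hv.1, hv.2.mul_left⟩

lemma grad_cont {v : EuclideanSpace ℝ (Fin N) → ℝ} (hv : ContDiff ℝ (⊤ : ℕ∞) v) : Continuous (gradient v) :=
  (InnerProductSpace.toDual ℝ _).symm.continuous.comp (hv.continuous_fderiv (by simp))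

lemma grad_supp {v : EuclideanSpace ℝ (Fin N) → ℝ} (hv : HasCompactSupport v) : HasCompactSupport (gradient v) :=
  (hv.fderiv ℝ).comp_left (g := (InnerProductSpace.toDual ℝ (EuclideanSpace ℝ (Fin N))).symm) (map_zero _)

lemma grad_memLp (v : Dsp N) : MemLp (gradient v.1) 2 (volume : Measure (EuclideanSpace ℝ (Fin N))) :=
  (grad_cont v.2.1).memLp_of_hasCompactSupport (grad_supp v.2.2)

/-- gradient as a map to L² -/
noncomputable def gradMap (N : ℕ) : Dsp N →ₗ[ℝ] Lp (EuclideanSpace ℝ (Fin N)) 2 (volume : Measure (EuclideanSpace ℝ (Fin N))) where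
  toFun v := (grad_memLp v).toLp _
  map_add' v w := by
    rw [← MemLp.toLp_add]
    congr 1
    funext x
    have h1 := v.2.1.differentiable (by simp) x
    have h2 := w.2.1.differentiable (by simp) x
    simp only [gradient, Submodule.coe_add, Pi.add_apply]
    rw [← map_add, fderiv_add h1 h2]
  map_smul' c v := by
    rw [RingHom.id_apply, ← MemLp.toLp_const_smul]
    congr 1
    funext x
    have h1 := v.2.1.differentiable (by simp) x
    simp only [gradient, Submodule.coe_smul, Pi.smul_apply]
    rw [fderiv_const_smul h1, map_smul]

variable (μ : Measure (EuclideanSpace ℝ (Fin N))) [IsFiniteMeasureOnCompacts μ]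

lemma emb_memLp (v : Dsp N) : MemLp v.1 2 μ :=
  v.2.1.continuous.memLp_of_hasCompactSupport v.2.2

/-- inclusion in weighted L² -/
noncomputable def emb : Dsp N →ₗ[ℝ] Lp ℝ 2 μ where
  toFun v := (emb_memLp μ v).toLp _
  map_add' v w := (MemLp.toLp_add (emb_memLp μ v) (emb_memLp μ w))
  map_smul' c v := (MemLp.toLp_const_smul c (emb_memLp μ v))

/-- homogeneous space -/
noncomputable abbrev Hs (N : ℕ) := (LinearMap.range (gradMap N)).topologicalClosure

/-- gradient into the homogeneous space -/
noncomputable def eMap (N : ℕ) : Dsp N →ₗ[ℝ] Hs N :=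
  (gradMap N).codRestrict _ fun v => Submodule.le_topologicalClosure _ (LinearMap.mem_range_self _ v)

lemma eMap_dense : DenseRange (eMap N) := by
  intro h
  rw [Metric.mem_closure_iff]
  intro ε hε
  obtain ⟨y, ⟨v, rfl⟩, hv⟩ := Metric.mem_closure_iff.1 h.2 ε hε
  exact ⟨eMap N v, ⟨v, rfl⟩, hv⟩

lemma norm_eMap (v : Dsp N) : ‖eMap N v‖ = ‖(grad_memLp v).toLp _‖ := rfl

/-- the embedding operator -/
noncomputable def iot : Hs N →L[ℝ] Lp ℝ 2 μ := (emb μ).extendOfNorm (eMap N)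

/-- Poincare inequality in operator form -/
def Poin : Prop := ∃ C : ℝ, ∀ v : Dsp N, ‖emb μ v‖ ≤ C * ‖eMap N v‖

variable {μ}

lemma iot_eq (hP : Poin μ) (v : Dsp N) : iot μ (eMap N v) = emb μ v :=
  LinearMap.extendOfNorm_eq eMap_dense hP v

/-- smooth reflection -/
noncomputable def eta (e s : ℝ) : ℝ := Real.sqrt (1 + e ^ 2) - Real.sqrt ((1 - s) ^ 2 + e ^ 2)

lemma eta_smooth {e : ℝ} (he : 0 < e) : ContDiff ℝ (⊤ : ℕ∞) (eta e) := by
  unfold eta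
  refine contDiff_const.sub (ContDiff.sqrt (by fun_prop) fun s => ?_)
  positivity

lemma eta_zero (e : ℝ) : eta e 0 = 0 := by simp [eta]

lemma eta_deriv {e : ℝ} (he : 0 < e) (s : ℝ) : |deriv (eta e) s| ≤ 1 := by
  have hpos : 0 < (1 - s) ^ 2 + e ^ 2 := by positivity
  have h1 : HasDerivAt (fun s : ℝ => (1 - s) ^ 2 + e ^ 2) (-2 * (1 - s)) s := by
    have := (((hasDerivAt_id s).const_sub 1).pow 2).add_const (e ^ 2)
    convert! this using 1
    simp
  have h2 : HasDerivAt (eta e) (-(-2 * (1 - s) / (2 * Real.sqrt ((1 - s) ^ 2 + e ^ 2)))) s :=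
    (h1.sqrt hpos.ne').const_sub _
  rw [h2.deriv]
  have hs : 0 < Real.sqrt ((1 - s) ^ 2 + e ^ 2) := Real.sqrt_pos.2 hpos
  have h3 : |1 - s| ≤ Real.sqrt ((1 - s) ^ 2 + e ^ 2) := Real.abs_le_sqrt (by nlinarith)
  rw [abs_neg, abs_div, abs_mul, abs_mul, abs_of_pos hs, div_le_one (by positivity)]
  simp only [abs_neg, abs_two]
  linarith

lemma eta_close {e : ℝ} (he : 0 < e) (s : ℝ) : |eta e s - refl.f s| ≤ e := by
  have key : ∀ a : ℝ, |a| ≤ Real.sqrt (a ^ 2 + e ^ 2) ∧ Real.sqrt (a ^ 2 + e ^ 2) ≤ |a| + e := fun a =>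
    ⟨Real.abs_le_sqrt (by nlinarith), by
      rw [Real.sqrt_le_left (by positivity)]
      nlinarith [sq_abs a, abs_nonneg a]⟩
  have h1 := key 1
  have h2 := key (1 - s)
  simp only [one_pow, abs_one] at h1
  simp only [eta, refl]
  rw [abs_le]
  constructor <;> linarith [h1.1, h1.2, h2.1, h2.2]

/-- composition with the smooth reflection -/
noncomputable def etaC {e : ℝ} (he : 0 < e) (v : Dsp N) : Dsp N :=
  ⟨fun x => eta e (v.1 x), (eta_smooth he).comp v.2.1, v.2.2.comp_left (eta_zero e)⟩

lemma etaC_grad {e : ℝ} (he : 0 < e) (v : Dsp N) : ‖eMap N (etaC he v)‖ ≤ ‖eMap N v‖ := by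
  have : ‖(grad_memLp (etaC he v)).toLp _‖ ≤ ‖(grad_memLp v).toLp _‖ := by
    refine Lp.norm_le_norm_of_ae_le ?_
    filter_upwards [(grad_memLp v).coeFn_toLp, (grad_memLp (etaC he v)).coeFn_toLp] with x h1 h2
    rw [h1, h2]
    simp only [gradient, LinearIsometryEquiv.norm_map]
    have h3 : HasFDerivAt (etaC he v).1 (deriv (eta e) (v.1 x) • fderiv ℝ v.1 x) x :=
      (((eta_smooth he).differentiable (by simp)) (v.1 x)).hasDerivAt.comp_hasFDerivAt x
        ((v.2.1.differentiable (by simp) x).hasFDerivAt)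
    rw [h3.fderiv, norm_smul, Real.norm_eq_abs]
    exact mul_le_of_le_one_left (norm_nonneg _) (eta_deriv he _)
  exact this

lemma norm_le_ind (f : Lp ℝ 2 μ) {K : Set (EuclideanSpace ℝ (Fin N))} (hK : IsCompact K) {e : ℝ} (he : 0 ≤ e)
    (h : ∀ᵐ x ∂μ, |f x| ≤ K.indicator (fun _ => e) x) : ‖f‖ ≤ e * (μ.real K) ^ (1 / 2 : ℝ) := by
  have hKf := hK.measure_lt_top (μ := μ).ne
  have h1 := Lp.norm_le_norm_of_ae_le (f := f) (g := indicatorConstLp 2 hK.measurableSet hKf e) (by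
    filter_upwards [h, indicatorConstLp_coeFn (p := 2) (hs := hK.measurableSet) (hμs := hKf) (c := e)] with x h1 h2
    rw [h2, Real.norm_eq_abs]
    exact h1.trans (le_abs_self _))
  refine h1.trans (le_of_eq ?_)
  rw [norm_indicatorConstLp (by norm_num) (by norm_num), Real.norm_of_nonneg he]
  norm_num

lemma etaC_close {e : ℝ} (he0 : 0 < e) (v : Dsp N) :
    ‖emb μ (etaC he0 v) - refl.app (emb μ v)‖ ≤ e * (μ.real (tsupport v.1)) ^ (1 / 2 : ℝ) := by
  refine norm_le_ind _ v.2.2 he0.le ?_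
  filter_upwards [Lp.coeFn_sub (emb μ (etaC he0 v)) (refl.app (emb μ v)), refl.coe_app (emb μ v),
    (emb_memLp μ v).coeFn_toLp, (emb_memLp μ (etaC he0 v)).coeFn_toLp] with x h1 h2 h3 h4
  have h3' : emb μ v x = v.1 x := h3
  have h4' : emb μ (etaC he0 v) x = eta e (v.1 x) := h4
  rw [h1, Pi.sub_apply, h2, h3', h4']
  by_cases hx : x ∈ tsupport v.1
  · rw [Set.indicator_of_mem hx]
    exact eta_close he0 _
  · rw [Set.indicator_of_notMem hx, image_eq_zero_of_notMem_tsupport hx, eta_zero, refl.zero]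
    simp

lemma iot_NC (hP : Poin μ) : NC (iot (N := N) μ) := by
  refine NC_of_dense (eMap N) eMap_dense _ fun v ε hε => ?_
  have hM0 : 0 ≤ (μ.real (tsupport v.1)) ^ (1 / 2 : ℝ) := by positivity
  have he0 : 0 < ε / ((μ.real (tsupport v.1)) ^ (1 / 2 : ℝ) + 1) := by positivity
  refine ⟨etaC he0 v, etaC_grad he0 v, ?_⟩
  rw [iot_eq hP, iot_eq hP]
  refine (etaC_close he0 v).trans ?_
  rw [div_mul_eq_mul_div, div_le_iff₀ (by positivity)]
  nlinarith

end conc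
end VWS

namespace VWS

lemma adj_of_dense {X : Type*} [MeasurableSpace X] {μ : Measure X}
    {H : Type*} [NormedAddCommGroup H] [InnerProductSpace ℝ H] [CompleteSpace H] {D : Type*}
    (e : D → H) (hd : DenseRange e) (ι : H →L[ℝ] Lp ℝ 2 μ) (g : H) (z : Lp ℝ 2 μ)
    (hyp : ∀ v, inner ℝ (ι (e v)) z = inner ℝ (e v) g) : ι.adjoint z = g := by
  refine ext_inner_left ℝ fun h => ?_
  refine hd.induction_on (p := fun h => inner ℝ h (ι.adjoint z) = inner ℝ h g) h
    (isClosed_eq (by fun_prop) (by fun_prop)) fun v => ?_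
  rw [ContinuousLinearMap.adjoint_inner_right]
  exact hyp v

section conc
variable {N : ℕ}

lemma dir_mem (φ : Dsp N) (y : EuclideanSpace ℝ (Fin N)) :
    (fun x => fderiv ℝ φ.1 x y) ∈ Dsp N :=
  ⟨(φ.2.1.fderiv_right (m := (⊤ : ℕ∞)) (by simp)).clm_apply contDiff_const, φ.2.2.fderiv_apply ℝ y⟩

lemma grad_coord (v : EuclideanSpace ℝ (Fin N) → ℝ) (x : EuclideanSpace ℝ (Fin N)) (i : Fin N) :
    gradient v x i = fderiv ℝ v x (EuclideanSpace.single i 1) := by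
  have h := InnerProductSpace.toDual_symm_apply (𝕜 := ℝ) (x := EuclideanSpace.single i (1 : ℝ)) (y := fderiv ℝ v x)
  rw [EuclideanSpace.inner_single_right] at h
  simpa [gradient] using h

lemma ibp (v φ : Dsp N) : ∫ x, inner ℝ (gradient v.1 x) (gradient φ.1 x) =
    - ∫ x, v.1 x * ∑ i, fderiv ℝ (fun y => fderiv ℝ φ.1 y (EuclideanSpace.single i 1)) x (EuclideanSpace.single i 1) := by
  have hint : ∀ a b : Dsp N, Integrable (fun x => a.1 x * b.1 x) volume := fun a b =>
    (a.2.1.continuous.mul b.2.1.continuous).integrable_of_hasCompactSupport a.2.2.mul_right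
  have h1 : ∀ x, inner ℝ (gradient v.1 x) (gradient φ.1 x) = ∑ i, fderiv ℝ v.1 x (EuclideanSpace.single i 1) *
      fderiv ℝ φ.1 x (EuclideanSpace.single i 1) := fun x => by
    rw [PiLp.inner_apply]
    refine Finset.sum_congr rfl fun i _ => ?_
    rw [grad_coord, grad_coord]
    simp [mul_comm]
  simp_rw [h1, Finset.mul_sum]
  rw [integral_finsetSum _ fun i _ => hint ⟨_, dir_mem v _⟩ ⟨_, dir_mem φ _⟩,
    integral_finsetSum _ fun i _ => hint v ⟨_, dir_mem ⟨_, dir_mem φ _⟩ _⟩, ← Finset.sum_neg_distrib]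
  refine Finset.sum_congr rfl fun i _ => ?_
  rw [integral_mul_fderiv_eq_neg_fderiv_mul_of_integrable (hint ⟨_, dir_mem v _⟩ ⟨_, dir_mem φ _⟩)
    (hint v ⟨_, dir_mem ⟨_, dir_mem φ _⟩ _⟩) (hint v ⟨_, dir_mem φ _⟩)
    (fun x _ => v.2.1.differentiable (by simp) x)
    (fun x _ => (dir_mem φ _).1.differentiable (by simp) x), neg_neg]

/-- continuous functions vanishing outside a compact cylinder -/
structure CC (K : Set (EuclideanSpace ℝ (Fin N))) (ψ : EuclideanSpace ℝ (Fin N) × ℝ → ℝ) : Prop where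
  hK : IsCompact K
  c : Continuous ψ
  uc : UniformContinuous ψ
  z : ∀ x t, x ∉ K → ψ (x, t) = 0

lemma CC.of_supp {ψ : EuclideanSpace ℝ (Fin N) × ℝ → ℝ} {S : Set (EuclideanSpace ℝ (Fin N) × ℝ)} (hS : IsCompact S)
    (c : Continuous ψ) (hs : HasCompactSupport ψ) (hz : ∀ y ∉ S, ψ y = 0) : CC (Prod.fst '' S) ψ :=
  ⟨hS.image continuous_fst, c, hs.uniformContinuous_of_continuous c,
    fun _ _ hx => hz _ fun h => hx ⟨_, h, rfl⟩⟩

variable {μ : Measure (EuclideanSpace ℝ (Fin N))} [IsFiniteMeasureOnCompacts μ]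
variable {K : Set (EuclideanSpace ℝ (Fin N))} {ψ ψ' : EuclideanSpace ℝ (Fin N) × ℝ → ℝ}

lemma CC.memLp (h : CC K ψ) (t : ℝ) : MemLp (fun x => ψ (x, t)) 2 μ :=
  (h.c.comp (by fun_prop : Continuous fun x : EuclideanSpace ℝ (Fin N) => (x, t))).memLp_of_hasCompactSupport
    (HasCompactSupport.intro h.hK fun x hx => h.z x t hx)

variable (μ) in
/-- time slices -/
noncomputable def CC.sl (h : CC K ψ) (t : ℝ) : Lp ℝ 2 μ := (h.memLp t).toLp _

lemma CC.sl_coe (h : CC K ψ) (t : ℝ) : ∀ᵐ x ∂μ, h.sl μ t x = ψ (x, t) := (h.memLp t).coeFn_toLp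

lemma exists_small (M : ℝ) (hM : 0 ≤ M) (ε : ℝ) (hε : 0 < ε) : ∃ e : ℝ, 0 < e ∧ e * M < ε := by
  refine ⟨ε / (M + 1), by positivity, ?_⟩
  rw [div_mul_eq_mul_div, div_lt_iff₀ (by positivity)]
  nlinarith

lemma CC.unif (h : CC K ψ) (e : ℝ) (he : 0 < e) : ∃ δ > 0, ∀ x s t, |s - t| < δ → |ψ (x, s) - ψ (x, t)| ≤ e := by
  obtain ⟨δ, hδ, hd⟩ := Metric.uniformContinuous_iff.1 h.uc e he
  refine ⟨δ, hδ, fun x s t hst => ?_⟩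
  have := hd (a := (x, s)) (b := (x, t)) (by
    rw [Prod.dist_eq, dist_self, Real.dist_eq]
    exact max_lt hδ hst)
  rw [Real.dist_eq] at this
  exact this.le

lemma CC.sl_cont (h : CC K ψ) : Continuous (h.sl μ) := by
  rw [Metric.continuous_iff]
  intro t ε hε
  obtain ⟨e, he, heM⟩ := exists_small ((μ.real K) ^ (1 / 2 : ℝ)) (by positivity) ε hε
  obtain ⟨δ, hδ, hd⟩ := h.unif e he
  refine ⟨δ, hδ, fun s hs => ?_⟩
  rw [Real.dist_eq] at hs
  rw [dist_eq_norm]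
  refine lt_of_le_of_lt (norm_le_ind _ h.hK he.le ?_) heM
  filter_upwards [Lp.coeFn_sub (h.sl μ s) (h.sl μ t), h.sl_coe s, h.sl_coe t] with x h1 h2 h3
  rw [h1, Pi.sub_apply, h2, h3]
  by_cases hx : x ∈ K
  · rw [Set.indicator_of_mem hx]; exact hd x s t hs
  · rw [Set.indicator_of_notMem hx, h.z x s hx, h.z x t hx]; simp

lemma CC.sl_der (h : CC K ψ) (h' : CC K ψ') (hder : ∀ x t, HasDerivAt (fun s => ψ (x, s)) (ψ' (x, t)) t) (t : ℝ) :
    HasDerivAt (h.sl μ) (h'.sl μ t) t := by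
  rw [hasDerivAt_iff_isLittleO, Asymptotics.isLittleO_iff]
  intro ε hε
  obtain ⟨e, he, heM⟩ := exists_small ((μ.real K) ^ (1 / 2 : ℝ)) (by positivity) ε hε
  obtain ⟨δ, hδ, hd⟩ := h'.unif e he
  filter_upwards [Metric.ball_mem_nhds t hδ] with s hs
  rw [Metric.mem_ball, Real.dist_eq] at hs
  have key : ‖h.sl μ s - h.sl μ t - (s - t) • h'.sl μ t‖ ≤ (e * |s - t|) * (μ.real K) ^ (1 / 2 : ℝ) := by
    refine norm_le_ind _ h.hK (by positivity) ?_
    filter_upwards [Lp.coeFn_sub (h.sl μ s - h.sl μ t) ((s - t) • h'.sl μ t), Lp.coeFn_sub (h.sl μ s) (h.sl μ t),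
      Lp.coeFn_smul (s - t) (h'.sl μ t), h.sl_coe s, h.sl_coe t, h'.sl_coe t] with x h1 h2 h3 h4 h5 h6
    rw [h1, Pi.sub_apply, h2, h3, Pi.sub_apply, Pi.smul_apply, h4, h5, h6, smul_eq_mul]
    by_cases hx : x ∈ K
    · rw [Set.indicator_of_mem hx]
      have g1 : ∀ r ∈ Set.uIcc t s, HasDerivWithinAt (fun r => ψ (x, r) - ψ' (x, t) * r)
          (ψ' (x, r) - ψ' (x, t) * 1) (Set.uIcc t s) r := fun r _ =>
        ((hder x r).sub ((hasDerivAt_id r).const_mul _)).hasDerivWithinAt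
      have g2 : ∀ r ∈ Set.uIcc t s, ‖ψ' (x, r) - ψ' (x, t) * 1‖ ≤ e := fun r hr => by
        rw [mul_one, Real.norm_eq_abs]
        exact hd x r t (lt_of_le_of_lt (Set.abs_sub_left_of_mem_uIcc hr) hs)
      have := (convex_uIcc t s).norm_image_sub_le_of_norm_hasDerivWithin_le g1 g2
        Set.left_mem_uIcc Set.right_mem_uIcc
      rw [Real.norm_eq_abs, Real.norm_eq_abs] at this
      refine le_trans (le_of_eq ?_) this
      congr 1; ring
    · rw [Set.indicator_of_notMem hx, h.z x s hx, h.z x t hx, h'.z x t hx]; simp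
  refine key.trans ?_
  rw [Real.norm_eq_abs]
  calc (e * |s - t|) * (μ.real K) ^ (1 / 2 : ℝ) = (e * (μ.real K) ^ (1 / 2 : ℝ)) * |s - t| := by ring
    _ ≤ ε * |s - t| := by gcongr

lemma CC.bdd (h : CC K ψ) (hs : HasCompactSupport ψ) : ∃ L : ℝ, 0 ≤ L ∧ ∀ t, ∀ᵐ x ∂μ, |h.sl μ t x| ≤ K.indicator (fun _ => L) x := by
  obtain ⟨L, hL⟩ := hs.exists_bound_of_continuous h.c
  refine ⟨L, (norm_nonneg _).trans (hL 0), fun t => ?_⟩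
  filter_upwards [h.sl_coe t] with x h1
  rw [h1]
  by_cases hx : x ∈ K
  · rw [Set.indicator_of_mem hx]; exact hL _
  · rw [Set.indicator_of_notMem hx, h.z x t hx]; simp

end conc
end VWS

namespace VWS
section conc
variable {N : ℕ}

/-- weighted measure -/
noncomputable abbrev wm (ρ : EuclideanSpace ℝ (Fin N) → ℝ) : Measure (EuclideanSpace ℝ (Fin N)) :=
  volume.withDensity fun x => ENNReal.ofReal (ρ x)

variable {ρ : EuclideanSpace ℝ (Fin N) → ℝ}

lemma integral_wm (hc : Continuous ρ) (hpos : ∀ x, 0 < ρ x) (f : EuclideanSpace ℝ (Fin N) → ℝ) :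
    ∫ x, f x ∂(wm ρ) = ∫ x, f x * ρ x := by
  rw [integral_withDensity_eq_integral_toReal_smul hc.measurable.ennreal_ofReal
    (Filter.Eventually.of_forall fun x => ENNReal.ofReal_lt_top)]
  refine integral_congr_ae (Filter.Eventually.of_forall fun x => ?_)
  simp only [ENNReal.toReal_ofReal (hpos x).le, smul_eq_mul]
  ring

lemma lintegral_wm (hc : Continuous ρ) {f : EuclideanSpace ℝ (Fin N) → ℝ} (hf : Measurable f) (hf0 : ∀ x, 0 ≤ f x) :
    ∫⁻ x, ENNReal.ofReal (f x) ∂(wm ρ) = ∫⁻ x, ENNReal.ofReal (f x * ρ x) := by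
  rw [lintegral_withDensity_eq_lintegral_mul _ hc.measurable.ennreal_ofReal hf.ennreal_ofReal]
  refine lintegral_congr fun x => ?_
  rw [Pi.mul_apply, ENNReal.ofReal_mul (hf0 x), mul_comm]

lemma poin (hc : Continuous ρ) (hpos : ∀ x, 0 < ρ x) [IsFiniteMeasureOnCompacts (wm ρ)] {Cp : ℝ}
    (hPoincare : ∀ v : EuclideanSpace ℝ (Fin N) → ℝ, ContDiff ℝ (⊤ : ℕ∞) v → HasCompactSupport v →
      (∫ x, v x ^ 2 * ρ x) ^ ((1 : ℝ) / 2) ≤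
        Cp⁻¹ * (∫ x, ‖fderiv ℝ v x‖ ^ 2) ^ ((1 : ℝ) / 2)) : Poin (wm ρ) := by
  refine ⟨Cp⁻¹, fun v => ?_⟩
  have h1 : ‖emb (wm ρ) v‖ = (∫ x, v.1 x ^ 2 * ρ x) ^ ((1 : ℝ) / 2) := by
    rw [← integral_wm hc hpos, ← Real.sqrt_eq_rpow, ← Real.sqrt_sq (norm_nonneg (emb (wm ρ) v)), norm_sq_eq]
    congr 1
    refine integral_congr_ae ?_
    filter_upwards [(emb_memLp (wm ρ) v).coeFn_toLp] with x hx
    have : emb (wm ρ) v x = v.1 x := hx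
    rw [this]
  have h2 : ‖eMap N v‖ = (∫ x, ‖fderiv ℝ v.1 x‖ ^ 2) ^ ((1 : ℝ) / 2) := by
    rw [norm_eMap, ← Real.sqrt_eq_rpow, ← Real.sqrt_sq (norm_nonneg ((grad_memLp v).toLp _)),
      ← real_inner_self_eq_norm_sq, L2.inner_def]
    congr 1
    refine integral_congr_ae ?_
    filter_upwards [(grad_memLp v).coeFn_toLp] with x hx
    rw [hx, real_inner_self_eq_norm_sq]
    simp [gradient]
  rw [h1, h2]
  exact hPoincare v.1 v.2.1 v.2.2

variable {φ : EuclideanSpace ℝ (Fin N) × ℝ → ℝ}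

lemma line_deriv (hφ : ContDiff ℝ (⊤ : ℕ∞) φ) (x y : EuclideanSpace ℝ (Fin N)) (t s : ℝ) :
    HasDerivAt (fun s : ℝ => φ (x + s • y, t)) (fderiv ℝ φ (x + s • y, t) (y, 0)) s := by
  have h1 : HasDerivAt (fun s : ℝ => (x + s • y, t)) (y, (0 : ℝ)) s := by
    have := ((hasDerivAt_id s).smul_const y).const_add x
    simp only [id, one_smul] at this
    exact this.prodMk (hasDerivAt_const s t)
  exact ((hφ.differentiable (by simp) _).hasFDerivAt).comp_hasDerivAt s h1

lemma time_deriv (hφ : ContDiff ℝ (⊤ : ℕ∞) φ) (x : EuclideanSpace ℝ (Fin N)) (t : ℝ) :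
    HasDerivAt (fun s : ℝ => φ (x, s)) (fderiv ℝ φ (x, t) (0, 1)) t :=
  ((hφ.differentiable (by simp) _).hasFDerivAt).comp_hasDerivAt t
    ((hasDerivAt_const t x).prodMk (hasDerivAt_id t))

lemma dir_smooth (hφ : ContDiff ℝ (⊤ : ℕ∞) φ) (y : EuclideanSpace ℝ (Fin N) × ℝ) :
    ContDiff ℝ (⊤ : ℕ∞) (fun z => fderiv ℝ φ z y) :=
  (hφ.fderiv_right (m := (⊤ : ℕ∞)) (by simp)).clm_apply contDiff_const

lemma slice_fderiv (hφ : ContDiff ℝ (⊤ : ℕ∞) φ) (x y : EuclideanSpace ℝ (Fin N)) (t : ℝ) :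
    fderiv ℝ (fun x => φ (x, t)) x y = fderiv ℝ φ (x, t) (y, 0) := by
  have h0 : HasFDerivAt (fun e : EuclideanSpace ℝ (Fin N) => (e, t)) (ContinuousLinearMap.inl ℝ (EuclideanSpace ℝ (Fin N)) ℝ) x :=
    hasFDerivAt_prodMk_left x t
  have h1 : HasFDerivAt φ (fderiv ℝ φ (x, t)) (x, t) := (hφ.differentiable (by simp) (x, t)).hasFDerivAt
  have h2 : fderiv ℝ (fun x => φ (x, t)) x = _ := (HasFDerivAt.comp x h1 h0).fderiv
  rw [h2]
  simp

/-- joint Laplacian -/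
noncomputable def lapJ (φ : EuclideanSpace ℝ (Fin N) × ℝ → ℝ) (z : EuclideanSpace ℝ (Fin N) × ℝ) : ℝ :=
  ∑ i : Fin N, fderiv ℝ (fun w => fderiv ℝ φ w (EuclideanSpace.single i 1, 0)) z (EuclideanSpace.single i 1, 0)

lemma lap_eq (hφ : ContDiff ℝ (⊤ : ℕ∞) φ) (x : EuclideanSpace ℝ (Fin N)) (t : ℝ) :
    lap (fun y => φ (y, t)) x = lapJ φ (x, t) := by
  unfold lap lapJ
  refine Finset.sum_congr rfl fun i _ => ?_
  have h1 : (deriv fun s : ℝ => φ (x + s • EuclideanSpace.single i (1 : ℝ), t)) =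
      fun s => fderiv ℝ φ (x + s • EuclideanSpace.single i (1 : ℝ), t) (EuclideanSpace.single i 1, 0) :=
    funext fun s => (line_deriv hφ x _ t s).deriv
  rw [h1, (line_deriv (dir_smooth hφ (EuclideanSpace.single i 1, 0)) x _ t 0).deriv, zero_smul, add_zero]

lemma lapJ_eq (hφ : ContDiff ℝ (⊤ : ℕ∞) φ) (x : EuclideanSpace ℝ (Fin N)) (t : ℝ) :
    ∑ i : Fin N, fderiv ℝ (fun y => fderiv ℝ (fun x => φ (x, t)) y (EuclideanSpace.single i 1)) x (EuclideanSpace.single i 1)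
      = lapJ φ (x, t) := by
  unfold lapJ
  refine Finset.sum_congr rfl fun i _ => ?_
  simp_rw [slice_fderiv hφ]
  exact slice_fderiv (dir_smooth hφ (EuclideanSpace.single i 1, 0)) x _ t

lemma dir_zero {y : EuclideanSpace ℝ (Fin N) × ℝ} {z : EuclideanSpace ℝ (Fin N) × ℝ} (hz : z ∉ tsupport φ) :
    fderiv ℝ φ z y = 0 := by
  have : fderiv ℝ φ z = 0 := Function.notMem_support.1 fun h => hz (support_fderiv_subset ℝ h)
  rw [this]; simp

lemma lapJ_zero {z : EuclideanSpace ℝ (Fin N) × ℝ} (hz : z ∉ tsupport φ) : lapJ φ z = 0 :=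
  Finset.sum_eq_zero fun i _ => dir_zero fun h => hz (tsupport_fderiv_apply_subset ℝ _ h)

lemma lapJ_cont (hφ : ContDiff ℝ (⊤ : ℕ∞) φ) : Continuous (lapJ φ) :=
  continuous_finsetSum _ fun i _ => (dir_smooth (dir_smooth hφ (EuclideanSpace.single i 1, 0)) _).continuous

lemma slice_mem (hφ : ContDiff ℝ (⊤ : ℕ∞) φ) (hs : HasCompactSupport φ) (t : ℝ) : (fun x => φ (x, t)) ∈ Dsp N :=
  ⟨hφ.comp (contDiff_id.prodMk contDiff_const), HasCompactSupport.intro (hs.image continuous_fst)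
    fun x hx => image_eq_zero_of_notMem_tsupport fun h => hx ⟨_, h, rfl⟩⟩

lemma exists_test (hc : Continuous ρ) (hpos : ∀ x, 0 < ρ x) [IsFiniteMeasureOnCompacts (wm ρ)] (hP : Poin (wm ρ))
    (hφ : ContDiff ℝ (⊤ : ℕ∞) φ) (hs : HasCompactSupport φ) {T : ℝ} (hT : ∀ x, φ (x, T) = 0) :
    ∃ (S : Set (EuclideanSpace ℝ (Fin N))) (L : ℝ) (f f' z : ℝ → Lp ℝ 2 (wm ρ)), Test (iot (wm ρ)) T S L f f' z ∧
      (∀ t, ∀ᵐ x ∂(wm ρ), f t x = φ (x, t)) ∧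
      (∀ t, ∀ᵐ x ∂(wm ρ), f' t x = deriv (fun s => φ (x, s)) t) ∧
      (∀ t, ∀ᵐ x ∂(wm ρ), z t x = - lap (fun y => φ (y, t)) x / ρ x) := by
  have c1 : CC (Prod.fst '' tsupport φ) φ := CC.of_supp hs hφ.continuous hs fun _ => image_eq_zero_of_notMem_tsupport
  have s2 : HasCompactSupport fun z => fderiv ℝ φ z (0, 1) := HasCompactSupport.intro hs fun z hz => dir_zero hz
  have c2 : CC (Prod.fst '' tsupport φ) fun z => fderiv ℝ φ z (0, 1) :=
    CC.of_supp hs (dir_smooth hφ _).continuous s2 fun z hz => dir_zero hz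
  have z3 : ∀ z ∉ tsupport φ, - lapJ φ z / ρ z.1 = 0 := fun z hz => by rw [lapJ_zero hz]; simp
  have s3 : HasCompactSupport fun z => - lapJ φ z / ρ z.1 := HasCompactSupport.intro hs z3
  have c3 : CC (Prod.fst '' tsupport φ) fun z => - lapJ φ z / ρ z.1 :=
    CC.of_supp hs ((lapJ_cont hφ).neg.div (hc.comp continuous_fst) fun z => (hpos _).ne') s3 z3
  obtain ⟨L1, hL1, b1⟩ := c1.bdd (μ := wm ρ) hs
  obtain ⟨L4, hL4, b2⟩ := c2.bdd (μ := wm ρ) s2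
  obtain ⟨L3, hL3, b3⟩ := c3.bdd (μ := wm ρ) s3
  refine ⟨Prod.fst '' tsupport φ, L1 + L4 + L3, c1.sl (wm ρ), c2.sl (wm ρ), c3.sl (wm ρ), ?_, c1.sl_coe, fun t => ?_, fun t => ?_⟩
  · have mono : ∀ L, L ≤ L1 + L4 + L3 → ∀ x, (Prod.fst '' tsupport φ).indicator (fun _ => L) x ≤
        (Prod.fst '' tsupport φ).indicator (fun _ => L1 + L4 + L3) x := fun L hL x =>
      Set.indicator_le_indicator hL
    refine ⟨c1.sl_der c2 (time_deriv hφ), c2.sl_cont, c3.sl_cont, fun t => ?_, ?_, c1.hK.measurableSet,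
      c1.hK.measure_lt_top.ne, by positivity, fun t => ?_, fun t => ?_, fun t => ?_⟩
    · have h1 : (iot (wm ρ)).adjoint (c3.sl (wm ρ) t) = eMap N ⟨_, slice_mem hφ hs t⟩ := by
        refine adj_of_dense (eMap N) eMap_dense _ _ _ fun v => ?_
        rw [iot_eq hP]
        have h2 : inner ℝ (eMap N v) (eMap N ⟨_, slice_mem hφ hs t⟩) =
            inner ℝ ((grad_memLp v).toLp _) ((grad_memLp ⟨_, slice_mem hφ hs t⟩).toLp _) := rfl
        rw [h2, inner_eq, MeasureTheory.L2.inner_def]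
        have h3 : ∫ x, emb (wm ρ) v x * c3.sl (wm ρ) t x ∂(wm ρ) = ∫ x, v.1 x * (- lapJ φ (x, t) / ρ x) ∂(wm ρ) := by
          refine integral_congr_ae ?_
          filter_upwards [c3.sl_coe t, (emb_memLp (wm ρ) v).coeFn_toLp] with x e1 e2
          have e3 : emb (wm ρ) v x = v.1 x := e2
          rw [e1, e3]
        have h4 : ∫ x, inner ℝ ((grad_memLp v).toLp _ x) ((grad_memLp ⟨_, slice_mem hφ hs t⟩).toLp _ x) =
            ∫ x, inner ℝ (gradient v.1 x) (gradient (fun x => φ (x, t)) x) := by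
          refine integral_congr_ae ?_
          filter_upwards [(grad_memLp v).coeFn_toLp, (grad_memLp ⟨_, slice_mem hφ hs t⟩).coeFn_toLp] with x e1 e2
          rw [e1, e2]
        rw [h3, h4, ibp v ⟨_, slice_mem hφ hs t⟩, integral_wm hc hpos, ← integral_neg]
        refine integral_congr_ae (Filter.Eventually.of_forall fun x => ?_)
        simp only [lapJ_eq hφ]
        have := (hpos x).ne'
        field_simp
      rw [h1, iot_eq hP]
      rfl
    · refine Lp.ext ?_
      filter_upwards [c1.sl_coe T, Lp.coeFn_zero ℝ 2 (wm ρ)] with x e1 e2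
      rw [e1, e2, hT]; rfl
    · filter_upwards [b1 t] with x hx using hx.trans (mono _ (by linarith) x)
    · filter_upwards [b2 t] with x hx using hx.trans (mono _ (by linarith) x)
    · filter_upwards [b3 t] with x hx using hx.trans (mono _ (by linarith) x)
  · filter_upwards [c2.sl_coe t] with x hx
    rw [hx, (time_deriv hφ x t).deriv]
  · filter_upwards [c3.sl_coe t] with x hx
    rw [hx, lap_eq hφ]

end conc
end VWS

/-- `L^q_ρ` estimate: for `u0 ∈ L^q_ρ ∩ L^m_ρ` nonnegative there is a
constant `C(q) > 0` such that for every `T > 0` there is a very weak solution `u` with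
`‖u(t)‖_{L^q_ρ} ≤ e^{C(q) t} ‖u0‖_{L^q_ρ}` for all `t > 0`. -/
theorem exists_veryWeakSolution_Lq_estimate
    (N : ℕ) (hN : 3 ≤ N) (m p : ℝ) (hp : 1 < p) (hpm : p < m)
    (ρ : EuclideanSpace ℝ (Fin N) → ℝ) (hρc : Continuous ρ)
    (hρb : ∃ M : ℝ, ∀ x, ρ x ≤ M) (hρpos : ∀ x, 0 < ρ x)
    (Cp : ℝ) (hCp : 0 < Cp)
    (hPoincare : ∀ v : EuclideanSpace ℝ (Fin N) → ℝ, ContDiff ℝ (⊤ : ℕ∞) v → HasCompactSupport v →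
      (∫ x, v x ^ 2 * ρ x) ^ ((1 : ℝ) / 2) ≤
        Cp⁻¹ * (∫ x, ‖fderiv ℝ v x‖ ^ 2) ^ ((1 : ℝ) / 2))
    (q : ℝ) (hq : 1 < q)
    (u0 : EuclideanSpace ℝ (Fin N) → ℝ) (hu0meas : Measurable u0)
    (hu0nonneg : ∀ x, 0 ≤ u0 x)
    (hu0m : Integrable (fun x => u0 x ^ m * ρ x))
    (hu0q : Integrable (fun x => u0 x ^ q * ρ x)) :
    ∃ C : ℝ, 0 < C ∧
      ∀ T : ℝ, 0 < T → ∃ u, IsVeryWeakSolution N m p T ρ u0 u ∧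
        ∀ t : ℝ, 0 < t →
          (∫ x, u x t ^ q * ρ x) ^ (1 / q) ≤
            Real.exp (C * t) * (∫ x, u0 x ^ q * ρ x) ^ (1 / q) := by
  have hlf : IsLocallyFiniteMeasure (VWS.wm ρ) := IsLocallyFiniteMeasure.withDensity_ofReal hρc
  have hP := VWS.poin hρc hρpos hPoincare
  obtain ⟨C, hC, hmain⟩ := VWS.abstract_main (VWS.iot (VWS.wm ρ)) (VWS.iot_NC hP) hp hpm hq
  refine ⟨C, hC, fun T hT => ?_⟩
  have hm0 : 0 < m := by linarith
  have hfin : ∀ (f : EuclideanSpace ℝ (Fin N) → ℝ) (r : ℝ), Measurable f → (∀ x, 0 ≤ f x) →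
      ∫⁻ x, ENNReal.ofReal (f x ^ r) ∂(VWS.wm ρ) = ∫⁻ x, ENNReal.ofReal (f x ^ r * ρ x) := fun f r hf h0 =>
    VWS.lintegral_wm hρc (hf.pow_const r) fun x => Real.rpow_nonneg (h0 x) r
  have hnn : ∀ (f : EuclideanSpace ℝ (Fin N) → ℝ) (r : ℝ), (∀ x, 0 ≤ f x) →
      ∀ x, 0 ≤ f x ^ r * ρ x := fun f r h0 x => mul_nonneg (Real.rpow_nonneg (h0 x) r) (hρpos x).le
  have hi : ∫⁻ x, ENNReal.ofReal (u0 x ^ m) ∂(VWS.wm ρ) ≠ ⊤ := by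
    rw [hfin u0 m hu0meas hu0nonneg]
    exact hu0m.lintegral_lt_top.ne
  obtain ⟨U, hU0, hUm, hUq, ⟨R, hR, hUR⟩, hw⟩ := hmain u0 hu0meas hu0nonneg hi T hT
  have hUx : ∀ t, Measurable fun x => U (x, t) := fun t => hUm.comp (measurable_id.prodMk measurable_const)
  refine ⟨fun x t => U (x, t), ⟨fun x t => hU0 _, hUm, ?_, ?_⟩, ?_⟩
  · have hmeas : Measurable fun z : EuclideanSpace ℝ (Fin N) × ℝ => U z ^ m * ρ z.1 :=
      (hUm.pow_const m).mul (hρc.measurable.comp measurable_fst)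
    refine ⟨hmeas.aestronglyMeasurable, ?_⟩
    rw [hasFiniteIntegral_iff_ofReal (Filter.Eventually.of_forall fun z =>
      mul_nonneg (Real.rpow_nonneg (hU0 _) m) (hρpos _).le)]
    rw [lintegral_prod_symm _ hmeas.ennreal_ofReal.aemeasurable]
    refine lt_of_le_of_lt (lintegral_mono (g := fun _ => R) fun t => ?_) ?_
    · have := hUR t
      rw [hfin _ m (hUx t) fun x => hU0 _] at this
      exact this
    · rw [lintegral_const]
      exact ENNReal.mul_lt_top hR.lt_top (by simp)
  · intro φ hφ hs hφT
    obtain ⟨S, L, f, f', z, hte, e0, e1, e2⟩ := VWS.exists_test hρc hρpos hP hφ hs hφT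
    have h := hw S L f f' z hte
    have a1 : ∀ t, ∫ x, U (x, t) * f' t x ∂(VWS.wm ρ) = ∫ x, U (x, t) * deriv (fun s => φ (x, s)) t * ρ x := fun t => by
      rw [← VWS.integral_wm hρc hρpos fun x => U (x, t) * deriv (fun s => φ (x, s)) t]
      refine integral_congr_ae ?_
      filter_upwards [e1 t] with x hx
      rw [hx]
    have a2 : ∀ t, ∫ x, U (x, t) ^ m * z t x ∂(VWS.wm ρ) = - ∫ x, U (x, t) ^ m * lap (fun y => φ (y, t)) x := fun t => by
      have : ∫ x, U (x, t) ^ m * z t x ∂(VWS.wm ρ) =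
          ∫ x, U (x, t) ^ m * (- lap (fun y => φ (y, t)) x / ρ x) ∂(VWS.wm ρ) := by
        refine integral_congr_ae ?_
        filter_upwards [e2 t] with x hx
        rw [hx]
      rw [this, VWS.integral_wm hρc hρpos, ← integral_neg]
      refine integral_congr_ae (Filter.Eventually.of_forall fun x => ?_)
      have := (hρpos x).ne'
      field_simp
    have a3 : ∀ t, ∫ x, U (x, t) ^ p * f t x ∂(VWS.wm ρ) = ∫ x, U (x, t) ^ p * φ (x, t) * ρ x := fun t => by
      rw [← VWS.integral_wm hρc hρpos fun x => U (x, t) ^ p * φ (x, t)]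
      refine integral_congr_ae ?_
      filter_upwards [e0 t] with x hx
      rw [hx]
    have a4 : ∫ x, u0 x * f 0 x ∂(VWS.wm ρ) = ∫ x, u0 x * φ (x, 0) * ρ x := by
      rw [← VWS.integral_wm hρc hρpos fun x => u0 x * φ (x, 0)]
      refine integral_congr_ae ?_
      filter_upwards [e0 0] with x hx
      rw [hx]
    simp_rw [a1, a2, a3, a4, integral_neg, integral_Icc_eq_integral_Ioo] at h
    linarith
  · intro t ht
    have hq0 : 0 < q := by linarith
    have h1 := hUq t ht
    rw [hfin _ q (hUx t) fun x => hU0 _, hfin _ q hu0meas hu0nonneg] at h1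
    have h2 : ∫ x, U (x, t) ^ q * ρ x ≤ Real.exp (C * t) * ∫ x, u0 x ^ q * ρ x := by
      rw [integral_eq_lintegral_of_nonneg_ae (Filter.Eventually.of_forall (hnn (fun x => U (x, t)) q fun x => hU0 _))
        (((hUx t).pow_const q).mul hρc.measurable).aestronglyMeasurable,
        integral_eq_lintegral_of_nonneg_ae (Filter.Eventually.of_forall (hnn u0 q hu0nonneg)) hu0q.1]
      refine (ENNReal.toReal_mono (ENNReal.mul_ne_top ENNReal.ofReal_ne_top hu0q.lintegral_lt_top.ne) h1).trans ?_
      rw [ENNReal.toReal_mul, ENNReal.toReal_ofReal (Real.exp_pos _).le]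
    have h3 : 0 ≤ ∫ x, u0 x ^ q * ρ x := integral_nonneg (hnn u0 q hu0nonneg)
    have h4 : 0 ≤ ∫ x, U (x, t) ^ q * ρ x := integral_nonneg (hnn (fun x => U (x, t)) q fun x => hU0 _)
    have h5 : Real.exp (C * t) ^ (1 / q) ≤ Real.exp (C * t) := by
      have h6 : 1 ≤ Real.exp (C * t) := Real.one_le_exp (by positivity)
      have h7 := Real.rpow_le_rpow_of_exponent_le h6 ((div_le_one hq0).2 hq.le)
      rwa [Real.rpow_one] at h7
    calc (∫ x, U (x, t) ^ q * ρ x) ^ (1 / q) ≤ (Real.exp (C * t) * ∫ x, u0 x ^ q * ρ x) ^ (1 / q) :=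
          Real.rpow_le_rpow h4 h2 (by positivity)
      _ = Real.exp (C * t) ^ (1 / q) * (∫ x, u0 x ^ q * ρ x) ^ (1 / q) := Real.mul_rpow (Real.exp_pos _).le h3
      _ ≤ _ := mul_le_mul_of_nonneg_right h5 (Real.rpow_nonneg h3 _)
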